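/- Let 0 < l < π/2. Consider the 1D system ∂_t g + 2G ∂_θ g = 2(sin θ · P + cos θ · ∂_θ P), ∂_t P + 2G ∂_θ P = P ∂_θ G on [0,l], where at each time G is the unique solution of ∂_{θθ}G + 4G = g with G(0) = G(l) = 0. Take initial data g₀ ≡ 0 and P₀(θ) = θ². Then the unique local-in-time C^∞ solution (g,P) cannot be extended past some finite time T*, and lim_{t→T*} ‖g(t,·)‖_{L^∞([0,l])} = +∞. -/

import Mathlib

open MeasureTheory Metric Set Filter Topology

noncomputable section

/-- A smooth solution on `[0,T) × [0,l]` of the 1D system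
`∂_t g + 2G ∂_θ g = 2(sin θ · P + cos θ · ∂_θ P)`, `∂_t P + 2G ∂_θ P = P ∂_θ G`,
where at each time `G` solves `G'' + 4G = g`, `G(0) = G(l) = 0`. -/
def IsSol1D (l T : ℝ) (g P G : ℝ → ℝ → ℝ) : Prop :=
  (∀ n : ℕ, ContDiffOn ℝ n (fun q : ℝ × ℝ => g q.1 q.2) (Ico (0:ℝ) T ×ˢ Icc (0:ℝ) l)) ∧
  (∀ n : ℕ, ContDiffOn ℝ n (fun q : ℝ × ℝ => P q.1 q.2) (Ico (0:ℝ) T ×ˢ Icc (0:ℝ) l)) ∧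
  (∀ n : ℕ, ContDiffOn ℝ n (fun q : ℝ × ℝ => G q.1 q.2) (Ico (0:ℝ) T ×ˢ Icc (0:ℝ) l)) ∧
  (∀ t ∈ Ico (0:ℝ) T, G t 0 = 0 ∧ G t l = 0 ∧ ∀ θ ∈ Icc (0:ℝ) l,
      derivWithin (fun θ' => derivWithin (G t) (Icc (0:ℝ) l) θ') (Icc (0:ℝ) l) θ
        + 4 * G t θ = g t θ) ∧
  (∀ t ∈ Ico (0:ℝ) T, ∀ θ ∈ Icc (0:ℝ) l,
      derivWithin (fun s => g s θ) (Ico (0:ℝ) T) t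
        + 2 * G t θ * derivWithin (g t) (Icc (0:ℝ) l) θ =
        2 * (Real.sin θ * P t θ + Real.cos θ * derivWithin (P t) (Icc (0:ℝ) l) θ)) ∧
  (∀ t ∈ Ico (0:ℝ) T, ∀ θ ∈ Icc (0:ℝ) l,
      derivWithin (fun s => P s θ) (Ico (0:ℝ) T) t
        + 2 * G t θ * derivWithin (P t) (Icc (0:ℝ) l) θ =
        P t θ * derivWithin (G t) (Icc (0:ℝ) l) θ)

/-- `u` is an integral curve of the vector field `F` on `(-ε, T)` starting at `u₀`. -/
def IsCurve {E : Type*} [NormedAddCommGroup E] [NormedSpace ℝ E] (F : E → E) (u₀ : E)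
    (ε T : ℝ) (u : ℝ → E) : Prop :=
  u 0 = u₀ ∧ ∀ t ∈ Ioo (-ε) T, HasDerivAt u (F (u t)) t

section Maximal

variable {E : Type*} [NormedAddCommGroup E] [NormedSpace ℝ E] {F : E → E} {u₀ : E}

theorem IsCurve.eqOn (hF : ContDiff ℝ 1 F) {ε T T' : ℝ} {u v : ℝ → E} (hε : 0 < ε)
    (hT : 0 < T) (hTT : T ≤ T') (hu : IsCurve F u₀ ε T u) (hv : IsCurve F u₀ ε T' v) :
    EqOn u v (Ioo (-ε) T) := by
  have h0 : (0:ℝ) ∈ Ioo (-ε) T := ⟨by linarith, hT⟩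
  have hvT : ∀ t ∈ Ioo (-ε) T, HasDerivAt v (F (v t)) t :=
    fun t ht => hv.2 t ⟨ht.1, ht.2.trans_le hTT⟩
  have hcu : ContinuousOn u (Ioo (-ε) T) := fun t ht => (hu.2 t ht).continuousAt.continuousWithinAt
  have hcv : ContinuousOn v (Ioo (-ε) T) := fun t ht => (hvT t ht).continuousAt.continuousWithinAt
  have hclosed : ∃ C, IsClosed C ∧ {t | t ∈ Ioo (-ε) T ∧ u t = v t} = C ∩ Ioo (-ε) T := by
    obtain ⟨C, hC, h⟩ := (continuousOn_iff_isClosed.1 (hcu.sub hcv)) {0} isClosed_singleton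
    refine ⟨C, hC, ?_⟩
    rw [← h]
    ext t
    simp [sub_eq_zero, and_comm]
  have hopen : IsOpen {t | t ∈ Ioo (-ε) T ∧ u t = v t} := by
    rw [isOpen_iff_mem_nhds]
    rintro t ⟨ht, htuv⟩
    obtain ⟨K, s, hs, hl⟩ := (hF.contDiffAt (x := u t)).exists_lipschitzOnWith
    have hI : Ioo (-ε) T ∈ 𝓝 t := isOpen_Ioo.mem_nhds ht
    have e1 : ∀ᶠ x in 𝓝 t, HasDerivAt u (F (u x)) x ∧ u x ∈ s := by
      filter_upwards [hI, (hu.2 t ht).continuousAt hs] with x hx hxs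
      exact ⟨hu.2 x hx, hxs⟩
    have e2 : ∀ᶠ x in 𝓝 t, HasDerivAt v (F (v x)) x ∧ v x ∈ s := by
      have hs' : s ∈ 𝓝 (v t) := htuv ▸ hs
      filter_upwards [hI, (hvT t ht).continuousAt hs'] with x hx hxs
      exact ⟨hvT x hx, hxs⟩
    have := ODE_solution_unique_of_eventually (v := fun _ => F) (s := fun _ => s) (K := K)
      (t₀ := t) (Eventually.of_forall fun _ => hl) e1 e2 htuv
    filter_upwards [hI, this] with x hx hxe using ⟨hx, hxe⟩
  have hsub : Ioo (-ε) T ⊆ {t | t ∈ Ioo (-ε) T ∧ u t = v t} := by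
    obtain ⟨C, hC, hCe⟩ := hclosed
    refine isPreconnected_Ioo.subset_of_closure_inter_subset hopen ⟨0, h0, h0, ?_⟩ ?_
    · rw [hu.1, hv.1]
    · rintro x ⟨hx, hxI⟩
      have : x ∈ C := by
        refine closure_minimal ?_ hC hx
        rw [hCe]; exact inter_subset_left
      rw [hCe]; exact ⟨this, hxI⟩
  exact fun t ht => (hsub ht).2

/-- An integral curve with a limit at the right end point can be continued. -/
theorem IsCurve.extend [CompleteSpace E] (hF : ContDiff ℝ 1 F) {ε T : ℝ} {u : ℝ → E}
    (hT : 0 < T) (hu : IsCurve F u₀ ε T u) {v : E}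
    (hv : Tendsto u (𝓝[<] T) (𝓝 v)) : ∃ T' > T, ∃ w, IsCurve F u₀ ε T' w := by
  obtain ⟨w, hw0, δ, hδ, hw⟩ :=
    (hF.contDiffAt (x := v)).exists_forall_mem_closedBall_exists_eq_forall_mem_Ioo_hasDerivAt₀ T
  set y : ℝ → E := fun t => if t < T then u t else w t with hy
  have hyT : y T = v := by simp [hy, hw0]
  have hylt : ∀ t < T, y =ᶠ[𝓝 t] u := fun t ht => by
    filter_upwards [isOpen_Iio.mem_nhds ht] with x hx
    exact if_pos hx
  have hygt : ∀ t > T, y =ᶠ[𝓝 t] w := fun t ht => by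
    filter_upwards [isOpen_Ioi.mem_nhds ht] with x hx
    exact if_neg (not_lt.2 (le_of_lt hx))
  refine ⟨T + δ, by linarith, y, ?_, fun t ht => ?_⟩
  · rw [← hu.1]; exact if_pos hT
  rcases lt_trichotomy t T with h | h | h
  · rw [(hylt t h).eq_of_nhds]
    exact (hu.2 t ⟨ht.1, h⟩).congr_of_eventuallyEq (hylt t h)
  · subst h
    rw [hyT]
    have hr : HasDerivWithinAt y (F v) (Ici t) t := by
      have := (hw t ⟨by linarith, by linarith⟩).hasDerivWithinAt (s := Ici t)
      rw [hw0] at this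
      exact this.congr (fun x hx => if_neg (not_lt.2 hx)) (by rw [hyT, hw0])
    have hIoo : Ioo (-ε) t ∈ 𝓝[<] t := Ioo_mem_nhdsLT ht.1
    have hl : HasDerivWithinAt y (F v) (Iic t) t := by
      refine hasDerivWithinAt_Iic_of_tendsto_deriv (s := Ioo (-ε) t) ?_ ?_ hIoo ?_
      · intro x hx
        exact ((hu.2 x hx).congr_of_eventuallyEq
          (hylt x hx.2)).differentiableAt.differentiableWithinAt
      · refine ContinuousWithinAt.mono (t := Iio t) ?_ (fun x hx => hx.2)
        rw [ContinuousWithinAt, hyT]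
        refine hv.congr' ?_
        filter_upwards [self_mem_nhdsWithin] with x hx
        exact (if_pos hx).symm
      · refine ((hF.continuous.tendsto v).comp hv).congr' ?_
        filter_upwards [hIoo] with x hx
        exact ((hu.2 x hx).congr_of_eventuallyEq (hylt x hx.2)).deriv.symm
    simpa using hl.union hr
  · rw [(hygt t h).eq_of_nhds]
    exact (hw t ⟨by linarith, ht.2⟩).congr_of_eventuallyEq (hygt t h)

/-- A vector field all of whose integral curves from `u₀` have bounded life span admits a
maximal one, and this has no limit at the right end point. -/
theorem exists_maximal_curve [CompleteSpace E] (hF : ContDiff ℝ 1 F) (u₀ : E) {B : ℝ}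
    (hB : ∀ ε > 0, ∀ T u, IsCurve F u₀ ε T u → T ≤ B) :
    ∃ ε > 0, ∃ T > 0, ∃ u, IsCurve F u₀ ε T u ∧ ∀ v, ¬ Tendsto u (𝓝[<] T) (𝓝 v) := by
  obtain ⟨w, hw0, ε, hε, hw⟩ :=
    (hF.contDiffAt (x := u₀)).exists_forall_mem_closedBall_exists_eq_forall_mem_Ioo_hasDerivAt₀ 0
  set S : Set ℝ := {T | ∃ u, IsCurve F u₀ ε T u} with hS
  have hεS : ε ∈ S := ⟨w, hw0, fun t ht => hw t (by simpa using ht)⟩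
  have hbdd : BddAbove S := ⟨B, by rintro T ⟨u, hu⟩; exact hB ε hε T u hu⟩
  set Tm := sSup S with hTm
  have hTpos : 0 < Tm := hε.trans_le (le_csSup hbdd hεS)
  have hex : ∀ t < Tm, ∃ T, t < T ∧ 0 < T ∧ ∃ u, IsCurve F u₀ ε T u := by
    intro t ht
    obtain ⟨T, ⟨u, hu⟩, hT⟩ := exists_lt_of_lt_csSup ⟨ε, hεS⟩ (max_lt ht hTpos)
    exact ⟨T, (le_max_left _ _).trans_lt hT, (le_max_right _ _).trans_lt hT, u, hu⟩
  choose! τ hτ1 hτ2 U hU using hex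
  have huniq : ∀ s t, -ε < s → s < τ t → s < Tm → t < Tm → U s s = U t s := by
    intro s t h1 h2 h3 h4
    rcases le_total (τ s) (τ t) with h | h
    · exact (hU s h3).eqOn hF hε (hτ2 s h3) h (hU t h4) ⟨h1, hτ1 s h3⟩
    · exact ((hU t h4).eqOn hF hε (hτ2 t h4) h (hU s h3) ⟨h1, h2⟩).symm
  have hcurve : IsCurve F u₀ ε Tm (fun t => U t t) := by
    refine ⟨(hU 0 hTpos).1, fun t ht => ?_⟩
    refine ((hU t ht.2).2 t ⟨ht.1, hτ1 t ht.2⟩).congr_of_eventuallyEq ?_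
    filter_upwards [isOpen_Ioo.mem_nhds (show t ∈ Ioo (-ε) (min (τ t) Tm) from
      ⟨ht.1, lt_min (hτ1 t ht.2) ht.2⟩)] with s hs
    exact huniq s t hs.1 (hs.2.trans_le (min_le_left _ _)) (hs.2.trans_le (min_le_right _ _)) ht.2
  refine ⟨ε, hε, Tm, hTpos, _, hcurve, fun v hv => ?_⟩
  obtain ⟨T', hT', y, hy⟩ := hcurve.extend hF hTpos hv
  exact absurd (le_csSup hbdd ⟨y, hy⟩) (not_le.2 hT')

end Maximal

section Superposition

variable {Y : Type*} [TopologicalSpace Y]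

/-- `exp ∘ ψ` as a continuous function. -/
def expC (ψ : C(Y, ℝ)) : C(Y, ℝ) := (⟨Real.exp, Real.continuous_exp⟩ : C(ℝ, ℝ)).comp ψ

/-- `sin ∘ ψ` as a continuous function. -/
def sinC (ψ : C(Y, ℝ)) : C(Y, ℝ) := (⟨Real.sin, Real.continuous_sin⟩ : C(ℝ, ℝ)).comp ψ

/-- `cos ∘ ψ` as a continuous function. -/
def cosC (ψ : C(Y, ℝ)) : C(Y, ℝ) := (⟨Real.cos, Real.continuous_cos⟩ : C(ℝ, ℝ)).comp ψ

@[simp] theorem expC_apply (ψ : C(Y, ℝ)) (y : Y) : expC ψ y = Real.exp (ψ y) := rfl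

@[simp] theorem sinC_apply (ψ : C(Y, ℝ)) (y : Y) : sinC ψ y = Real.sin (ψ y) := rfl

@[simp] theorem cosC_apply (ψ : C(Y, ℝ)) (y : Y) : cosC ψ y = Real.cos (ψ y) := rfl

variable [CompactSpace Y]

/-- The superposition operator `φ ↦ f ∘ φ` of a `C¹` function on the space of continuous
functions is differentiable. -/
theorem hasFDerivAt_comp_left (f f' : C(ℝ, ℝ)) (hf : ∀ x, HasDerivAt f (f' x) x) (φ : C(Y, ℝ)) :
    HasFDerivAt (fun ψ : C(Y, ℝ) => f.comp ψ)
      (ContinuousLinearMap.mul ℝ C(Y, ℝ) (f'.comp φ)) φ := by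
  rw [hasFDerivAt_iff_isLittleO_nhds_zero, Asymptotics.isLittleO_iff]
  intro c hc
  have hcont : ContinuousAt (fun ψ : C(Y, ℝ) => f'.comp ψ) φ :=
    (ContinuousMap.continuous_postcomp f').continuousAt
  obtain ⟨δ, hδ, hball⟩ := Metric.continuousAt_iff.1 hcont c hc
  filter_upwards [Metric.ball_mem_nhds (0 : C(Y, ℝ)) hδ] with h hh
  rw [ContinuousMap.norm_le _ (by positivity)]
  intro y
  have hd : ∀ s ∈ Icc (0:ℝ) 1,
      HasDerivWithinAt (fun s : ℝ => f (φ y + s * h y) - s * (f' (φ y) * h y))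
        (f' (φ y + s * h y) * h y - f' (φ y) * h y) (Icc 0 1) s := by
    intro s _
    have h1 : HasDerivAt (fun s : ℝ => φ y + s * h y) (h y) s := by
      simpa using ((hasDerivAt_id s).mul_const (h y)).const_add (φ y)
    have h2 := (hf (φ y + s * h y)).comp s h1
    have h3 : HasDerivAt (fun s : ℝ => s * (f' (φ y) * h y)) (f' (φ y) * h y) s := by
      simpa using (hasDerivAt_id s).mul_const (f' (φ y) * h y)
    exact (h2.sub h3).hasDerivWithinAt
  have hb : ∀ s ∈ Icc (0:ℝ) 1, ‖f' (φ y + s * h y) * h y - f' (φ y) * h y‖ ≤ c * ‖h‖ := by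
    intro s hs
    rw [← sub_mul, norm_mul]
    refine mul_le_mul ?_ (h.norm_coe_le_norm y) (norm_nonneg _) hc.le
    have hs' : dist (φ + s • h) φ < δ := by
      rw [dist_eq_norm, add_sub_cancel_left, norm_smul, Real.norm_of_nonneg hs.1]
      have : ‖h‖ < δ := by simpa using hh
      nlinarith [hs.2, norm_nonneg h]
    have := (ContinuousMap.dist_apply_le_dist y).trans (hball hs').le
    simpa [dist_eq_norm] using this
  have := (convex_Icc (0:ℝ) 1).norm_image_sub_le_of_norm_hasDerivWithin_le hd hb
    (left_mem_Icc.2 zero_le_one) (right_mem_Icc.2 zero_le_one)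
  simp only [one_mul, zero_mul, add_zero, sub_zero, norm_one, mul_one] at this
  refine le_of_eq_of_le ?_ this
  simp only [ContinuousMap.coe_sub, Pi.sub_apply, ContinuousMap.comp_apply,
    ContinuousMap.coe_add, Pi.add_apply, ContinuousLinearMap.mul_apply', ContinuousMap.coe_mul,
    Pi.mul_apply]
  congr 1
  ring

theorem contDiff_comp_left (f f' : C(ℝ, ℝ)) (hf : ∀ x, HasDerivAt f (f' x) x) :
    ContDiff ℝ 1 (fun ψ : C(Y, ℝ) => f.comp ψ) := by
  rw [contDiff_one_iff_hasFDerivAt]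
  exact ⟨_, (ContinuousLinearMap.mul ℝ C(Y, ℝ)).continuous.comp
    (ContinuousMap.continuous_postcomp f'), hasFDerivAt_comp_left f f' hf⟩

@[fun_prop] theorem contDiff_expC : ContDiff ℝ 1 (expC : C(Y, ℝ) → C(Y, ℝ)) :=
  contDiff_comp_left _ ⟨Real.exp, Real.continuous_exp⟩ Real.hasDerivAt_exp

@[fun_prop] theorem contDiff_sinC : ContDiff ℝ 1 (sinC : C(Y, ℝ) → C(Y, ℝ)) :=
  contDiff_comp_left _ ⟨Real.cos, Real.continuous_cos⟩ Real.hasDerivAt_sin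

@[fun_prop] theorem contDiff_cosC : ContDiff ℝ 1 (cosC : C(Y, ℝ) → C(Y, ℝ)) :=
  contDiff_comp_left _ ⟨fun x => -Real.sin x, Real.continuous_sin.neg⟩ Real.hasDerivAt_cos

end Superposition

section Primitive

variable {l : ℝ} (hl : 0 ≤ l)

/-- The constant extension to the line of a function on `[0, l]`. -/
def icExt (f : C(Icc (0:ℝ) l, ℝ)) (b : ℝ) : ℝ := f (projIcc 0 l hl b)

theorem icExt_of_mem (f : C(Icc (0:ℝ) l, ℝ)) {b : ℝ} (hb : b ∈ Icc (0:ℝ) l) :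
    icExt hl f b = f ⟨b, hb⟩ := by rw [icExt, projIcc_of_mem]

theorem continuous_icExt (f : C(Icc (0:ℝ) l, ℝ)) : Continuous (icExt hl f) :=
  f.continuous.comp continuous_projIcc

/-- The primitive vanishing at `0`, as a continuous linear operator on `C([0, l])`. -/
def prim : C(Icc (0:ℝ) l, ℝ) →L[ℝ] C(Icc (0:ℝ) l, ℝ) :=
  LinearMap.mkContinuous
    { toFun := fun f => ⟨fun a => ∫ b in (0:ℝ)..a, icExt hl f b,
        (intervalIntegral.continuous_primitive
          (fun _ _ => (continuous_icExt hl f).intervalIntegrable _ _) 0).comp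
            continuous_subtype_val⟩
      map_add' := fun f g => by
        ext a
        exact intervalIntegral.integral_add ((continuous_icExt hl f).intervalIntegrable _ _)
          ((continuous_icExt hl g).intervalIntegrable _ _)
      map_smul' := fun c f => by
        ext a
        exact intervalIntegral.integral_const_mul c _ }
    l (fun f => by
      rw [ContinuousMap.norm_le _ (mul_nonneg hl (norm_nonneg _))]
      intro a
      refine (intervalIntegral.norm_integral_le_of_norm_le_const (C := ‖f‖)
        fun b _ => f.norm_coe_le_norm _).trans ?_
      rw [mul_comm, sub_zero, abs_of_nonneg a.2.1]
      exact mul_le_mul_of_nonneg_right a.2.2 (norm_nonneg _))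

/-- The constant function with the value of `f` at the right end point. -/
def rightConst : C(Icc (0:ℝ) l, ℝ) →L[ℝ] C(Icc (0:ℝ) l, ℝ) :=
  LinearMap.mkContinuous
    { toFun := fun f => ContinuousMap.const _ (f ⟨l, hl, le_rfl⟩)
      map_add' := fun _ _ => rfl
      map_smul' := fun _ _ => rfl }
    1 (fun f => by
      rw [ContinuousMap.norm_le _ (by positivity)]
      intro a
      simpa using! f.norm_coe_le_norm _)

end Primitive

section VectorField

variable {l : ℝ} (hl : 0 ≤ l)

/-- The label function `a ↦ a`. -/
def labelC : C(Icc (0:ℝ) l, ℝ) := ⟨Subtype.val, continuous_subtype_val⟩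

/-- Flow map, as the primitive of its Jacobian `exp (2z)`. -/
def phiC (z : C(Icc (0:ℝ) l, ℝ)) : C(Icc (0:ℝ) l, ℝ) := prim hl (expC ((2:ℝ) • z))

/-- `∫₀^φ sin(2y) g(y) dy` in Lagrangian coordinates. -/
def alpC (z h : C(Icc (0:ℝ) l, ℝ)) : C(Icc (0:ℝ) l, ℝ) :=
  prim hl (sinC ((2:ℝ) • phiC hl z) * h * expC ((2:ℝ) • z))

/-- The integrand of `betC`. -/
def betDensC (z h : C(Icc (0:ℝ) l, ℝ)) : C(Icc (0:ℝ) l, ℝ) :=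
  sinC (ContinuousMap.const _ (2 * l) - (2:ℝ) • phiC hl z) * h * expC ((2:ℝ) • z)

/-- `∫_φ^l sin(2(l - y)) g(y) dy` in Lagrangian coordinates. -/
def betC (z h : C(Icc (0:ℝ) l, ℝ)) : C(Icc (0:ℝ) l, ℝ) :=
  rightConst hl (prim hl (betDensC hl z h)) - prim hl (betDensC hl z h)

/-- The stream function `G` in Lagrangian coordinates. -/
def gamC (z h : C(Icc (0:ℝ) l, ℝ)) : C(Icc (0:ℝ) l, ℝ) :=
  (-(2 * Real.sin (2 * l))⁻¹) • (sinC (ContinuousMap.const _ (2 * l) - (2:ℝ) • phiC hl z)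
    * alpC hl z h + sinC ((2:ℝ) • phiC hl z) * betC hl z h)

/-- The derivative `∂_θ G` in Lagrangian coordinates. -/
def lamC (z h : C(Icc (0:ℝ) l, ℝ)) : C(Icc (0:ℝ) l, ℝ) :=
  (Real.sin (2 * l))⁻¹ • (cosC (ContinuousMap.const _ (2 * l) - (2:ℝ) • phiC hl z)
    * alpC hl z h - cosC ((2:ℝ) • phiC hl z) * betC hl z h)

/-- The coefficient `2 a² cos φ exp (-z)`. -/
def coefC (z : C(Icc (0:ℝ) l, ℝ)) : C(Icc (0:ℝ) l, ℝ) :=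
  (2:ℝ) • (labelC * labelC * cosC (phiC hl z) * expC (-z))

/-- The Lagrangian form of the system, with unknowns `z = ½ log ∂_aφ`, `m = ∂_a z`, `h = g ∘ φ`
and two solutions of the homogeneous part of the linear system for `(m, h)`. -/
def lagField (u : Fin 7 → C(Icc (0:ℝ) l, ℝ)) : Fin 7 → C(Icc (0:ℝ) l, ℝ) :=
  ![lamC hl (u 0) (u 2),
    expC ((2:ℝ) • u 0) * (u 2 - (4:ℝ) • gamC hl (u 0) (u 2)),
    (2:ℝ) • (labelC * labelC * sinC (phiC hl (u 0)) * expC (u 0)) +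
      (4:ℝ) • (labelC * cosC (phiC hl (u 0)) * expC (-u 0)) + coefC hl (u 0) * u 1,
    expC ((2:ℝ) • u 0) * u 4,
    coefC hl (u 0) * u 3,
    expC ((2:ℝ) • u 0) * u 6,
    coefC hl (u 0) * u 5]

/-- Initial data for `lagField`. -/
def lagInit : Fin 7 → C(Icc (0:ℝ) l, ℝ) := ![0, 0, 0, 1, 0, 0, 1]

theorem contDiff_lagField : ContDiff ℝ 1 (lagField hl) := by
  rw [contDiff_pi]
  intro i
  fin_cases i <;> simp only [lagField, lamC, gamC, coefC, betC, betDensC, alpC, phiC] <;>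
    simp <;> fun_prop

end VectorField

section Partials

variable {I K : Set ℝ} {f ft fa : ℝ × ℝ → ℝ}

/-- A function on a product of convex sets with continuous partial derivatives is
differentiable. -/
theorem hasFDerivWithinAt_of_partials (hI : Convex ℝ I) (hK : Convex ℝ K)
    (hft : ContinuousOn ft (I ×ˢ K)) (hfa : ContinuousOn fa (I ×ˢ K))
    (ht : ∀ t ∈ I, ∀ a ∈ K, HasDerivWithinAt (fun s => f (s, a)) (ft (t, a)) I t)
    (ha : ∀ t ∈ I, ∀ a ∈ K, HasDerivWithinAt (fun b => f (t, b)) (fa (t, a)) K a)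
    {p : ℝ × ℝ} (hp : p ∈ I ×ˢ K) :
    HasFDerivWithinAt f
      (ft p • ContinuousLinearMap.fst ℝ ℝ ℝ + fa p • ContinuousLinearMap.snd ℝ ℝ ℝ) (I ×ˢ K) p := by
  rw [hasFDerivWithinAt_iff_isLittleO, Asymptotics.isLittleO_iff]
  intro c hc
  obtain ⟨δ₁, hδ₁, h₁⟩ := Metric.continuousWithinAt_iff.1 (hft p hp) (c / 2) (half_pos hc)
  obtain ⟨δ₂, hδ₂, h₂⟩ := Metric.continuousWithinAt_iff.1 (hfa p hp) (c / 2) (half_pos hc)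
  have hball : ball p (min δ₁ δ₂) ∈ 𝓝[I ×ˢ K] p :=
    mem_nhdsWithin_of_mem_nhds (ball_mem_nhds _ (lt_min hδ₁ hδ₂))
  filter_upwards [hball, self_mem_nhdsWithin] with q hq hqD
  obtain ⟨t₀, a₀⟩ := p
  obtain ⟨t, a⟩ := q
  obtain ⟨ht₀, ha₀⟩ := hp
  obtain ⟨htI, haK⟩ := hqD
  simp only [mem_ball, Prod.dist_eq, max_lt_iff, lt_min_iff] at hq ht₀ ha₀ htI haK h₁ h₂
  obtain ⟨⟨htδ₁, haδ₁⟩, htδ₂, haδ₂⟩ := hq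
  have e₁ : ‖(f (t, a) - t * ft (t₀, a₀)) - (f (t₀, a) - t₀ * ft (t₀, a₀))‖
      ≤ c / 2 * ‖t - t₀‖ := by
    refine (hI.inter (convex_ball t₀ δ₁)).norm_image_sub_le_of_norm_hasDerivWithin_le
      (f := fun s => f (s, a) - s * ft (t₀, a₀)) (f' := fun s => ft (s, a) - 1 * ft (t₀, a₀))
      (fun s hs => ?_) (fun s hs => ?_) ⟨ht₀, mem_ball_self hδ₁⟩ ⟨htI, htδ₁⟩
    · exact ((ht s hs.1 a haK).mono inter_subset_left).sub
        ((hasDerivWithinAt_id s _).mul_const _)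
    · rw [one_mul, ← dist_eq_norm]
      exact (h₁ (x := (s, a)) ⟨hs.1, haK⟩ ⟨hs.2, haδ₁⟩).le
  have e₂ : ‖(f (t₀, a) - a * fa (t₀, a₀)) - (f (t₀, a₀) - a₀ * fa (t₀, a₀))‖
      ≤ c / 2 * ‖a - a₀‖ := by
    refine (hK.inter (convex_ball a₀ δ₂)).norm_image_sub_le_of_norm_hasDerivWithin_le
      (f := fun s => f (t₀, s) - s * fa (t₀, a₀)) (f' := fun s => fa (t₀, s) - 1 * fa (t₀, a₀))
      (fun s hs => ?_) (fun s hs => ?_) ⟨ha₀, mem_ball_self hδ₂⟩ ⟨haK, haδ₂⟩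
    · exact ((ha t₀ ht₀ s hs.1).mono inter_subset_left).sub
        ((hasDerivWithinAt_id s _).mul_const _)
    · rw [one_mul, ← dist_eq_norm]
      exact (h₂ (x := (t₀, s)) ⟨ht₀, hs.1⟩ ⟨by simpa using hδ₂, hs.2⟩).le
  have n₁ : ‖t - t₀‖ ≤ ‖(t, a) - (t₀, a₀)‖ := norm_fst_le ((t, a) - (t₀, a₀))
  have n₂ : ‖a - a₀‖ ≤ ‖(t, a) - (t₀, a₀)‖ := norm_snd_le ((t, a) - (t₀, a₀))
  calc _ = ‖((f (t, a) - t * ft (t₀, a₀)) - (f (t₀, a) - t₀ * ft (t₀, a₀)))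
        + ((f (t₀, a) - a * fa (t₀, a₀)) - (f (t₀, a₀) - a₀ * fa (t₀, a₀)))‖ := by
        congr 1
        simp
        ring
    _ ≤ c / 2 * ‖t - t₀‖ + c / 2 * ‖a - a₀‖ := (norm_add_le _ _).trans (add_le_add e₁ e₂)
    _ ≤ c * ‖(t, a) - (t₀, a₀)‖ := by nlinarith

theorem contDiffOn_succ_of_partials (hI : Convex ℝ I) (hK : Convex ℝ K)
    (huI : UniqueDiffOn ℝ I) (huK : UniqueDiffOn ℝ K) {n : ℕ}
    (hft : ContDiffOn ℝ n ft (I ×ˢ K)) (hfa : ContDiffOn ℝ n fa (I ×ˢ K))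
    (ht : ∀ t ∈ I, ∀ a ∈ K, HasDerivWithinAt (fun s => f (s, a)) (ft (t, a)) I t)
    (ha : ∀ t ∈ I, ∀ a ∈ K, HasDerivWithinAt (fun b => f (t, b)) (fa (t, a)) K a) :
    ContDiffOn ℝ (n + 1 : ℕ) f (I ×ˢ K) := by
  push_cast
  rw [contDiffOn_succ_iff_hasFDerivWithinAt_of_uniqueDiffOn (huI.prod huK)]
  refine ⟨by simp, _, ?_, fun p hp => hasFDerivWithinAt_of_partials hI hK hft.continuousOn
    hfa.continuousOn ht ha hp⟩
  fun_prop

theorem ContDiffOn.hasDerivWithinAt_fst {n : WithTop ℕ∞} (hf : ContDiffOn ℝ n f (I ×ˢ K))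
    (hn : n ≠ 0) {t a : ℝ} (ht : t ∈ I) (ha : a ∈ K) :
    HasDerivWithinAt (fun s => f (s, a)) (fderivWithin ℝ f (I ×ˢ K) (t, a) (1, 0)) I t := by
  have h := ((hf.differentiableOn hn) (t, a) ⟨ht, ha⟩).hasFDerivWithinAt
  have h2 : HasDerivWithinAt (fun s : ℝ => (s, a)) (1, 0) I t :=
    (hasDerivWithinAt_id t I).prodMk (hasDerivWithinAt_const t I a)
  exact h.comp_hasDerivWithinAt (t := I ×ˢ K) t h2 (fun s hs => ⟨hs, ha⟩)

theorem ContDiffOn.hasDerivWithinAt_snd {n : WithTop ℕ∞} (hf : ContDiffOn ℝ n f (I ×ˢ K))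
    (hn : n ≠ 0) {t a : ℝ} (ht : t ∈ I) (ha : a ∈ K) :
    HasDerivWithinAt (fun b => f (t, b)) (fderivWithin ℝ f (I ×ˢ K) (t, a) (0, 1)) K a := by
  have h := ((hf.differentiableOn hn) (t, a) ⟨ht, ha⟩).hasFDerivWithinAt
  have h2 : HasDerivWithinAt (fun b : ℝ => (t, b)) (0, 1) K a :=
    (hasDerivWithinAt_const a K t).prodMk (hasDerivWithinAt_id a K)
  exact h.comp_hasDerivWithinAt (t := I ×ˢ K) a h2 (fun s hs => ⟨ht, hs⟩)

theorem ContDiffOn.fderivWithin_apply_pair (huI : UniqueDiffOn ℝ I) (huK : UniqueDiffOn ℝ K)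
    {n : ℕ} (hf : ContDiffOn ℝ (n + 1 : ℕ) f (I ×ˢ K)) (v : ℝ × ℝ) :
    ContDiffOn ℝ n (fun q => fderivWithin ℝ f (I ×ˢ K) q v) (I ×ˢ K) := by
  have := hf.fderivWithin (m := n) (huI.prod huK) (by push_cast; exact le_rfl)
  fun_prop

end Partials

section Parametric

theorem continuousOn_parametric_integral {A : Set (ℝ × ℝ)} {F : (ℝ × ℝ) × ℝ → ℝ} {u v : ℝ}
    (huv : u ≤ v) (hF : ContinuousOn F (A ×ˢ Icc u v)) :
    ContinuousOn (fun q => ∫ r in u..v, F (q, r)) A := by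
  rw [continuousOn_iff_continuous_domRestrict]
  have h : Continuous (Function.uncurry fun (x : A) (r : ℝ) => F (x.1, projIcc u v huv r)) := by
    refine hF.comp_continuous (f := fun p : A × ℝ => ((p.1 : ℝ × ℝ), (projIcc u v huv p.2 : ℝ)))
      (by fun_prop) (fun p => ⟨p.1.2, (projIcc u v huv p.2).2⟩)
  refine (intervalIntegral.continuous_parametric_intervalIntegral_of_continuous'
    (μ := volume) h u v).congr fun x => ?_
  refine intervalIntegral.integral_congr fun r hr => ?_
  rw [uIcc_of_le huv] at hr
  simp [projIcc_of_mem huv hr]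

variable {I K : Set ℝ} {f ft fa : ℝ × ℝ → ℝ}

theorem segment_mem {K : Set ℝ} (hK : Convex ℝ K) {a b r : ℝ} (ha : a ∈ K) (hb : b ∈ K)
    (hr : r ∈ Icc (0:ℝ) 1) : b + r * (a - b) ∈ K := by
  have := hK hb ha (sub_nonneg.2 hr.2) hr.1 (by ring)
  simp only [smul_eq_mul] at this
  convert this using 1
  ring

/-- Hadamard's lemma in the second variable. -/
theorem exists_hadamard_snd (hK : Convex ℝ K) (hfa : ContinuousOn fa (I ×ˢ K))
    (ha : ∀ t ∈ I, ∀ a ∈ K, HasDerivWithinAt (fun b => f (t, b)) (fa (t, a)) K a)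
    {b : ℝ} (hb : b ∈ K) :
    ∃ q : ℝ × ℝ → ℝ, ContinuousOn q (I ×ˢ K) ∧ (∀ t ∈ I, q (t, b) = fa (t, b)) ∧
      ∀ t ∈ I, ∀ a ∈ K, f (t, a) - f (t, b) = (a - b) * q (t, a) := by
  refine ⟨fun p => ∫ r in (0:ℝ)..1, fa (p.1, b + r * (p.2 - b)), ?_, ?_, ?_⟩
  · refine continuousOn_parametric_integral zero_le_one
      (F := fun x => fa (x.1.1, b + x.2 * (x.1.2 - b)))
      (hfa.comp (by fun_prop) fun x hx => ⟨hx.1.1, segment_mem hK hx.1.2 hb hx.2⟩)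
  · intro t _
    simp
  · intro t ht a haK
    have hmaps : MapsTo (fun r : ℝ => b + r * (a - b)) (Icc 0 1) K :=
      fun r hr => segment_mem hK haK hb hr
    have hd : ∀ r ∈ Icc (0:ℝ) 1, HasDerivWithinAt (fun r => f (t, b + r * (a - b)))
        (fa (t, b + r * (a - b)) * (a - b)) (Icc 0 1) r := by
      intro r hr
      have h1 : HasDerivWithinAt (fun r : ℝ => b + r * (a - b)) (a - b) (Icc 0 1) r := by
        simpa using ((hasDerivWithinAt_id r (Icc 0 1)).mul_const (a - b)).const_add b
      exact HasDerivWithinAt.comp (h₂ := fun b => f (t, b)) r (ha t ht _ (hmaps hr)) h1 hmaps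
    have hc : ContinuousOn (fun r => fa (t, b + r * (a - b)) * (a - b)) (Icc 0 1) :=
      (hfa.comp (by fun_prop) (fun r hr => ⟨ht, hmaps hr⟩)).mul continuousOn_const
    have := intervalIntegral.integral_eq_sub_of_hasDerivAt_of_le zero_le_one
      (fun r hr => (hd r hr).continuousWithinAt)
      (fun r hr => (hd r (Ioo_subset_Icc_self hr)).hasDerivAt (Icc_mem_nhds hr.1 hr.2))
      (hc.intervalIntegrable_of_Icc zero_le_one)
    rw [intervalIntegral.integral_mul_const] at this
    simp only [one_mul, add_sub_cancel, zero_mul, add_zero] at this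
    rw [← this, mul_comm]

theorem continuousOn_swap_iff : ContinuousOn (fun p : ℝ × ℝ => f p.swap) (K ×ˢ I) ↔
    ContinuousOn f (I ×ˢ K) := by
  constructor
  · intro h
    exact h.comp (f := Prod.swap) continuous_swap.continuousOn (fun p hp => ⟨hp.2, hp.1⟩)
  · intro h
    exact h.comp continuous_swap.continuousOn (fun p hp => ⟨hp.2, hp.1⟩)

/-- Hadamard's lemma in the first variable. -/
theorem exists_hadamard_fst (hI : Convex ℝ I) (hft : ContinuousOn ft (I ×ˢ K))
    (ht : ∀ t ∈ I, ∀ a ∈ K, HasDerivWithinAt (fun s => f (s, a)) (ft (t, a)) I t)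
    {s : ℝ} (hs : s ∈ I) :
    ∃ q : ℝ × ℝ → ℝ, ContinuousOn q (I ×ˢ K) ∧ (∀ a ∈ K, q (s, a) = ft (s, a)) ∧
      ∀ t ∈ I, ∀ a ∈ K, f (t, a) - f (s, a) = (t - s) * q (t, a) := by
  obtain ⟨q, hq, h1, h2⟩ := exists_hadamard_snd (I := K) (K := I)
    (f := fun p => f p.swap) (fa := fun p => ft p.swap) hI (continuousOn_swap_iff.2 hft)
    (fun a ha t htI => ht t htI a ha) hs
  exact ⟨fun p => q p.swap, continuousOn_swap_iff.2 hq, fun a ha => h1 a ha,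
    fun t htI a ha => h2 a ha t htI⟩

theorem hasDerivWithinAt_of_hadamard {g q : ℝ → ℝ} {b : ℝ} (hb : b ∈ K)
    (hq : ContinuousOn q K) (h : ∀ a ∈ K, g a - g b = (a - b) * q a) :
    HasDerivWithinAt g (q b) K b := by
  rw [hasDerivWithinAt_iff_tendsto_slope]
  refine Tendsto.congr' ?_ ((hq b hb).mono_left (nhdsWithin_mono _ sdiff_subset))
  filter_upwards [self_mem_nhdsWithin] with a ha
  have hne : a - b ≠ 0 := sub_ne_zero.2 ha.2
  rw [slope_def_field, h a ha.1, mul_div_cancel_left₀ _ hne]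

theorem uIcc_subset_of_convex {K : Set ℝ} (hK : Convex ℝ K) {a b : ℝ} (ha : a ∈ K) (hb : b ∈ K) :
    uIcc a b ⊆ K := by rw [← segment_eq_uIcc]; exact hK.segment_subset ha hb

theorem ContinuousOn.intervalIntegrable_snd (hK : Convex ℝ K) (hf : ContinuousOn f (I ×ˢ K))
    {t a b : ℝ} (ht : t ∈ I) (ha : a ∈ K) (hb : b ∈ K) :
    IntervalIntegrable (fun b => f (t, b)) volume a b :=
  ContinuousOn.intervalIntegrable (hf.comp (by fun_prop)
    fun _ hr => ⟨ht, uIcc_subset_of_convex hK ha hb hr⟩)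

theorem continuousOn_integral_snd_fixed (hK : Convex ℝ K) (hf : ContinuousOn f (I ×ˢ K))
    {u v : ℝ} (hu : u ∈ K) (hv : v ∈ K) : ContinuousOn (fun t => ∫ b in u..v, f (t, b)) I := by
  wlog huv : u ≤ v generalizing u v
  · simp_rw [intervalIntegral.integral_symm v u]
    exact (this hv hu (le_of_not_ge huv)).neg
  have := continuousOn_parametric_integral (A := I ×ˢ {(0:ℝ)}) (F := fun x => f (x.1.1, x.2)) huv
    (hf.comp (by fun_prop) fun x hx => ⟨hx.1.1, uIcc_subset_of_convex hK hu hv (by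
      rw [uIcc_of_le huv]; exact hx.2)⟩)
  exact this.comp (f := fun t : ℝ => (t, (0:ℝ))) (by fun_prop) fun t ht => ⟨ht, rfl⟩

/-- Differentiation under the integral sign, along a convex set of parameters. -/
theorem hasDerivWithinAt_integral_fst (hI : Convex ℝ I) (hK : Convex ℝ K)
    (hf : ContinuousOn f (I ×ˢ K)) (hft : ContinuousOn ft (I ×ˢ K))
    (ht : ∀ t ∈ I, ∀ a ∈ K, HasDerivWithinAt (fun s => f (s, a)) (ft (t, a)) I t)
    {u v : ℝ} (hu : u ∈ K) (hv : v ∈ K) {s : ℝ} (hs : s ∈ I) :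
    HasDerivWithinAt (fun t => ∫ b in u..v, f (t, b)) (∫ b in u..v, ft (s, b)) I s := by
  obtain ⟨q, hq, h1, h2⟩ := exists_hadamard_fst hI hft ht hs
  have h3 := hasDerivWithinAt_of_hadamard (g := fun t => ∫ b in u..v, f (t, b)) hs
    (continuousOn_integral_snd_fixed hK hq hu hv) (fun t htI => by
      rw [← intervalIntegral.integral_sub (hf.intervalIntegrable_snd hK htI hu hv)
        (hf.intervalIntegrable_snd hK hs hu hv), ← intervalIntegral.integral_const_mul]
      exact intervalIntegral.integral_congr fun b hb =>
        h2 t htI b (uIcc_subset_of_convex hK hu hv hb))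
  convert h3 using 1
  exact (intervalIntegral.integral_congr fun b hb =>
        h1 b (uIcc_subset_of_convex hK hu hv hb)).symm

/-- The fundamental theorem of calculus relative to a convex set. -/
theorem hasDerivWithinAt_integral_of_continuousOn (hK : Convex ℝ K) {g : ℝ → ℝ}
    (hg : ContinuousOn g K) {u a : ℝ} (hu : u ∈ K) (ha : a ∈ K) :
    HasDerivWithinAt (fun x => ∫ b in u..x, g b) (g a) K a := by
  have hmap : ∀ x ∈ K, ∀ r ∈ Icc (0:ℝ) 1, a + r * (x - a) ∈ K :=
    fun x hx r hr => segment_mem hK hx ha hr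
  have hint : ∀ {x y}, x ∈ K → y ∈ K → IntervalIntegrable g volume x y := fun hx hy =>
    (hg.mono (uIcc_subset_of_convex hK hx hy)).intervalIntegrable
  have hq : ContinuousOn (fun x => ∫ r in (0:ℝ)..1, g (a + r * (x - a))) K :=
    continuousOn_integral_snd_fixed (f := fun p => g (a + p.2 * (p.1 - a))) (convex_Icc 0 1)
      (hg.comp (by fun_prop) fun p hp => hmap _ hp.1 _ hp.2)
      (left_mem_Icc.2 zero_le_one) (right_mem_Icc.2 zero_le_one)
  have := hasDerivWithinAt_of_hadamard (g := fun x => ∫ b in u..x, g b) ha hq (fun x hx => by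
    rw [intervalIntegral.integral_interval_sub_left (hint hu hx) (hint hu ha)]
    have := intervalIntegral.mul_integral_comp_mul_add (f := g) (a := 0) (b := 1) (x - a) a
    simp only [mul_zero, zero_add, mul_one, sub_add_cancel] at this
    rw [← this]
    congr 2 with r
    congr 1
    ring)
  simpa using this

theorem continuousOn_integral_snd (hK : Convex ℝ K) (hf : ContinuousOn f (I ×ˢ K))
    {u : ℝ} (hu : u ∈ K) :
    ContinuousOn (fun p : ℝ × ℝ => ∫ b in u..p.2, f (p.1, b)) (I ×ˢ K) := by
  have h := continuousOn_parametric_integral zero_le_one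
      (A := I ×ˢ K) (F := fun x => f (x.1.1, x.2 * (x.1.2 - u) + u))
      (hf.comp (by fun_prop) fun x hx => ⟨hx.1.1, by
        rw [add_comm]; exact segment_mem hK hx.1.2 hu hx.2⟩)
  have h2 : ContinuousOn (fun p : ℝ × ℝ => (p.2 - u) *
      ∫ r in (0:ℝ)..1, f (p.1, r * (p.2 - u) + u)) (I ×ˢ K) := by fun_prop
  refine h2.congr fun p _ => ?_
  have := intervalIntegral.mul_integral_comp_mul_add (f := fun b => f (p.1, b))
    (a := 0) (b := 1) (p.2 - u) u
  simp only [mul_zero, zero_add, mul_one, sub_add_cancel] at this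
  simp only [← this]
  congr 2 with r
  congr 2
  ring

/-- The primitive in the second variable is as smooth as the function. -/
theorem contDiffOn_integral_snd (hI : Convex ℝ I) (hK : Convex ℝ K)
    (huI : UniqueDiffOn ℝ I) (huK : UniqueDiffOn ℝ K) {u : ℝ} (hu : u ∈ K) {n : ℕ}
    (hf : ContDiffOn ℝ n f (I ×ˢ K)) :
    ContDiffOn ℝ n (fun p : ℝ × ℝ => ∫ b in u..p.2, f (p.1, b)) (I ×ˢ K) := by
  induction n generalizing f with
  | zero =>
    rw [Nat.cast_zero, contDiffOn_zero] at hf ⊢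
    exact continuousOn_integral_snd hK hf hu
  | succ n ih =>
    have h0 : ((n + 1 : ℕ) : WithTop ℕ∞) ≠ 0 := by simp
    have hft := hf.fderivWithin_apply_pair huI huK (1, 0)
    refine contDiffOn_succ_of_partials hI hK huI huK (ih hft)
      (hf.of_le (by exact_mod_cast n.le_succ)) (fun t ht a ha => ?_) (fun t ht a ha => ?_)
    · exact hasDerivWithinAt_integral_fst hI hK hf.continuousOn hft.continuousOn
        (fun t ht a ha => hf.hasDerivWithinAt_fst h0 ht ha) hu ha ht
    · exact hasDerivWithinAt_integral_of_continuousOn hK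
        (hf.continuousOn.comp (f := fun b : ℝ => (t, b)) (by fun_prop) fun b hb => ⟨ht, hb⟩) hu ha

theorem contDiffOn_swap {n : WithTop ℕ∞} (h : ContDiffOn ℝ n f (I ×ˢ K)) :
    ContDiffOn ℝ n (fun p : ℝ × ℝ => f p.swap) (K ×ˢ I) :=
  h.comp (g := f) (f := Prod.swap) (contDiff_snd.prodMk contDiff_fst).contDiffOn
    (fun _ hp => ⟨hp.2, hp.1⟩)

/-- The primitive in the first variable is as smooth as the function. -/
theorem contDiffOn_integral_fst (hI : Convex ℝ I) (hK : Convex ℝ K)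
    (huI : UniqueDiffOn ℝ I) (huK : UniqueDiffOn ℝ K) {u : ℝ} (hu : u ∈ I) {n : ℕ}
    (hf : ContDiffOn ℝ n f (I ×ˢ K)) :
    ContDiffOn ℝ n (fun p : ℝ × ℝ => ∫ s in u..p.1, f (s, p.2)) (I ×ˢ K) :=
  contDiffOn_swap (f := fun p : ℝ × ℝ => ∫ s in u..p.2, f (s, p.1))
    (contDiffOn_integral_snd (f := fun p => f p.swap) hK hI huK huI hu (contDiffOn_swap hf))

end Parametric

section LinearSystem

theorem eq_integral_of_hasDerivWithinAt {I : Set ℝ} (hI : Convex ℝ I) {y y' : ℝ → ℝ}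
    (hy : ∀ t ∈ I, HasDerivWithinAt y (y' t) I t) (hy' : ContinuousOn y' I) {s t : ℝ}
    (hs : s ∈ I) (ht : t ∈ I) : y t - y s = ∫ r in s..t, y' r := by
  have := hI.norm_image_sub_le_of_norm_hasDerivWithin_le (C := 0)
    (f := fun t => y t - ∫ r in s..t, y' r) (f' := fun t => y' t - y' t)
    (fun r hr => (hy r hr).sub (hasDerivWithinAt_integral_of_continuousOn hI hy' hs hr))
    (fun r _ => by simp) hs ht
  simp only [zero_mul, norm_le_zero_iff, intervalIntegral.integral_same] at this
  linarith

variable {I K : Set ℝ} {κ c κa ca x₁ x₂ β₁ β₂ β₁a β₂a m₁ h₁ m₂ h₂ : ℝ × ℝ → ℝ}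

/-- `(x₁, x₂)` solves `x₁' = κ x₂ + β₁`, `x₂' = c x₁ + β₂` in the first variable. -/
structure IsLinSol (I K : Set ℝ) (κ c β₁ β₂ x₁ x₂ : ℝ × ℝ → ℝ) : Prop where
  cont₁ : ContinuousOn x₁ (I ×ˢ K)
  cont₂ : ContinuousOn x₂ (I ×ˢ K)
  deriv₁ : ∀ t ∈ I, ∀ a ∈ K,
    HasDerivWithinAt (fun s => x₁ (s, a)) (κ (t, a) * x₂ (t, a) + β₁ (t, a)) I t
  deriv₂ : ∀ t ∈ I, ∀ a ∈ K,
    HasDerivWithinAt (fun s => x₂ (s, a)) (c (t, a) * x₁ (t, a) + β₂ (t, a)) I t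

/-- The first coordinate of the variation of constants formula. -/
def varConst (m₁ m₂ h₁ h₂ r₁ r₂ : ℝ × ℝ → ℝ) (y₁ y₂ : ℝ × ℝ → ℝ) (p : ℝ × ℝ) : ℝ :=
  y₁ p * (∫ s in (0:ℝ)..p.1, (h₂ (s, p.2) * r₁ (s, p.2) - m₂ (s, p.2) * r₂ (s, p.2)))
    + y₂ p * ∫ s in (0:ℝ)..p.1, (m₁ (s, p.2) * r₂ (s, p.2) - h₁ (s, p.2) * r₁ (s, p.2))

/-- Differentiability with respect to the parameter of solutions of a linear system. -/
theorem IsLinSol.hasDerivWithinAt_snd (hI : Convex ℝ I) (hK : Convex ℝ K) (h0 : (0:ℝ) ∈ I)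
    (hW₁ : IsLinSol I K κ c 0 0 m₁ h₁) (hW₂ : IsLinSol I K κ c 0 0 m₂ h₂)
    (hW : ∀ p ∈ I ×ˢ K, m₁ p * h₂ p - m₂ p * h₁ p = 1)
    (hx : IsLinSol I K κ c β₁ β₂ x₁ x₂)
    (hx₁ : ∀ a ∈ K, ∀ b ∈ K, x₁ (0, a) = x₁ (0, b))
    (hx₂ : ∀ a ∈ K, ∀ b ∈ K, x₂ (0, a) = x₂ (0, b))
    (hκa : ContinuousOn κa (I ×ˢ K)) (hca : ContinuousOn ca (I ×ˢ K))
    (hβ₁a : ContinuousOn β₁a (I ×ˢ K)) (hβ₂a : ContinuousOn β₂a (I ×ˢ K))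
    (hκ : ∀ t ∈ I, ∀ a ∈ K, HasDerivWithinAt (fun b => κ (t, b)) (κa (t, a)) K a)
    (hc : ∀ t ∈ I, ∀ a ∈ K, HasDerivWithinAt (fun b => c (t, b)) (ca (t, a)) K a)
    (hβ₁ : ∀ t ∈ I, ∀ a ∈ K, HasDerivWithinAt (fun b => β₁ (t, b)) (β₁a (t, a)) K a)
    (hβ₂ : ∀ t ∈ I, ∀ a ∈ K, HasDerivWithinAt (fun b => β₂ (t, b)) (β₂a (t, a)) K a)
    {t b : ℝ} (ht : t ∈ I) (hb : b ∈ K) :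
    HasDerivWithinAt (fun b => x₁ (t, b))
      (varConst m₁ m₂ h₁ h₂ (fun p => κa p * x₂ p + β₁a p) (fun p => ca p * x₁ p + β₂a p)
        m₁ m₂ (t, b)) K b ∧
    HasDerivWithinAt (fun b => x₂ (t, b))
      (varConst m₁ m₂ h₁ h₂ (fun p => κa p * x₂ p + β₁a p) (fun p => ca p * x₁ p + β₂a p)
        h₁ h₂ (t, b)) K b := by
  obtain ⟨q₁, hq₁, hq₁b, hq₁d⟩ := exists_hadamard_snd hK hκa hκ hb
  obtain ⟨q₂, hq₂, hq₂b, hq₂d⟩ := exists_hadamard_snd hK hca hc hb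
  obtain ⟨q₃, hq₃, hq₃b, hq₃d⟩ := exists_hadamard_snd hK hβ₁a hβ₁ hb
  obtain ⟨q₄, hq₄, hq₄b, hq₄d⟩ := exists_hadamard_snd hK hβ₂a hβ₂ hb
  have cb : ∀ {f : ℝ × ℝ → ℝ}, ContinuousOn f (I ×ˢ K) →
      ContinuousOn (fun p : ℝ × ℝ => f (p.2, b)) (K ×ˢ I) := fun hf =>
    hf.comp (by fun_prop) fun p hp => ⟨hp.2, hb⟩
  have cs : ∀ {f : ℝ × ℝ → ℝ}, ContinuousOn f (I ×ˢ K) →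
      ContinuousOn (fun p : ℝ × ℝ => f (p.2, p.1)) (K ×ˢ I) := fun hf =>
    hf.comp (by fun_prop) fun p hp => ⟨hp.2, hp.1⟩
  have cr : ∀ {f : ℝ × ℝ → ℝ}, ContinuousOn f (K ×ˢ I) → ∀ a ∈ K,
      ContinuousOn (fun s : ℝ => f (a, s)) I := fun hf a ha =>
    hf.comp (by fun_prop) fun s hs => ⟨ha, hs⟩
  set r₁ : ℝ × ℝ → ℝ := fun p => q₁ p * x₂ p + q₃ p
  set r₂ : ℝ × ℝ → ℝ := fun p => q₂ p * x₁ p + q₄ p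
  have hr₁ : ContinuousOn r₁ (I ×ˢ K) := (hq₁.mul hx.cont₂).add hq₃
  have hr₂ : ContinuousOn r₂ (I ×ˢ K) := (hq₂.mul hx.cont₁).add hq₄
  set F₁ : ℝ × ℝ → ℝ := fun p => h₂ (p.2, b) * r₁ (p.2, p.1) - m₂ (p.2, b) * r₂ (p.2, p.1)
  set F₂ : ℝ × ℝ → ℝ := fun p => m₁ (p.2, b) * r₂ (p.2, p.1) - h₁ (p.2, b) * r₁ (p.2, p.1)
  have hF₁ : ContinuousOn F₁ (K ×ˢ I) :=
    ((cb hW₂.cont₂).mul (cs hr₁)).sub ((cb hW₂.cont₁).mul (cs hr₂))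
  have hF₂ : ContinuousOn F₂ (K ×ˢ I) :=
    ((cb hW₁.cont₁).mul (cs hr₂)).sub ((cb hW₁.cont₂).mul (cs hr₁))
  have key : ∀ a ∈ K,
      h₂ (t, b) * (x₁ (t, a) - x₁ (t, b)) - m₂ (t, b) * (x₂ (t, a) - x₂ (t, b))
        = (a - b) * ∫ s in (0:ℝ)..t, F₁ (a, s) ∧
      m₁ (t, b) * (x₂ (t, a) - x₂ (t, b)) - h₁ (t, b) * (x₁ (t, a) - x₁ (t, b))
        = (a - b) * ∫ s in (0:ℝ)..t, F₂ (a, s) := by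
    intro a ha
    have e₁ := eq_integral_of_hasDerivWithinAt hI
      (y := fun s => h₂ (s, b) * (x₁ (s, a) - x₁ (s, b)) - m₂ (s, b) * (x₂ (s, a) - x₂ (s, b)))
      (y' := fun s => (a - b) * F₁ (a, s)) (fun s hs => by
        refine (((hW₂.deriv₂ s hs b hb).mul ((hx.deriv₁ s hs a ha).sub
          (hx.deriv₁ s hs b hb))).sub ((hW₂.deriv₁ s hs b hb).mul ((hx.deriv₂ s hs a ha).sub
          (hx.deriv₂ s hs b hb)))).congr_deriv ?_
        simp only [F₁, r₁, r₂, Pi.zero_apply, Pi.sub_apply]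
        linear_combination h₂ (s, b) * x₂ (s, a) * hq₁d s hs a ha + h₂ (s, b) * hq₃d s hs a ha
          - m₂ (s, b) * x₁ (s, a) * hq₂d s hs a ha - m₂ (s, b) * hq₄d s hs a ha)
      (continuousOn_const.mul (cr hF₁ a ha)) h0 ht
    have e₂ := eq_integral_of_hasDerivWithinAt hI
      (y := fun s => m₁ (s, b) * (x₂ (s, a) - x₂ (s, b)) - h₁ (s, b) * (x₁ (s, a) - x₁ (s, b)))
      (y' := fun s => (a - b) * F₂ (a, s)) (fun s hs => by
        refine (((hW₁.deriv₁ s hs b hb).mul ((hx.deriv₂ s hs a ha).sub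
          (hx.deriv₂ s hs b hb))).sub ((hW₁.deriv₂ s hs b hb).mul ((hx.deriv₁ s hs a ha).sub
          (hx.deriv₁ s hs b hb)))).congr_deriv ?_
        simp only [F₂, r₁, r₂, Pi.zero_apply, Pi.sub_apply]
        linear_combination m₁ (s, b) * x₁ (s, a) * hq₂d s hs a ha + m₁ (s, b) * hq₄d s hs a ha
          - h₁ (s, b) * x₂ (s, a) * hq₁d s hs a ha - h₁ (s, b) * hq₃d s hs a ha)
      (continuousOn_const.mul (cr hF₂ a ha)) h0 ht
    simp only [hx₁ a ha b hb, hx₂ a ha b hb, sub_self, mul_zero, sub_zero,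
      intervalIntegral.integral_const_mul] at e₁ e₂
    exact ⟨e₁, e₂⟩
  have hA := continuousOn_integral_snd_fixed hI hF₁ h0 ht
  have hB := continuousOn_integral_snd_fixed hI hF₂ h0 ht
  have hdet := hW (t, b) ⟨ht, hb⟩
  have eA : ∫ s in (0:ℝ)..t, F₁ (b, s) = ∫ s in (0:ℝ)..t,
      (h₂ (s, b) * (κa (s, b) * x₂ (s, b) + β₁a (s, b))
        - m₂ (s, b) * (ca (s, b) * x₁ (s, b) + β₂a (s, b))) :=
    intervalIntegral.integral_congr fun s hs => by
      have hs' := uIcc_subset_of_convex hI h0 ht hs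
      simp only [F₁, r₁, r₂, hq₁b s hs', hq₂b s hs', hq₃b s hs', hq₄b s hs']
  have eB : ∫ s in (0:ℝ)..t, F₂ (b, s) = ∫ s in (0:ℝ)..t,
      (m₁ (s, b) * (ca (s, b) * x₁ (s, b) + β₂a (s, b))
        - h₁ (s, b) * (κa (s, b) * x₂ (s, b) + β₁a (s, b))) :=
    intervalIntegral.integral_congr fun s hs => by
      have hs' := uIcc_subset_of_convex hI h0 ht hs
      simp only [F₂, r₁, r₂, hq₁b s hs', hq₂b s hs', hq₃b s hs', hq₄b s hs']
  constructor
  · refine (hasDerivWithinAt_of_hadamard (g := fun b => x₁ (t, b)) hb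
      ((continuousOn_const (c := m₁ (t, b))).mul hA |>.add
        ((continuousOn_const (c := m₂ (t, b))).mul hB)) fun a ha => ?_).congr_deriv ?_
    · obtain ⟨k₁, k₂⟩ := key a ha
      simp only [Pi.add_apply, Pi.mul_apply]
      linear_combination m₁ (t, b) * k₁ + m₂ (t, b) * k₂ - (x₁ (t, a) - x₁ (t, b)) * hdet
    · simp only [Pi.add_apply, Pi.mul_apply, varConst, ← eA, ← eB]
  · refine (hasDerivWithinAt_of_hadamard (g := fun b => x₂ (t, b)) hb
      ((continuousOn_const (c := h₁ (t, b))).mul hA |>.add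
        ((continuousOn_const (c := h₂ (t, b))).mul hB)) fun a ha => ?_).congr_deriv ?_
    · obtain ⟨k₁, k₂⟩ := key a ha
      simp only [Pi.add_apply, Pi.mul_apply]
      linear_combination h₁ (t, b) * k₁ + h₂ (t, b) * k₂ - (x₂ (t, a) - x₂ (t, b)) * hdet
    · simp only [Pi.add_apply, Pi.mul_apply, varConst, ← eA, ← eB]

theorem contDiffOn_varConst (hI : Convex ℝ I) (hK : Convex ℝ K)
    (huI : UniqueDiffOn ℝ I) (huK : UniqueDiffOn ℝ K) (h0 : (0:ℝ) ∈ I) {n : ℕ}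
    {r₁ r₂ y₁ y₂ : ℝ × ℝ → ℝ}
    (hm₁ : ContDiffOn ℝ n m₁ (I ×ˢ K)) (hm₂ : ContDiffOn ℝ n m₂ (I ×ˢ K))
    (hh₁ : ContDiffOn ℝ n h₁ (I ×ˢ K)) (hh₂ : ContDiffOn ℝ n h₂ (I ×ˢ K))
    (hr₁ : ContDiffOn ℝ n r₁ (I ×ˢ K)) (hr₂ : ContDiffOn ℝ n r₂ (I ×ˢ K))
    (hy₁ : ContDiffOn ℝ n y₁ (I ×ˢ K)) (hy₂ : ContDiffOn ℝ n y₂ (I ×ˢ K)) :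
    ContDiffOn ℝ n (varConst m₁ m₂ h₁ h₂ r₁ r₂ y₁ y₂) (I ×ˢ K) :=
  (hy₁.mul (contDiffOn_integral_fst hI hK huI huK h0 (f := fun p => h₂ p * r₁ p - m₂ p * r₂ p)
    ((hh₂.mul hr₁).sub (hm₂.mul hr₂)))).add
  (hy₂.mul (contDiffOn_integral_fst hI hK huI huK h0 (f := fun p => m₁ p * r₂ p - h₁ p * r₁ p)
    ((hm₁.mul hr₂).sub (hh₁.mul hr₁))))

end LinearSystem

section Lagrangian

/-- The Jacobian of the flow map. -/
def lagKap (z : ℝ × ℝ → ℝ) (p : ℝ × ℝ) : ℝ := Real.exp (2 * z p)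

/-- The flow map. -/
def lagPhi (z : ℝ × ℝ → ℝ) (p : ℝ × ℝ) : ℝ := ∫ b in (0:ℝ)..p.2, lagKap z (p.1, b)

/-- `∫₀^φ sin(2y) g(y) dy` in Lagrangian coordinates. -/
def lagAlp (z h : ℝ × ℝ → ℝ) (p : ℝ × ℝ) : ℝ :=
  ∫ b in (0:ℝ)..p.2, Real.sin (2 * lagPhi z (p.1, b)) * h (p.1, b) * lagKap z (p.1, b)

/-- `∫_φ^l sin(2(l - y)) g(y) dy` in Lagrangian coordinates. -/
def lagBet (l : ℝ) (z h : ℝ × ℝ → ℝ) (p : ℝ × ℝ) : ℝ :=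
  -∫ b in l..p.2, Real.sin (2 * l - 2 * lagPhi z (p.1, b)) * h (p.1, b) * lagKap z (p.1, b)

/-- The stream function `G` in Lagrangian coordinates. -/
def lagGam (l : ℝ) (z h : ℝ × ℝ → ℝ) (p : ℝ × ℝ) : ℝ :=
  -(2 * Real.sin (2 * l))⁻¹ * (Real.sin (2 * l - 2 * lagPhi z p) * lagAlp z h p
    + Real.sin (2 * lagPhi z p) * lagBet l z h p)

/-- The derivative `∂_θ G` in Lagrangian coordinates. -/
def lagLam (l : ℝ) (z h : ℝ × ℝ → ℝ) (p : ℝ × ℝ) : ℝ :=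
  (Real.sin (2 * l))⁻¹ * (Real.cos (2 * l - 2 * lagPhi z p) * lagAlp z h p
    - Real.cos (2 * lagPhi z p) * lagBet l z h p)

/-- The coefficient of `m` in the equation for `h`. -/
def lagCoef (z : ℝ × ℝ → ℝ) (p : ℝ × ℝ) : ℝ :=
  2 * (p.2 * p.2 * Real.cos (lagPhi z p) * Real.exp (-z p))

/-- The inhomogeneity in the equation for `m`. -/
def lagSrc₁ (l : ℝ) (z h : ℝ × ℝ → ℝ) (p : ℝ × ℝ) : ℝ := -4 * (lagKap z p * lagGam l z h p)

/-- The inhomogeneity in the equation for `h`. -/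
def lagSrc₂ (z : ℝ × ℝ → ℝ) (p : ℝ × ℝ) : ℝ :=
  2 * (p.2 * p.2 * Real.sin (lagPhi z p) * Real.exp (z p))
    + 4 * (p.2 * Real.cos (lagPhi z p) * Real.exp (-z p))

/-- Solutions of the Lagrangian form of the system: `exp (2 z)` is the Jacobian of the flow map,
`m = ∂_a z`, `h = g ∘ φ`, and `(m₁, h₁)`, `(m₂, h₂)` is a fundamental system for the homogeneous
part of the linear system for `(m, h)`. -/
structure IsLag (l : ℝ) (I : Set ℝ) (z m h m₁ h₁ m₂ h₂ : ℝ × ℝ → ℝ) : Prop where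
  contZ : ContinuousOn z (I ×ˢ Icc 0 l)
  derivZ : ∀ t ∈ I, ∀ a ∈ Icc 0 l,
    HasDerivWithinAt (fun s => z (s, a)) (lagLam l z h (t, a)) I t
  lin : IsLinSol I (Icc 0 l) (lagKap z) (lagCoef z) (lagSrc₁ l z h) (lagSrc₂ z) m h
  lin₁ : IsLinSol I (Icc 0 l) (lagKap z) (lagCoef z) 0 0 m₁ h₁
  lin₂ : IsLinSol I (Icc 0 l) (lagKap z) (lagCoef z) 0 0 m₂ h₂
  initZ : ∀ a ∈ Icc 0 l, z (0, a) = 0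
  initM : ∀ a ∈ Icc 0 l, m (0, a) = 0
  initH : ∀ a ∈ Icc 0 l, h (0, a) = 0
  initM₁ : ∀ a ∈ Icc 0 l, m₁ (0, a) = 1
  initH₁ : ∀ a ∈ Icc 0 l, h₁ (0, a) = 0
  initM₂ : ∀ a ∈ Icc 0 l, m₂ (0, a) = 0
  initH₂ : ∀ a ∈ Icc 0 l, h₂ (0, a) = 1

variable {l : ℝ} {I : Set ℝ} {z m h m₁ h₁ m₂ h₂ : ℝ × ℝ → ℝ}

section Regularity

variable (hI : Convex ℝ I) (huI : UniqueDiffOn ℝ I) (hl : 0 < l) {n : ℕ}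

include hI huI hl

theorem contDiffOn_lagPhi (hz : ContDiffOn ℝ n z (I ×ˢ Icc 0 l)) :
    ContDiffOn ℝ n (lagPhi z) (I ×ˢ Icc 0 l) :=
  contDiffOn_integral_snd hI (convex_Icc 0 l) huI (uniqueDiffOn_Icc hl)
    (left_mem_Icc.2 hl.le) (f := lagKap z) (by unfold lagKap; fun_prop)

theorem contDiffOn_lagAlp (hz : ContDiffOn ℝ n z (I ×ˢ Icc 0 l))
    (hh : ContDiffOn ℝ n h (I ×ˢ Icc 0 l)) :
    ContDiffOn ℝ n (lagAlp z h) (I ×ˢ Icc 0 l) := by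
  have hφ := contDiffOn_lagPhi hI huI hl hz
  exact contDiffOn_integral_snd hI (convex_Icc 0 l) huI (uniqueDiffOn_Icc hl)
    (left_mem_Icc.2 hl.le) (f := fun p => Real.sin (2 * lagPhi z p) * h p * lagKap z p)
    (by unfold lagKap; fun_prop)

theorem contDiffOn_lagBet (hz : ContDiffOn ℝ n z (I ×ˢ Icc 0 l))
    (hh : ContDiffOn ℝ n h (I ×ˢ Icc 0 l)) :
    ContDiffOn ℝ n (lagBet l z h) (I ×ˢ Icc 0 l) := by
  have hφ := contDiffOn_lagPhi hI huI hl hz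
  exact (contDiffOn_integral_snd hI (convex_Icc 0 l) huI (uniqueDiffOn_Icc hl)
    (right_mem_Icc.2 hl.le) (f := fun p => Real.sin (2 * l - 2 * lagPhi z p) * h p * lagKap z p)
    (by unfold lagKap; fun_prop)).neg

theorem contDiffOn_lagGam (hz : ContDiffOn ℝ n z (I ×ˢ Icc 0 l))
    (hh : ContDiffOn ℝ n h (I ×ˢ Icc 0 l)) :
    ContDiffOn ℝ n (lagGam l z h) (I ×ˢ Icc 0 l) := by
  have hφ := contDiffOn_lagPhi hI huI hl hz
  have hα := contDiffOn_lagAlp hI huI hl hz hh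
  have hβ := contDiffOn_lagBet hI huI hl hz hh
  unfold lagGam
  fun_prop

theorem contDiffOn_lagLam (hz : ContDiffOn ℝ n z (I ×ˢ Icc 0 l))
    (hh : ContDiffOn ℝ n h (I ×ˢ Icc 0 l)) :
    ContDiffOn ℝ n (lagLam l z h) (I ×ˢ Icc 0 l) := by
  have hφ := contDiffOn_lagPhi hI huI hl hz
  have hα := contDiffOn_lagAlp hI huI hl hz hh
  have hβ := contDiffOn_lagBet hI huI hl hz hh
  unfold lagLam
  fun_prop

end Regularity

section SpaceDerivatives

variable (hI : Convex ℝ I) (huI : UniqueDiffOn ℝ I) (hl : 0 < l)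
  (hz : ContinuousOn z (I ×ˢ Icc 0 l)) (hh : ContinuousOn h (I ×ˢ Icc 0 l))

include hl hz in
theorem hasDerivWithinAt_lagPhi_snd {t a : ℝ} (ht : t ∈ I) (ha : a ∈ Icc 0 l) :
    HasDerivWithinAt (fun b => lagPhi z (t, b)) (lagKap z (t, a)) (Icc 0 l) a := by
  have hm : MapsTo (fun b : ℝ => (t, b)) (Icc 0 l) (I ×ˢ Icc 0 l) := fun b hb => ⟨ht, hb⟩
  exact hasDerivWithinAt_integral_of_continuousOn (convex_Icc 0 l)
    (g := fun b => lagKap z (t, b)) (by unfold lagKap; fun_prop) (left_mem_Icc.2 hl.le) ha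

@[simp] theorem lagPhi_zero (t : ℝ) : lagPhi z (t, 0) = 0 := by simp [lagPhi]

@[simp] theorem lagAlp_zero (t : ℝ) : lagAlp z h (t, 0) = 0 := by simp [lagAlp]

@[simp] theorem lagBet_right (t : ℝ) : lagBet l z h (t, l) = 0 := by simp [lagBet]

@[simp] theorem lagGam_zero (t : ℝ) : lagGam l z h (t, 0) = 0 := by simp [lagGam]

include hI huI hl hz hh in
theorem hasDerivWithinAt_lagAlp_snd {t a : ℝ} (ht : t ∈ I) (ha : a ∈ Icc 0 l) :
    HasDerivWithinAt (fun b => lagAlp z h (t, b))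
      (Real.sin (2 * lagPhi z (t, a)) * h (t, a) * lagKap z (t, a)) (Icc 0 l) a := by
  have hφ := contDiffOn_lagPhi hI huI hl (n := 0) (contDiffOn_zero.2 hz)
  rw [Nat.cast_zero, contDiffOn_zero] at hφ
  have hm : MapsTo (fun b : ℝ => (t, b)) (Icc 0 l) (I ×ˢ Icc 0 l) := fun b hb => ⟨ht, hb⟩
  have hz' : ContinuousOn (fun b => z (t, b)) (Icc 0 l) := hz.comp (by fun_prop) hm
  have hφ' : ContinuousOn (fun b => lagPhi z (t, b)) (Icc 0 l) := hφ.comp (by fun_prop) hm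
  have hh' : ContinuousOn (fun b => h (t, b)) (Icc 0 l) := hh.comp (by fun_prop) hm
  exact hasDerivWithinAt_integral_of_continuousOn (convex_Icc 0 l)
    (g := fun b => Real.sin (2 * lagPhi z (t, b)) * h (t, b) * lagKap z (t, b))
    (by unfold lagKap; fun_prop) (left_mem_Icc.2 hl.le) ha

include hI huI hl hz hh in
theorem hasDerivWithinAt_lagBet_snd {t a : ℝ} (ht : t ∈ I) (ha : a ∈ Icc 0 l) :
    HasDerivWithinAt (fun b => lagBet l z h (t, b))
      (-(Real.sin (2 * l - 2 * lagPhi z (t, a)) * h (t, a) * lagKap z (t, a))) (Icc 0 l) a := by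
  have hφ := contDiffOn_lagPhi hI huI hl (n := 0) (contDiffOn_zero.2 hz)
  rw [Nat.cast_zero, contDiffOn_zero] at hφ
  have hm : MapsTo (fun b : ℝ => (t, b)) (Icc 0 l) (I ×ˢ Icc 0 l) := fun b hb => ⟨ht, hb⟩
  have hz' : ContinuousOn (fun b => z (t, b)) (Icc 0 l) := hz.comp (by fun_prop) hm
  have hφ' : ContinuousOn (fun b => lagPhi z (t, b)) (Icc 0 l) := hφ.comp (by fun_prop) hm
  have hh' : ContinuousOn (fun b => h (t, b)) (Icc 0 l) := hh.comp (by fun_prop) hm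
  exact (hasDerivWithinAt_integral_of_continuousOn (convex_Icc 0 l)
    (g := fun b => Real.sin (2 * l - 2 * lagPhi z (t, b)) * h (t, b) * lagKap z (t, b))
    (by unfold lagKap; fun_prop) (right_mem_Icc.2 hl.le) ha).neg

include hI huI hl hz hh in
theorem hasDerivWithinAt_lagGam_snd (hS : Real.sin (2 * l) ≠ 0)
    {t a : ℝ} (ht : t ∈ I) (ha : a ∈ Icc 0 l) :
    HasDerivWithinAt (fun b => lagGam l z h (t, b))
      (lagKap z (t, a) * lagLam l z h (t, a)) (Icc 0 l) a := by
  have h1 := (hasDerivWithinAt_lagPhi_snd hl hz ht ha).const_mul 2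
  have h2 := hasDerivWithinAt_lagAlp_snd hI huI hl hz hh ht ha
  have h3 := hasDerivWithinAt_lagBet_snd hI huI hl hz hh ht ha
  refine ((((h1.const_sub (2 * l)).sin.mul h2).add (h1.sin.mul h3)).const_mul
    (-(2 * Real.sin (2 * l))⁻¹)).congr_deriv ?_
  simp only [lagLam]
  field_simp
  ring

include hI huI hl hz hh in
theorem hasDerivWithinAt_lagLam_snd (hS : Real.sin (2 * l) ≠ 0)
    {t a : ℝ} (ht : t ∈ I) (ha : a ∈ Icc 0 l) :
    HasDerivWithinAt (fun b => lagLam l z h (t, b))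
      (lagKap z (t, a) * (h (t, a) - 4 * lagGam l z h (t, a))) (Icc 0 l) a := by
  have h1 := (hasDerivWithinAt_lagPhi_snd hl hz ht ha).const_mul 2
  have h2 := hasDerivWithinAt_lagAlp_snd hI huI hl hz hh ht ha
  have h3 := hasDerivWithinAt_lagBet_snd hI huI hl hz hh ht ha
  refine ((((h1.const_sub (2 * l)).cos.mul h2).sub (h1.cos.mul h3)).const_mul
    (Real.sin (2 * l))⁻¹).congr_deriv ?_
  have e : Real.sin (2 * l) =
      Real.sin (2 * l - 2 * lagPhi z (t, a)) * Real.cos (2 * lagPhi z (t, a))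
      + Real.cos (2 * l - 2 * lagPhi z (t, a)) * Real.sin (2 * lagPhi z (t, a)) := by
    rw [← Real.sin_add, sub_add_cancel]
  simp only [lagGam]
  generalize Real.sin (2 * l - 2 * lagPhi z (t, a)) = s₁ at *
  generalize Real.cos (2 * l - 2 * lagPhi z (t, a)) = c₁ at *
  field_simp
  linear_combination -2 * lagKap z (t, a) * h (t, a) * e

end SpaceDerivatives
end Lagrangian

theorem eq_zero_of_hasDerivWithinAt_mul {I : Set ℝ} (hI : Convex ℝ I) {y A : ℝ → ℝ}
    (hA : ContinuousOn A I) (hy : ∀ t ∈ I, HasDerivWithinAt y (A t * y t) I t)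
    {s t : ℝ} (hs : s ∈ I) (ht : t ∈ I) (h0 : y s = 0) : y t = 0 := by
  have h1 : ∀ r ∈ I, HasDerivWithinAt (fun r => y r * Real.exp (-∫ x in s..r, A x)) 0 I r := by
    intro r hr
    have h2 := (hasDerivWithinAt_integral_of_continuousOn hI hA hs hr).neg.exp
    refine ((hy r hr).mul h2).congr_deriv ?_
    simp only [Pi.neg_apply]
    ring
  have := eq_integral_of_hasDerivWithinAt hI (y' := fun _ => 0) h1 continuousOn_const hs ht
  simpa [h0] using this

namespace IsLag

variable {l : ℝ} {I : Set ℝ} {z m h m₁ h₁ m₂ h₂ : ℝ × ℝ → ℝ}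
  (H : IsLag l I z m h m₁ h₁ m₂ h₂) (hI : Convex ℝ I) (huI : UniqueDiffOn ℝ I) (h0 : (0:ℝ) ∈ I)
  (hl : 0 < l) (hl2 : l < Real.pi / 2)

include hl hl2 in
omit H in
theorem _root_.sin_two_mul_pos : 0 < Real.sin (2 * l) :=
  Real.sin_pos_of_pos_of_lt_pi (by linarith) (by linarith)

include H in
theorem contH : ContinuousOn h (I ×ˢ Icc 0 l) := H.lin.cont₂

include H in
theorem contDiffOn_zero_z : ContDiffOn ℝ (0 : ℕ) z (I ×ˢ Icc 0 l) := contDiffOn_zero.2 H.contZ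

include H in
theorem contDiffOn_zero_h : ContDiffOn ℝ (0 : ℕ) h (I ×ˢ Icc 0 l) := contDiffOn_zero.2 H.contH

include H hI huI hl

theorem contPhi : ContinuousOn (lagPhi z) (I ×ˢ Icc 0 l) :=
  (contDiffOn_lagPhi hI huI hl H.contDiffOn_zero_z).continuousOn

theorem contLam : ContinuousOn (lagLam l z h) (I ×ˢ Icc 0 l) :=
  (contDiffOn_lagLam hI huI hl H.contDiffOn_zero_z H.contDiffOn_zero_h).continuousOn

theorem contGam : ContinuousOn (lagGam l z h) (I ×ˢ Icc 0 l) :=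
  (contDiffOn_lagGam hI huI hl H.contDiffOn_zero_z H.contDiffOn_zero_h).continuousOn

theorem contAlp : ContinuousOn (lagAlp z h) (I ×ˢ Icc 0 l) :=
  (contDiffOn_lagAlp hI huI hl H.contDiffOn_zero_z H.contDiffOn_zero_h).continuousOn

omit hI huI hl in
theorem contKap : ContinuousOn (lagKap z) (I ×ˢ Icc 0 l) := by
  have := H.contZ
  unfold lagKap
  fun_prop

omit hI huI hl in
theorem hasDerivWithinAt_kap_fst {t a : ℝ} (ht : t ∈ I) (ha : a ∈ Icc 0 l) :
    HasDerivWithinAt (fun s => lagKap z (s, a)) (2 * lagLam l z h (t, a) * lagKap z (t, a)) I t :=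
  ((H.derivZ t ht a ha).const_mul 2).exp.congr_deriv (by rw [lagKap]; ring)

include hl2 in
theorem hasDerivWithinAt_phi_fst {t a : ℝ} (ht : t ∈ I) (ha : a ∈ Icc 0 l) :
    HasDerivWithinAt (fun s => lagPhi z (s, a)) (2 * lagGam l z h (t, a)) I t := by
  have hS := (sin_two_mul_pos hl hl2).ne'
  have hc : ContinuousOn (fun p => 2 * lagLam l z h p * lagKap z p) (I ×ˢ Icc 0 l) :=
    (continuousOn_const.mul (H.contLam hI huI hl)).mul H.contKap
  have hz0 : (0:ℝ) ∈ Icc 0 l := left_mem_Icc.2 hl.le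
  have h1 := hasDerivWithinAt_integral_fst hI (convex_Icc 0 l) H.contKap hc
    (fun s hs b hb => H.hasDerivWithinAt_kap_fst hs hb) hz0 ha ht
  refine h1.congr_deriv ?_
  have h2 := eq_integral_of_hasDerivWithinAt (convex_Icc 0 l)
    (y := fun b => 2 * lagGam l z h (t, b)) (fun b hb =>
      (hasDerivWithinAt_lagGam_snd hI huI hl H.contZ H.contH hS ht hb).const_mul 2)
    (y' := fun b => 2 * (lagKap z (t, b) * lagLam l z h (t, b)))
    (by
      refine ContinuousOn.congr (hc.comp (f := fun b : ℝ => (t, b)) (by fun_prop)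
        fun b hb => ⟨ht, hb⟩) fun b _ => ?_
      simp only [Function.comp]
      ring) hz0 ha
  simp only [lagGam_zero, mul_zero, sub_zero] at h2
  rw [h2]
  exact intervalIntegral.integral_congr fun b _ => by ring

omit hI huI hl in
theorem kap_init {a : ℝ} (ha : a ∈ Icc 0 l) : lagKap z (0, a) = 1 := by
  simp [lagKap, H.initZ a ha]

omit hI huI in
theorem phi_init {a : ℝ} (ha : a ∈ Icc 0 l) : lagPhi z (0, a) = a := by
  have : ∫ b in (0:ℝ)..a, lagKap z (0, b) = ∫ b in (0:ℝ)..a, 1 :=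
    intervalIntegral.integral_congr fun b hb => H.kap_init
      (uIcc_subset_of_convex (convex_Icc 0 l) (left_mem_Icc.2 hl.le) ha hb)
  simpa [lagPhi] using this

include hl2 h0 in
/-- The flow preserves the right end point. -/
theorem phi_right {t : ℝ} (ht : t ∈ I) : lagPhi z (t, l) = l := by
  have hS := sin_two_mul_pos hl hl2
  have hlm : l ∈ Icc 0 l := right_mem_Icc.2 hl.le
  have hφ : ContinuousOn (fun s => lagPhi z (s, l)) I :=
    (H.contPhi hI huI hl).comp (by fun_prop) fun s hs => ⟨hs, hlm⟩
  have hα : ContinuousOn (fun s => lagAlp z h (s, l)) I :=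
    (H.contAlp hI huI hl).comp (by fun_prop) fun s hs => ⟨hs, hlm⟩
  have := eq_zero_of_hasDerivWithinAt_mul hI (y := fun s => lagPhi z (s, l) - l)
    (A := fun s => 2 * (Real.sin (2 * l))⁻¹ * lagAlp z h (s, l)
      * Real.sinc (2 * (lagPhi z (s, l) - l))) (by
        have := Real.continuous_sinc
        fun_prop) (fun s hs => by
      refine ((H.hasDerivWithinAt_phi_fst hI huI hl hl2 hs hlm).sub_const l).congr_deriv ?_
      have e : Real.sin (2 * l - 2 * lagPhi z (s, l))
          = -(2 * (lagPhi z (s, l) - l) * Real.sinc (2 * (lagPhi z (s, l) - l))) := by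
        rw [show 2 * l - 2 * lagPhi z (s, l) = -(2 * (lagPhi z (s, l) - l)) by ring, Real.sin_neg]
        rcases eq_or_ne (2 * (lagPhi z (s, l) - l)) 0 with h | h
        · simp [h]
        · rw [Real.sinc_of_ne_zero h, mul_div_cancel₀ _ h]
      simp only [lagGam, e, lagBet_right, mul_zero, add_zero]
      field_simp) h0 ht (by simp [H.phi_init hl hlm])
  linarith

include hl2 h0 in
theorem gam_right {t : ℝ} (ht : t ∈ I) : lagGam l z h (t, l) = 0 := by
  simp [lagGam, H.phi_right hI huI h0 hl hl2 ht]

include h0 in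
omit hl huI in
theorem wronskian : ∀ p ∈ I ×ˢ Icc 0 l, m₁ p * h₂ p - m₂ p * h₁ p = 1 := by
  rintro ⟨t, a⟩ ⟨ht, ha⟩
  simp only at ht ha
  have := eq_integral_of_hasDerivWithinAt hI
    (y := fun s => m₁ (s, a) * h₂ (s, a) - m₂ (s, a) * h₁ (s, a)) (y' := fun _ => 0)
    (fun s hs => (((H.lin₁.deriv₁ s hs a ha).mul (H.lin₂.deriv₂ s hs a ha)).sub
      ((H.lin₂.deriv₁ s hs a ha).mul (H.lin₁.deriv₂ s hs a ha))).congr_deriv (by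
        simp only [Pi.zero_apply]; ring)) continuousOn_const h0 ht
  simp [H.initM₁ a ha, H.initM₂ a ha, H.initH₁ a ha, H.initH₂ a ha] at this
  linarith

include h0 hl2 in
theorem hasDerivWithinAt_z_snd {t a : ℝ} (ht : t ∈ I) (ha : a ∈ Icc 0 l) :
    HasDerivWithinAt (fun b => z (t, b)) (m (t, a)) (Icc 0 l) a := by
  have hS := (sin_two_mul_pos hl hl2).ne'
  have hc : ContinuousOn (fun p => lagKap z p * (h p - 4 * lagGam l z h p)) (I ×ˢ Icc 0 l) :=
    H.contKap.mul (H.contH.sub (continuousOn_const.mul (H.contGam hI huI hl)))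
  have h1 := hasDerivWithinAt_integral_fst (convex_Icc 0 l) hI (f := fun p => lagLam l z h p.swap)
    (ft := fun p => lagKap z p.swap * (h p.swap - 4 * lagGam l z h p.swap))
    (continuousOn_swap_iff.2 (H.contLam hI huI hl)) (continuousOn_swap_iff.2 hc)
    (fun b hb s hs => hasDerivWithinAt_lagLam_snd hI huI hl H.contZ H.contH hS hs hb) h0 ht ha
  have ez : ∀ b ∈ Icc 0 l, z (t, b) = ∫ s in (0:ℝ)..t, lagLam l z h (s, b) := by
    intro b hb
    have := eq_integral_of_hasDerivWithinAt hI (fun s hs => H.derivZ s hs b hb)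
      ((H.contLam hI huI hl).comp (f := fun s : ℝ => (s, b)) (by fun_prop)
        fun s hs => ⟨hs, hb⟩) h0 ht
    rw [H.initZ b hb, sub_zero] at this
    exact this
  have em := eq_integral_of_hasDerivWithinAt hI (fun s hs => H.lin.deriv₁ s hs a ha)
    (ContinuousOn.congr (hc.comp (f := fun s : ℝ => (s, a)) (by fun_prop)
        fun s hs => ⟨hs, ha⟩) fun s _ => by
          simp only [Function.comp, lagSrc₁]
          ring) h0 ht
  rw [H.initM a ha, sub_zero] at em
  refine (h1.congr ez (ez a ha)).congr_deriv ?_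
  rw [em]
  exact intervalIntegral.integral_congr fun s _ => by
    simp only [lagSrc₁, Prod.swap_prod_mk]
    ring

end IsLag

/-- The variation of constants formula solves the inhomogeneous linear system. -/
theorem IsLinSol.hasDerivWithinAt_varConst {I K : Set ℝ} {κ c m₁ h₁ m₂ h₂ r₁ r₂ : ℝ × ℝ → ℝ}
    (hI : Convex ℝ I) (h0 : (0:ℝ) ∈ I)
    (hW₁ : IsLinSol I K κ c 0 0 m₁ h₁) (hW₂ : IsLinSol I K κ c 0 0 m₂ h₂)
    (hW : ∀ p ∈ I ×ˢ K, m₁ p * h₂ p - m₂ p * h₁ p = 1)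
    (hr₁ : ContinuousOn r₁ (I ×ˢ K)) (hr₂ : ContinuousOn r₂ (I ×ˢ K))
    {t b : ℝ} (ht : t ∈ I) (hb : b ∈ K) :
    HasDerivWithinAt (fun s => varConst m₁ m₂ h₁ h₂ r₁ r₂ m₁ m₂ (s, b))
      (κ (t, b) * varConst m₁ m₂ h₁ h₂ r₁ r₂ h₁ h₂ (t, b) + r₁ (t, b)) I t ∧
    HasDerivWithinAt (fun s => varConst m₁ m₂ h₁ h₂ r₁ r₂ h₁ h₂ (s, b))
      (c (t, b) * varConst m₁ m₂ h₁ h₂ r₁ r₂ m₁ m₂ (t, b) + r₂ (t, b)) I t := by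
  have cr : ∀ {f : ℝ × ℝ → ℝ}, ContinuousOn f (I ×ˢ K) →
      ContinuousOn (fun s : ℝ => f (s, b)) I := fun hf =>
    hf.comp (by fun_prop) fun s hs => ⟨hs, hb⟩
  have d₁ := hasDerivWithinAt_integral_of_continuousOn hI
    (g := fun s => h₂ (s, b) * r₁ (s, b) - m₂ (s, b) * r₂ (s, b))
    (((cr hW₂.cont₂).mul (cr hr₁)).sub ((cr hW₂.cont₁).mul (cr hr₂))) h0 ht
  have d₂ := hasDerivWithinAt_integral_of_continuousOn hI
    (g := fun s => m₁ (s, b) * r₂ (s, b) - h₁ (s, b) * r₁ (s, b))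
    (((cr hW₁.cont₁).mul (cr hr₂)).sub ((cr hW₁.cont₂).mul (cr hr₁))) h0 ht
  have hdet := hW (t, b) ⟨ht, hb⟩
  constructor
  · refine (((hW₁.deriv₁ t ht b hb).mul d₁).add ((hW₂.deriv₁ t ht b hb).mul d₂)).congr_deriv ?_
    simp only [varConst, Pi.zero_apply]
    linear_combination r₁ (t, b) * hdet
  · refine (((hW₁.deriv₂ t ht b hb).mul d₁).add ((hW₂.deriv₂ t ht b hb).mul d₂)).congr_deriv ?_
    simp only [varConst, Pi.zero_apply]
    linear_combination r₂ (t, b) * hdet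

section Lagrangian

variable (l : ℝ) (z m h : ℝ × ℝ → ℝ)

/-- The label derivative of `lagKap`. -/
def lagKapA (p : ℝ × ℝ) : ℝ := 2 * m p * lagKap z p

/-- The label derivative of `lagCoef`. -/
def lagCoefA (p : ℝ × ℝ) : ℝ :=
  2 * (2 * p.2 * Real.cos (lagPhi z p) * Real.exp (-z p)
    - p.2 * p.2 * Real.sin (lagPhi z p) * lagKap z p * Real.exp (-z p)
    - p.2 * p.2 * Real.cos (lagPhi z p) * m p * Real.exp (-z p))

/-- The label derivative of `lagSrc₁`. -/
def lagSrc₁A (p : ℝ × ℝ) : ℝ :=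
  -4 * (2 * m p * lagKap z p * lagGam l z h p + lagKap z p * (lagKap z p * lagLam l z h p))

/-- The label derivative of `lagSrc₂`. -/
def lagSrc₂A (p : ℝ × ℝ) : ℝ :=
  2 * (2 * p.2 * Real.sin (lagPhi z p) * Real.exp (z p)
      + p.2 * p.2 * Real.cos (lagPhi z p) * lagKap z p * Real.exp (z p)
      + p.2 * p.2 * Real.sin (lagPhi z p) * m p * Real.exp (z p))
    + 4 * (Real.cos (lagPhi z p) * Real.exp (-z p)
      - p.2 * Real.sin (lagPhi z p) * lagKap z p * Real.exp (-z p)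
      - p.2 * Real.cos (lagPhi z p) * m p * Real.exp (-z p))

variable (m₁ h₁ m₂ h₂ : ℝ × ℝ → ℝ)

/-- The label derivative of `m`. -/
def lagMA (p : ℝ × ℝ) : ℝ :=
  varConst m₁ m₂ h₁ h₂ (fun p => lagKapA z m p * h p + lagSrc₁A l z m h p)
    (fun p => lagCoefA z m p * m p + lagSrc₂A z m p) m₁ m₂ p

/-- The label derivative of `h`. -/
def lagHA (p : ℝ × ℝ) : ℝ :=
  varConst m₁ m₂ h₁ h₂ (fun p => lagKapA z m p * h p + lagSrc₁A l z m h p)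
    (fun p => lagCoefA z m p * m p + lagSrc₂A z m p) h₁ h₂ p

end Lagrangian

namespace IsLag

variable {l : ℝ} {I : Set ℝ} {z m h m₁ h₁ m₂ h₂ : ℝ × ℝ → ℝ}
  (H : IsLag l I z m h m₁ h₁ m₂ h₂) (hI : Convex ℝ I) (huI : UniqueDiffOn ℝ I) (h0 : (0:ℝ) ∈ I)
  (hl : 0 < l) (hl2 : l < Real.pi / 2)

include H hI huI h0 hl hl2

omit hI huI h0 hl2 in
theorem hasDerivWithinAt_phi_snd {t a : ℝ} (ht : t ∈ I) (ha : a ∈ Icc 0 l) :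
    HasDerivWithinAt (fun b => lagPhi z (t, b)) (lagKap z (t, a)) (Icc 0 l) a :=
  hasDerivWithinAt_lagPhi_snd hl H.contZ ht ha

theorem hasDerivWithinAt_kap_snd {t a : ℝ} (ht : t ∈ I) (ha : a ∈ Icc 0 l) :
    HasDerivWithinAt (fun b => lagKap z (t, b)) (lagKapA z m (t, a)) (Icc 0 l) a :=
  ((H.hasDerivWithinAt_z_snd hI huI h0 hl hl2 ht ha).const_mul 2).exp.congr_deriv (by
    simp only [lagKapA, lagKap]; ring)

theorem hasDerivWithinAt_coef_snd {t a : ℝ} (ht : t ∈ I) (ha : a ∈ Icc 0 l) :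
    HasDerivWithinAt (fun b => lagCoef z (t, b)) (lagCoefA z m (t, a)) (Icc 0 l) a := by
  have dz := H.hasDerivWithinAt_z_snd hI huI h0 hl hl2 ht ha
  have dφ := hasDerivWithinAt_lagPhi_snd hl H.contZ ht ha
  have d := hasDerivWithinAt_id a (Icc 0 l)
  refine ((((d.mul d).mul dφ.cos).mul dz.neg.exp).const_mul 2).congr_deriv ?_
  simp only [lagCoefA, Pi.mul_apply, Pi.neg_apply, id]
  ring

theorem hasDerivWithinAt_src₁_snd {t a : ℝ} (ht : t ∈ I) (ha : a ∈ Icc 0 l) :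
    HasDerivWithinAt (fun b => lagSrc₁ l z h (t, b)) (lagSrc₁A l z m h (t, a)) (Icc 0 l) a :=
  (((H.hasDerivWithinAt_kap_snd hI huI h0 hl hl2 ht ha).mul
    (hasDerivWithinAt_lagGam_snd hI huI hl H.contZ H.contH (sin_two_mul_pos hl hl2).ne'
      ht ha)).const_mul (-4)).congr_deriv (by simp only [lagSrc₁A, lagKapA])

theorem hasDerivWithinAt_src₂_snd {t a : ℝ} (ht : t ∈ I) (ha : a ∈ Icc 0 l) :
    HasDerivWithinAt (fun b => lagSrc₂ z (t, b)) (lagSrc₂A z m (t, a)) (Icc 0 l) a := by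
  have dz := H.hasDerivWithinAt_z_snd hI huI h0 hl hl2 ht ha
  have dφ := hasDerivWithinAt_lagPhi_snd hl H.contZ ht ha
  have d := hasDerivWithinAt_id a (Icc 0 l)
  refine (((((d.mul d).mul dφ.sin).mul dz.exp).const_mul 2).add
    (((d.mul dφ.cos).mul dz.neg.exp).const_mul 4)).congr_deriv ?_
  simp only [lagSrc₂A, Pi.mul_apply, Pi.neg_apply, id]
  ring

omit h0 hl2

section

variable {n : ℕ} (hz : ContDiffOn ℝ n z (I ×ˢ Icc 0 l)) (hm : ContDiffOn ℝ n m (I ×ˢ Icc 0 l))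
  (hh : ContDiffOn ℝ n h (I ×ˢ Icc 0 l))

include hz hm
omit H

omit hI huI hl in
theorem contDiffOn_kapA : ContDiffOn ℝ n (lagKapA z m) (I ×ˢ Icc 0 l) := by
  unfold lagKapA lagKap
  fun_prop

theorem contDiffOn_coefA : ContDiffOn ℝ n (lagCoefA z m) (I ×ˢ Icc 0 l) := by
  have hφ := contDiffOn_lagPhi hI huI hl hz
  unfold lagCoefA lagKap
  fun_prop

theorem contDiffOn_src₂A : ContDiffOn ℝ n (lagSrc₂A z m) (I ×ˢ Icc 0 l) := by
  have hφ := contDiffOn_lagPhi hI huI hl hz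
  unfold lagSrc₂A lagKap
  fun_prop

include hh

theorem contDiffOn_src₁A : ContDiffOn ℝ n (lagSrc₁A l z m h) (I ×ˢ Icc 0 l) := by
  have hΓ := contDiffOn_lagGam hI huI hl hz hh
  have hΛ := contDiffOn_lagLam hI huI hl hz hh
  unfold lagSrc₁A lagKap
  fun_prop

end

include h0 hl2

theorem hasDerivWithinAt_mh_snd {t a : ℝ} (ht : t ∈ I) (ha : a ∈ Icc 0 l) :
    HasDerivWithinAt (fun b => m (t, b)) (lagMA l z m h m₁ h₁ m₂ h₂ (t, a)) (Icc 0 l) a ∧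
    HasDerivWithinAt (fun b => h (t, b)) (lagHA l z m h m₁ h₁ m₂ h₂ (t, a)) (Icc 0 l) a := by
  have cz := H.contDiffOn_zero_z
  have ch := H.contDiffOn_zero_h
  have cm : ContDiffOn ℝ (0 : ℕ) m (I ×ˢ Icc 0 l) := contDiffOn_zero.2 H.lin.cont₁
  exact IsLinSol.hasDerivWithinAt_snd hI (convex_Icc 0 l) h0 H.lin₁ H.lin₂
    (H.wronskian hI h0) H.lin (fun a ha b hb => by rw [H.initM a ha, H.initM b hb])
    (fun a ha b hb => by rw [H.initH a ha, H.initH b hb])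
    (contDiffOn_kapA cz cm).continuousOn
    (contDiffOn_coefA hI huI hl cz cm).continuousOn
    (contDiffOn_src₁A hI huI hl cz cm ch).continuousOn
    (contDiffOn_src₂A hI huI hl cz cm).continuousOn
    (fun t ht a ha => H.hasDerivWithinAt_kap_snd hI huI h0 hl hl2 ht ha)
    (fun t ht a ha => H.hasDerivWithinAt_coef_snd hI huI h0 hl hl2 ht ha)
    (fun t ht a ha => H.hasDerivWithinAt_src₁_snd hI huI h0 hl hl2 ht ha)
    (fun t ht a ha => H.hasDerivWithinAt_src₂_snd hI huI h0 hl hl2 ht ha) ht ha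

omit hl2 in
theorem hasDerivWithinAt_MAHA_fst {t a : ℝ} (ht : t ∈ I) (ha : a ∈ Icc 0 l) :
    HasDerivWithinAt (fun s => lagMA l z m h m₁ h₁ m₂ h₂ (s, a))
      (lagKap z (t, a) * lagHA l z m h m₁ h₁ m₂ h₂ (t, a)
        + (lagKapA z m (t, a) * h (t, a) + lagSrc₁A l z m h (t, a))) I t ∧
    HasDerivWithinAt (fun s => lagHA l z m h m₁ h₁ m₂ h₂ (s, a))
      (lagCoef z (t, a) * lagMA l z m h m₁ h₁ m₂ h₂ (t, a)
        + (lagCoefA z m (t, a) * m (t, a) + lagSrc₂A z m (t, a))) I t := by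
  have cz := H.contDiffOn_zero_z
  have ch := H.contDiffOn_zero_h
  have cm : ContDiffOn ℝ (0 : ℕ) m (I ×ˢ Icc 0 l) := contDiffOn_zero.2 H.lin.cont₁
  exact IsLinSol.hasDerivWithinAt_varConst hI h0 H.lin₁ H.lin₂ (H.wronskian hI h0)
    (((contDiffOn_kapA cz cm).continuousOn.mul H.contH).add
      (contDiffOn_src₁A hI huI hl cz cm ch).continuousOn)
    (((contDiffOn_coefA hI huI hl cz cm).continuousOn.mul H.lin.cont₁).add
      (contDiffOn_src₂A hI huI hl cz cm).continuousOn) ht ha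

theorem contDiffOn_succ_of_isLinSol {n : ℕ} {x₁ x₂ β₁ β₂ β₁a β₂a : ℝ × ℝ → ℝ}
    (hz : ContDiffOn ℝ n z (I ×ˢ Icc 0 l)) (hm : ContDiffOn ℝ n m (I ×ˢ Icc 0 l))
    (hm₁ : ContDiffOn ℝ n m₁ (I ×ˢ Icc 0 l))
    (hh₁ : ContDiffOn ℝ n h₁ (I ×ˢ Icc 0 l)) (hm₂ : ContDiffOn ℝ n m₂ (I ×ˢ Icc 0 l))
    (hh₂ : ContDiffOn ℝ n h₂ (I ×ˢ Icc 0 l))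
    (hx : IsLinSol I (Icc 0 l) (lagKap z) (lagCoef z) β₁ β₂ x₁ x₂)
    (hx₁ : ContDiffOn ℝ n x₁ (I ×ˢ Icc 0 l)) (hx₂ : ContDiffOn ℝ n x₂ (I ×ˢ Icc 0 l))
    (hx₁0 : ∀ a ∈ Icc 0 l, ∀ b ∈ Icc 0 l, x₁ (0, a) = x₁ (0, b))
    (hx₂0 : ∀ a ∈ Icc 0 l, ∀ b ∈ Icc 0 l, x₂ (0, a) = x₂ (0, b))
    (hβ₁ : ContDiffOn ℝ n β₁ (I ×ˢ Icc 0 l)) (hβ₂ : ContDiffOn ℝ n β₂ (I ×ˢ Icc 0 l))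
    (hβ₁a : ContDiffOn ℝ n β₁a (I ×ˢ Icc 0 l)) (hβ₂a : ContDiffOn ℝ n β₂a (I ×ˢ Icc 0 l))
    (dβ₁ : ∀ t ∈ I, ∀ a ∈ Icc 0 l, HasDerivWithinAt (fun b => β₁ (t, b)) (β₁a (t, a)) (Icc 0 l) a)
    (dβ₂ : ∀ t ∈ I, ∀ a ∈ Icc 0 l, HasDerivWithinAt (fun b => β₂ (t, b)) (β₂a (t, a)) (Icc 0 l) a) :
    ContDiffOn ℝ (n + 1 : ℕ) x₁ (I ×ˢ Icc 0 l) ∧ ContDiffOn ℝ (n + 1 : ℕ) x₂ (I ×ˢ Icc 0 l) := by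
  have hK : Convex ℝ (Icc 0 l) := convex_Icc 0 l
  have huK := uniqueDiffOn_Icc hl
  have hφ := contDiffOn_lagPhi hI huI hl hz
  have hκ : ContDiffOn ℝ n (lagKap z) (I ×ˢ Icc 0 l) := by unfold lagKap; fun_prop
  have hc : ContDiffOn ℝ n (lagCoef z) (I ×ˢ Icc 0 l) := by unfold lagCoef; fun_prop
  have hκa := contDiffOn_kapA hz hm
  have hca := contDiffOn_coefA hI huI hl hz hm
  have key := fun t ht a ha => IsLinSol.hasDerivWithinAt_snd hI hK h0 H.lin₁ H.lin₂
    (H.wronskian hI h0) hx hx₁0 hx₂0 hκa.continuousOn hca.continuousOn hβ₁a.continuousOn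
    hβ₂a.continuousOn
    (fun t ht a ha => H.hasDerivWithinAt_kap_snd hI huI h0 hl hl2 ht ha)
    (fun t ht a ha => H.hasDerivWithinAt_coef_snd hI huI h0 hl hl2 ht ha) dβ₁ dβ₂
    (t := t) (b := a) ht ha
  have hr₁ := (hκa.mul hx₂).add hβ₁a
  have hr₂ := (hca.mul hx₁).add hβ₂a
  exact ⟨contDiffOn_succ_of_partials hI hK huI huK ((hκ.mul hx₂).add hβ₁)
      (contDiffOn_varConst hI hK huI huK h0 hm₁ hm₂ hh₁ hh₂ hr₁ hr₂ hm₁ hm₂) hx.deriv₁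
      fun t ht a ha => (key t ht a ha).1,
    contDiffOn_succ_of_partials hI hK huI huK ((hc.mul hx₁).add hβ₂)
      (contDiffOn_varConst hI hK huI huK h0 hm₁ hm₂ hh₁ hh₂ hr₁ hr₂ hh₁ hh₂) hx.deriv₂
      fun t ht a ha => (key t ht a ha).2⟩

theorem contDiffOn_all (n : ℕ) :
    ContDiffOn ℝ n z (I ×ˢ Icc 0 l) ∧
    (ContDiffOn ℝ n m (I ×ˢ Icc 0 l) ∧ ContDiffOn ℝ n h (I ×ˢ Icc 0 l)) ∧
    (ContDiffOn ℝ n m₁ (I ×ˢ Icc 0 l) ∧ ContDiffOn ℝ n h₁ (I ×ˢ Icc 0 l)) ∧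
    (ContDiffOn ℝ n m₂ (I ×ˢ Icc 0 l) ∧ ContDiffOn ℝ n h₂ (I ×ˢ Icc 0 l)) := by
  have hK : Convex ℝ (Icc 0 l) := convex_Icc 0 l
  have huK := uniqueDiffOn_Icc hl
  induction n with
  | zero =>
    simp only [Nat.cast_zero, contDiffOn_zero]
    exact ⟨H.contZ, ⟨H.lin.cont₁, H.lin.cont₂⟩, ⟨H.lin₁.cont₁, H.lin₁.cont₂⟩,
      ⟨H.lin₂.cont₁, H.lin₂.cont₂⟩⟩
  | succ n ih =>
    obtain ⟨hz, ⟨hm, hh⟩, ⟨hm₁, hh₁⟩, ⟨hm₂, hh₂⟩⟩ := ih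
    have hφ := contDiffOn_lagPhi hI huI hl hz
    have hΓ := contDiffOn_lagGam hI huI hl hz hh
    have hβ₁ : ContDiffOn ℝ n (lagSrc₁ l z h) (I ×ˢ Icc 0 l) := by
      unfold lagSrc₁ lagKap; fun_prop
    have hβ₂ : ContDiffOn ℝ n (lagSrc₂ z) (I ×ˢ Icc 0 l) := by unfold lagSrc₂; fun_prop
    refine ⟨contDiffOn_succ_of_partials hI hK huI huK (contDiffOn_lagLam hI huI hl hz hh) hm
      H.derivZ fun t ht a ha => H.hasDerivWithinAt_z_snd hI huI h0 hl hl2 ht ha, ?_, ?_, ?_⟩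
    · exact H.contDiffOn_succ_of_isLinSol hI huI h0 hl hl2 hz hm hm₁ hh₁ hm₂ hh₂ H.lin hm hh
        (fun a ha b hb => by rw [H.initM a ha, H.initM b hb])
        (fun a ha b hb => by rw [H.initH a ha, H.initH b hb]) hβ₁ hβ₂
        (contDiffOn_src₁A hI huI hl hz hm hh) (contDiffOn_src₂A hI huI hl hz hm)
        (fun t ht a ha => H.hasDerivWithinAt_src₁_snd hI huI h0 hl hl2 ht ha)
        (fun t ht a ha => H.hasDerivWithinAt_src₂_snd hI huI h0 hl hl2 ht ha)
    · exact H.contDiffOn_succ_of_isLinSol hI huI h0 hl hl2 hz hm hm₁ hh₁ hm₂ hh₂ H.lin₁ hm₁ hh₁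
        (fun a ha b hb => by rw [H.initM₁ a ha, H.initM₁ b hb])
        (fun a ha b hb => by rw [H.initH₁ a ha, H.initH₁ b hb]) contDiffOn_const contDiffOn_const
        (β₁a := 0) (β₂a := 0) contDiffOn_const contDiffOn_const
        (fun t _ a _ => hasDerivWithinAt_const ..) (fun t _ a _ => hasDerivWithinAt_const ..)
    · exact H.contDiffOn_succ_of_isLinSol hI huI h0 hl hl2 hz hm hm₁ hh₁ hm₂ hh₂ H.lin₂ hm₂ hh₂
        (fun a ha b hb => by rw [H.initM₂ a ha, H.initM₂ b hb])
        (fun a ha b hb => by rw [H.initH₂ a ha, H.initH₂ b hb]) contDiffOn_const contDiffOn_const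
        (β₁a := 0) (β₂a := 0) contDiffOn_const contDiffOn_const
        (fun t _ a _ => hasDerivWithinAt_const ..) (fun t _ a _ => hasDerivWithinAt_const ..)

end IsLag

section Extraction

variable {l : ℝ} (hl : 0 ≤ l)

/-- A curve in `C([0, l])` viewed as a function of two variables. -/
def uncurryExt (Z : ℝ → C(Icc (0:ℝ) l, ℝ)) (p : ℝ × ℝ) : ℝ := icExt hl (Z p.1) p.2

variable (Z N : ℝ → C(Icc (0:ℝ) l, ℝ)) {t a : ℝ} (ha : a ∈ Icc 0 l)

theorem phiC_apply : phiC hl (Z t) ⟨a, ha⟩ = lagPhi (uncurryExt hl Z) (t, a) := rfl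

theorem alpC_apply : alpC hl (Z t) (N t) ⟨a, ha⟩
    = lagAlp (uncurryExt hl Z) (uncurryExt hl N) (t, a) :=
  intervalIntegral.integral_congr fun b hb => by
    have hb' := uIcc_subset_of_convex (convex_Icc 0 l) (left_mem_Icc.2 hl) ha hb
    simp only [icExt_of_mem hl _ hb', uncurryExt, lagKap, ← phiC_apply hl Z hb']
    rfl

theorem integral_betDensC_apply : prim hl (betDensC hl (Z t) (N t)) ⟨a, ha⟩ =
    ∫ b in (0:ℝ)..a, Real.sin (2 * l - 2 * lagPhi (uncurryExt hl Z) (t, b))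
      * uncurryExt hl N (t, b) * lagKap (uncurryExt hl Z) (t, b) :=
  intervalIntegral.integral_congr fun b hb => by
    have hb' := uIcc_subset_of_convex (convex_Icc 0 l) (left_mem_Icc.2 hl) ha hb
    simp only [icExt_of_mem hl _ hb', uncurryExt, lagKap, ← phiC_apply hl Z hb']
    rfl

theorem betC_apply : betC hl (Z t) (N t) ⟨a, ha⟩
    = lagBet l (uncurryExt hl Z) (uncurryExt hl N) (t, a) := by
  have hlm : l ∈ Icc 0 l := right_mem_Icc.2 hl
  have h0m : (0:ℝ) ∈ Icc 0 l := left_mem_Icc.2 hl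
  have hc : ContinuousOn (fun b => Real.sin (2 * l - 2 * lagPhi (uncurryExt hl Z) (t, b))
      * uncurryExt hl N (t, b) * lagKap (uncurryExt hl Z) (t, b)) (Icc 0 l) := by
    refine ((continuous_icExt hl (betDensC hl (Z t) (N t))).continuousOn).congr fun b hb => ?_
    simp only [icExt_of_mem hl _ hb, uncurryExt, lagKap, ← phiC_apply hl Z hb]
    rfl
  have e : betC hl (Z t) (N t) ⟨a, ha⟩ = prim hl (betDensC hl (Z t) (N t)) ⟨l, hlm⟩
    - prim hl (betDensC hl (Z t) (N t)) ⟨a, ha⟩ := rfl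
  rw [e, integral_betDensC_apply, integral_betDensC_apply, lagBet,
    intervalIntegral.integral_interval_sub_left, ← intervalIntegral.integral_symm]
  · exact (hc.mono (uIcc_subset_of_convex (convex_Icc 0 l) h0m hlm)).intervalIntegrable
  · exact (hc.mono (uIcc_subset_of_convex (convex_Icc 0 l) h0m ha)).intervalIntegrable

theorem gamC_apply : gamC hl (Z t) (N t) ⟨a, ha⟩
    = lagGam l (uncurryExt hl Z) (uncurryExt hl N) (t, a) := by
  rw [lagGam, ← phiC_apply hl Z ha, ← alpC_apply hl Z N ha, ← betC_apply hl Z N ha]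
  rfl

theorem lamC_apply : lamC hl (Z t) (N t) ⟨a, ha⟩
    = lagLam l (uncurryExt hl Z) (uncurryExt hl N) (t, a) := by
  rw [lagLam, ← phiC_apply hl Z ha, ← alpC_apply hl Z N ha, ← betC_apply hl Z N ha]
  rfl

theorem coefC_apply : coefC hl (Z t) ⟨a, ha⟩ = lagCoef (uncurryExt hl Z) (t, a) := by
  rw [lagCoef, ← phiC_apply hl Z ha, uncurryExt, icExt_of_mem hl _ ha]
  rfl

variable {I : Set ℝ} {Z N}

include hl in
theorem continuousOn_uncurryExt (hZ : ContinuousOn Z I) :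
    ContinuousOn (uncurryExt hl Z) (I ×ˢ Icc 0 l) := by
  have h1 : ContinuousOn (fun p : ℝ × ℝ => (Z p.1, projIcc 0 l hl p.2)) (I ×ˢ Icc 0 l) :=
    (hZ.comp continuousOn_fst fun p hp => hp.1).prodMk
      (continuous_projIcc.comp continuous_snd).continuousOn
  exact ContinuousEval.continuous_eval.comp_continuousOn h1

theorem HasDerivAt.uncurryExt {Z' : C(Icc (0:ℝ) l, ℝ)} (hZ : HasDerivAt Z Z' t) :
    HasDerivWithinAt (fun s => uncurryExt hl Z (s, a)) (Z' ⟨a, ha⟩) I t := by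
  have := ((ContinuousMap.evalCLM ℝ (⟨a, ha⟩ : Icc (0:ℝ) l)).hasFDerivAt.comp_hasDerivAt t
    hZ).hasDerivWithinAt (s := I)
  refine this.congr_of_eventuallyEq ?_ ?_
  · exact Eventually.of_forall fun s => icExt_of_mem hl _ ha
  · exact icExt_of_mem hl _ ha

/-- The two-variable functions associated with an integral curve of `lagField`. -/
theorem IsCurve.isLag {ε T : ℝ} {u : ℝ → Fin 7 → C(Icc (0:ℝ) l, ℝ)}
    (hu : IsCurve (lagField hl) lagInit ε T u) :
    IsLag l (Ioo (-ε) T) (uncurryExt hl fun t => u t 0) (uncurryExt hl fun t => u t 1)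
      (uncurryExt hl fun t => u t 2) (uncurryExt hl fun t => u t 3) (uncurryExt hl fun t => u t 4)
      (uncurryExt hl fun t => u t 5) (uncurryExt hl fun t => u t 6) := by
  obtain ⟨hu0, hu⟩ := hu
  have hui : ∀ i, ∀ t ∈ Ioo (-ε) T, HasDerivAt (fun t => u t i) (lagField hl (u t) i) t :=
    fun i t ht => hasDerivAt_pi.1 (hu t ht) i
  have hc : ∀ i, ContinuousOn (uncurryExt hl fun t => u t i) (Ioo (-ε) T ×ˢ Icc 0 l) := fun i =>
    continuousOn_uncurryExt hl fun t ht => (hui i t ht).continuousAt.continuousWithinAt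
  have hi : ∀ i, ∀ a (ha : a ∈ Icc 0 l), uncurryExt hl (fun t => u t i) (0, a)
      = (lagInit i : C(Icc (0:ℝ) l, ℝ)) ⟨a, ha⟩ := fun i a ha => by
    rw [uncurryExt, hu0, icExt_of_mem hl _ ha]
  have hd : ∀ i, ∀ t ∈ Ioo (-ε) T, ∀ a (ha : a ∈ Icc 0 l),
      HasDerivWithinAt (fun s => uncurryExt hl (fun t => u t i) (s, a))
        (lagField hl (u t) i ⟨a, ha⟩) (Ioo (-ε) T) t := fun i t ht a ha =>
    HasDerivAt.uncurryExt hl ha (hui i t ht)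
  have hv : ∀ i t a (ha : a ∈ Icc 0 l), u t i ⟨a, ha⟩ = uncurryExt hl (fun t => u t i) (t, a) :=
    fun i t a ha => by rw [uncurryExt, icExt_of_mem hl _ ha]
  have hφ := fun t a (ha : a ∈ Icc 0 l) => phiC_apply hl (fun t => u t 0) (t := t) ha
  have hΓ := fun t a (ha : a ∈ Icc 0 l) =>
    gamC_apply hl (fun t => u t 0) (fun t => u t 2) (t := t) ha
  have hcf := fun t a (ha : a ∈ Icc 0 l) => coefC_apply hl (fun t => u t 0) (t := t) ha
  have hlab : ∀ a (ha : a ∈ Icc 0 l), labelC ⟨a, ha⟩ = a := fun _ _ => rfl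
  refine ⟨hc 0, fun t ht a ha => (hd 0 t ht a ha).congr_deriv
    (lamC_apply hl (fun t => u t 0) (fun t => u t 2) ha), ⟨hc 1, hc 2, fun t ht a ha => ?_,
      fun t ht a ha => ?_⟩, ⟨hc 3, hc 4, fun t ht a ha => ?_, fun t ht a ha => ?_⟩,
    ⟨hc 5, hc 6, fun t ht a ha => ?_, fun t ht a ha => ?_⟩, ?_, ?_, ?_, ?_, ?_, ?_, ?_⟩
  · refine (hd 1 t ht a ha).congr_deriv ?_
    simp [lagField, lagSrc₁, lagKap, hv, hΓ]
    ring
  · refine (hd 2 t ht a ha).congr_deriv ?_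
    simp [lagField, lagSrc₂, hv, hφ, hcf, hlab]
    ring
  · refine (hd 3 t ht a ha).congr_deriv ?_
    simp [lagField, lagKap, hv]
  · refine (hd 4 t ht a ha).congr_deriv ?_
    simp [lagField, hv, hcf]
  · refine (hd 5 t ht a ha).congr_deriv ?_
    simp [lagField, lagKap, hv]
  · refine (hd 6 t ht a ha).congr_deriv ?_
    simp [lagField, hv, hcf]
  all_goals
    intro a ha
    rw [hi _ a ha]
    simp [lagInit]

end Extraction

theorem monotoneOn_of_hasDerivWithinAt_self {D : Set ℝ} (hD : Convex ℝ D) {f f' : ℝ → ℝ}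
    (hf : ∀ x ∈ D, HasDerivWithinAt f (f' x) D x) (hf' : ∀ x ∈ D, 0 ≤ f' x) : MonotoneOn f D :=
  monotoneOn_of_hasDerivWithinAt_nonneg hD (fun x hx => (hf x hx).continuousWithinAt)
    (fun x hx => (hf x (interior_subset hx)).mono interior_subset)
    fun x hx => hf' x (interior_subset hx)

/-- A positivity property of two-dimensional cooperative linear systems. -/
theorem nonneg_of_cooperative {τ : ℝ} (hτ : 0 ≤ τ) {x y A B : ℝ → ℝ}
    (hx : ∀ s ∈ Icc 0 τ, HasDerivWithinAt x (A s * y s) (Icc 0 τ) s)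
    (hy : ∀ s ∈ Icc 0 τ, HasDerivWithinAt y (B s * x s) (Icc 0 τ) s)
    (hA : ∀ s ∈ Icc 0 τ, 0 ≤ A s) (hB : ∀ s ∈ Icc 0 τ, 0 ≤ B s)
    (hx0 : x 0 = 0) (hy0 : 0 < y 0) : 0 ≤ x τ := by
  have h0 : (0:ℝ) ∈ Icc 0 τ := left_mem_Icc.2 hτ
  have h1 : MonotoneOn (fun s => x s * y s) (Icc 0 τ) :=
    monotoneOn_of_hasDerivWithinAt_self (convex_Icc 0 τ) (fun s hs => (hx s hs).mul (hy s hs))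
      fun s hs => by
        nlinarith [mul_nonneg (hA s hs) (sq_nonneg (y s)),
          mul_nonneg (hB s hs) (sq_nonneg (x s))]
  have h2 : ∀ s ∈ Icc 0 τ, 0 ≤ x s * y s := fun s hs => by
    simpa [hx0] using h1 h0 hs hs.1
  have h3 : MonotoneOn (fun s => y s * y s) (Icc 0 τ) :=
    monotoneOn_of_hasDerivWithinAt_self (convex_Icc 0 τ) (fun s hs => (hy s hs).mul (hy s hs))
      fun s hs => by nlinarith [mul_nonneg (hB s hs) (h2 s hs)]
  have h4 : ∀ s ∈ Icc 0 τ, y s ≠ 0 := fun s hs h => by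
    have := h3 h0 hs hs.1
    simp only [h, mul_zero] at this
    nlinarith
  have hyc : ContinuousOn y (Icc 0 τ) := fun s hs => (hy s hs).continuousWithinAt
  have h5 : 0 < y τ := by
    by_contra! h
    obtain ⟨s, hs, hs0⟩ := intermediate_value_Icc' hτ hyc ⟨h, hy0.le⟩
    exact h4 s hs hs0
  exact nonneg_of_mul_nonneg_left (h2 τ (right_mem_Icc.2 hτ)) h5

namespace IsLag

variable {l : ℝ} {I : Set ℝ} {z m h m₁ h₁ m₂ h₂ : ℝ × ℝ → ℝ}
  (H : IsLag l I z m h m₁ h₁ m₂ h₂) (hI : Convex ℝ I) (huI : UniqueDiffOn ℝ I) (h0 : (0:ℝ) ∈ I)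
  (hl : 0 < l) (hl2 : l < Real.pi / 2)

include H hI huI h0 hl hl2

omit hI huI h0 hl hl2 H in
theorem kap_pos (p : ℝ × ℝ) : 0 < lagKap z p := Real.exp_pos _

omit hI huI h0 hl2 in
theorem phi_monotone {t : ℝ} (ht : t ∈ I) : MonotoneOn (fun a => lagPhi z (t, a)) (Icc 0 l) :=
  monotoneOn_of_hasDerivWithinAt_self (convex_Icc 0 l)
    (fun _ ha => H.hasDerivWithinAt_phi_snd hl ht ha) fun _ _ => (kap_pos _).le

theorem phi_mem {t a : ℝ} (ht : t ∈ I) (ha : a ∈ Icc 0 l) : lagPhi z (t, a) ∈ Icc 0 l := by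
  have hm := H.phi_monotone hl ht
  have h1 := hm (left_mem_Icc.2 hl.le) ha ha.1
  have h2 := hm ha (right_mem_Icc.2 hl.le) ha.2
  simp only [lagPhi_zero, H.phi_right hI huI h0 hl hl2 ht] at h1 h2
  exact ⟨h1, h2⟩

theorem sin_phi_nonneg {t a : ℝ} (ht : t ∈ I) (ha : a ∈ Icc 0 l) :
    0 ≤ Real.sin (lagPhi z (t, a)) := by
  have := H.phi_mem hI huI h0 hl hl2 ht ha
  exact Real.sin_nonneg_of_nonneg_of_le_pi this.1 (by linarith [this.2])

theorem cos_phi_ge {t a : ℝ} (ht : t ∈ I) (ha : a ∈ Icc 0 l) :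
    Real.cos l ≤ Real.cos (lagPhi z (t, a)) := by
  have := H.phi_mem hI huI h0 hl hl2 ht ha
  exact Real.cos_le_cos_of_nonneg_of_le_pi this.1 (by linarith) this.2

omit H hI huI h0 in
theorem cos_pos : 0 < Real.cos l := Real.cos_pos_of_mem_Ioo ⟨by linarith, hl2⟩

theorem sin_two_phi_nonneg {t a : ℝ} (ht : t ∈ I) (ha : a ∈ Icc 0 l) :
    0 ≤ Real.sin (2 * lagPhi z (t, a)) ∧ 0 ≤ Real.sin (2 * l - 2 * lagPhi z (t, a)) := by
  have := H.phi_mem hI huI h0 hl hl2 ht ha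
  exact ⟨Real.sin_nonneg_of_nonneg_of_le_pi (by linarith [this.1]) (by linarith [this.2]),
    Real.sin_nonneg_of_nonneg_of_le_pi (by linarith [this.2]) (by linarith [this.1])⟩

section

variable {t : ℝ} (ht : t ∈ I) (ht0 : 0 ≤ t)

omit H huI hl hl2 in
include ht in
theorem Icc_subset_of_mem : Icc 0 t ⊆ I := hI.ordConnected.out h0 ht

include ht ht0

theorem HA_nonneg {a : ℝ} (ha : a ∈ Icc 0 l) : 0 ≤ lagHA l z m h m₁ h₁ m₂ h₂ (t, a) := by
  have hs : Icc 0 t ⊆ I := Icc_subset_of_mem hI h0 ht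
  refine nonneg_of_cooperative ht0
    (x := fun s => lagHA l z m h m₁ h₁ m₂ h₂ (s, a))
    (y := fun s => 2 + a ^ 2 * (lagMA l z m h m₁ h₁ m₂ h₂ (s, a) - m (s, a) ^ 2
      + lagKap z (s, a) ^ 2))
    (A := fun s => 2 * Real.cos (lagPhi z (s, a)) * Real.exp (-z (s, a)))
    (B := fun s => a ^ 2 * lagKap z (s, a)) ?_ ?_ ?_ ?_ ?_ ?_
  · intro s hst
    refine ((H.hasDerivWithinAt_MAHA_fst hI huI h0 hl (hs hst) ha).2.mono hs).congr_deriv ?_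
    simp only [lagCoef, lagCoefA, lagSrc₂A, lagKap]
    rw [show 2 * z (s, a) = z (s, a) + z (s, a) by ring, Real.exp_add, Real.exp_neg]
    have := (Real.exp_pos (z (s, a))).ne'
    field_simp
    ring
  · intro s hst
    refine ((((((H.hasDerivWithinAt_MAHA_fst hI huI h0 hl (hs hst) ha).1.sub
      ((H.lin.deriv₁ s (hs hst) a ha).pow 2)).add
      ((H.hasDerivWithinAt_kap_fst (hs hst) ha).pow 2)).const_mul (a ^ 2)).const_add 2).mono
        hs).congr_deriv ?_
    simp only [lagKapA, lagSrc₁, lagSrc₁A]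
    ring
  · intro s hst
    have := (cos_pos hl hl2).trans_le (H.cos_phi_ge hI huI h0 hl hl2 (hs hst) ha)
    positivity
  · intro s _
    have := kap_pos (z := z) (s, a)
    positivity
  · simp [lagHA, varConst]
  · simp only [H.initM a ha, H.kap_init ha]
    simp only [lagMA, varConst, intervalIntegral.integral_same]
    nlinarith [sq_nonneg a]

theorem h_monotone : MonotoneOn (fun a => h (t, a)) (Icc 0 l) :=
  monotoneOn_of_hasDerivWithinAt_self (convex_Icc 0 l)
    (fun _ ha => (H.hasDerivWithinAt_mh_snd hI huI h0 hl hl2 ht ha).2)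
    fun _ ha => H.HA_nonneg hI huI h0 hl hl2 ht ht0 ha

omit huI hl2 ht0 in
theorem h_zero : h (t, 0) = 0 := by
  have h0m : (0:ℝ) ∈ Icc 0 l := left_mem_Icc.2 hl.le
  have := eq_integral_of_hasDerivWithinAt hI (y := fun s => h (s, 0)) (y' := fun _ => 0)
    (fun s hs => (H.lin.deriv₂ s hs 0 h0m).congr_deriv (by simp [lagCoef, lagSrc₂]))
    continuousOn_const h0 ht
  simpa [H.initH 0 h0m] using this

theorem h_nonneg {a : ℝ} (ha : a ∈ Icc 0 l) : 0 ≤ h (t, a) := by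
  have := H.h_monotone hI huI h0 hl hl2 ht ht0 (left_mem_Icc.2 hl.le) ha ha.1
  simpa only [H.h_zero hI h0 hl ht] using this

theorem alp_nonneg {a : ℝ} (ha : a ∈ Icc 0 l) : 0 ≤ lagAlp z h (t, a) := by
  have := monotoneOn_of_hasDerivWithinAt_self (convex_Icc 0 l) (fun b hb =>
    hasDerivWithinAt_lagAlp_snd hI huI hl H.contZ H.contH ht hb) (fun b hb => by
      have h1 := (H.sin_two_phi_nonneg hI huI h0 hl hl2 ht hb).1
      have h2 := H.h_nonneg hI huI h0 hl hl2 ht ht0 hb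
      have h3 := kap_pos (z := z) (t, b)
      positivity) (left_mem_Icc.2 hl.le) ha ha.1
  simpa using this

theorem bet_nonneg {a : ℝ} (ha : a ∈ Icc 0 l) : 0 ≤ lagBet l z h (t, a) := by
  have := monotoneOn_of_hasDerivWithinAt_self (convex_Icc 0 l) (fun b hb =>
    (hasDerivWithinAt_lagBet_snd hI huI hl H.contZ H.contH ht hb).neg) (fun b hb => by
      have h1 := (H.sin_two_phi_nonneg hI huI h0 hl hl2 ht hb).2
      have h2 := H.h_nonneg hI huI h0 hl hl2 ht ht0 hb
      have h3 := kap_pos (z := z) (t, b)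
      rw [neg_neg]
      positivity) ha (right_mem_Icc.2 hl.le) ha.2
  simpa using this

theorem gam_nonpos {a : ℝ} (ha : a ∈ Icc 0 l) : lagGam l z h (t, a) ≤ 0 := by
  have h1 := H.sin_two_phi_nonneg hI huI h0 hl hl2 ht ha
  have h2 := mul_nonneg h1.2 (H.alp_nonneg hI huI h0 hl hl2 ht ht0 ha)
  have h3 := mul_nonneg h1.1 (H.bet_nonneg hI huI h0 hl hl2 ht ht0 ha)
  have h4 := sin_two_mul_pos hl hl2
  rw [lagGam, neg_mul]
  exact neg_nonpos.2 (by positivity)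

theorem m_nonneg {a : ℝ} (ha : a ∈ Icc 0 l) : 0 ≤ m (t, a) := by
  have hs : Icc 0 t ⊆ I := Icc_subset_of_mem hI h0 ht
  have := monotoneOn_of_hasDerivWithinAt_self (convex_Icc 0 t) (f := fun s => m (s, a))
    (fun s hst => (H.lin.deriv₁ s (hs hst) a ha).mono hs) (fun s hst => by
      have h1 := H.h_nonneg hI huI h0 hl hl2 (hs hst) hst.1 ha
      have h2 := H.gam_nonpos hI huI h0 hl hl2 (hs hst) hst.1 ha
      have h3 := kap_pos (z := z) (s, a)
      simp only [lagSrc₁]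
      nlinarith [mul_nonneg h3.le h1, mul_nonneg h3.le (neg_nonneg.2 h2)])
      (left_mem_Icc.2 ht0) (right_mem_Icc.2 ht0) ht0
  simpa [H.initM a ha] using this

omit ht0 in
theorem h_fst_monotone {a : ℝ} (ha : a ∈ Icc 0 l) : MonotoneOn (fun s => h (s, a)) (Icc 0 t) := by
  have hs : Icc 0 t ⊆ I := Icc_subset_of_mem hI h0 ht
  refine monotoneOn_of_hasDerivWithinAt_self (convex_Icc 0 t)
    (fun s hst => (H.lin.deriv₂ s (hs hst) a ha).mono hs) (fun s hst => ?_)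
  have h1 := H.m_nonneg hI huI h0 hl hl2 (hs hst) hst.1 ha
  have h2 := (cos_pos hl hl2).trans_le (H.cos_phi_ge hI huI h0 hl hl2 (hs hst) ha)
  have h3 := H.sin_phi_nonneg hI huI h0 hl hl2 (hs hst) ha
  have h4 := ha.1
  simp only [lagCoef, lagSrc₂]
  positivity

end

end IsLag

/-- A differential inequality of Riccati type can only hold on a bounded interval. -/
theorem time_le_of_riccati {τ k : ℝ} (hτ : 0 ≤ τ) (hk : 0 < k) {x L y y' : ℝ → ℝ}
    (hx : ∀ s ∈ Icc 0 τ, HasDerivWithinAt x (L s * x s) (Icc 0 τ) s)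
    (hy : ∀ s ∈ Icc 0 τ, HasDerivWithinAt y (y' s) (Icc 0 τ) s)
    (hL : ∀ s ∈ Icc 0 τ, y s / 2 ≤ L s) (hy' : ∀ s ∈ Icc 0 τ, k * x s ≤ y' s)
    (hx0 : ∀ s ∈ Icc 0 τ, 0 ≤ x s) (hxi : x 0 = 1) (hyi : y 0 = 0) :
    τ ≤ Real.pi / √k := by
  have h0 : (0:ℝ) ∈ Icc 0 τ := left_mem_Icc.2 hτ
  have hK : Convex ℝ (Icc 0 τ) := convex_Icc 0 τ
  have hxc : ContinuousOn x (Icc 0 τ) := fun s hs => (hx s hs).continuousWithinAt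
  set J : ℝ → ℝ := fun s => ∫ r in (0:ℝ)..s, k * x r with hJ
  have hJ0 : J 0 = 0 := by simp [hJ]
  have dJ : ∀ s ∈ Icc 0 τ, HasDerivWithinAt J (k * x s) (Icc 0 τ) s := fun s hs =>
    hasDerivWithinAt_integral_of_continuousOn hK (continuousOn_const.mul hxc) h0 hs
  have hJy : ∀ s ∈ Icc 0 τ, J s ≤ y s := fun s hs => by
    have := monotoneOn_of_hasDerivWithinAt_self hK (f := fun s => y s - J s)
      (fun s hs => (hy s hs).sub (dJ s hs)) (fun s hs => sub_nonneg.2 (hy' s hs)) h0 hs hs.1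
    simp only [hJ0, hyi] at this
    linarith
  have hJx : ∀ s ∈ Icc 0 τ, k + J s ^ 2 / 4 ≤ k * x s := fun s hs => by
    have := monotoneOn_of_hasDerivWithinAt_self hK (f := fun s => k * x s - J s ^ 2 / 4)
      (fun s hs => ((hx s hs).const_mul k).sub (((dJ s hs).pow 2).div_const 4)) (fun s hs => by
        have h1 := mul_le_mul_of_nonneg_right ((div_le_div_of_nonneg_right (hJy s hs)
          zero_le_two).trans (hL s hs)) (mul_nonneg hk.le (hx0 s hs))
        simp only [Nat.cast_ofNat, Nat.add_one_sub_one, pow_one]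
        nlinarith) h0 hs hs.1
    simp only [hJ0, hxi] at this
    linarith
  have hk' := Real.sqrt_pos.2 hk
  have hkk := Real.sq_sqrt hk.le
  have hfin := monotoneOn_of_hasDerivWithinAt_self hK
    (f := fun s => Real.arctan (J s / (2 * √k)) - √k / 2 * s)
    (fun s hs => ((dJ s hs).div_const (2 * √k)).arctan.sub
      ((hasDerivWithinAt_id s _).const_mul (√k / 2))) (fun s hs => by
      have h1 := hJx s hs
      rw [sub_nonneg, mul_one]
      have : 1 + (J s / (2 * √k)) ^ 2 = (k + J s ^ 2 / 4) / k := by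
        rw [div_pow, mul_pow, hkk]
        field_simp
        ring
      rw [this, one_div_div, div_mul_div_comm, div_le_div_iff₀ two_pos (by positivity)]
      have h2 : √k * √k = k := Real.mul_self_sqrt hk.le
      nlinarith [mul_le_mul_of_nonneg_left h1 hk.le]) h0 (right_mem_Icc.2 hτ) hτ
  simp only [hJ0, zero_div, Real.arctan_zero, mul_zero, sub_zero] at hfin
  rw [le_div_iff₀ hk']
  nlinarith [Real.arctan_lt_pi_div_two (J τ / (2 * √k))]

theorem cos_add_cos_sub (x y : ℝ) :
    Real.cos (x + y) + Real.cos (x - y) = 2 * (Real.cos x * Real.cos y) := by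
  rw [Real.cos_add, Real.cos_sub]; ring

theorem sin_add_sin_sub (x y : ℝ) :
    Real.sin (x + y) + Real.sin (x - y) = 2 * (Real.sin x * Real.cos y) := by
  rw [Real.sin_add, Real.sin_sub]; ring

namespace IsLag

variable {l : ℝ} {I : Set ℝ} {z m h m₁ h₁ m₂ h₂ : ℝ × ℝ → ℝ}
  (H : IsLag l I z m h m₁ h₁ m₂ h₂) (hI : Convex ℝ I) (huI : UniqueDiffOn ℝ I) (h0 : (0:ℝ) ∈ I)
  (hl : 0 < l) (hl2 : l < Real.pi / 2)
  {t : ℝ} (ht : t ∈ I) (ht0 : 0 ≤ t)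

include H hI huI h0 hl hl2 ht

theorem cos_two_phi_sub_ge {a : ℝ} (ha : a ∈ Icc 0 l) :
    Real.cos l ≤ Real.cos (2 * lagPhi z (t, a) - l) := by
  have := H.phi_mem hI huI h0 hl hl2 ht ha
  rw [← Real.cos_abs (2 * lagPhi z (t, a) - l)]
  exact Real.cos_le_cos_of_nonneg_of_le_pi (abs_nonneg _) (by linarith)
    (abs_le.2 ⟨by linarith [this.1], by linarith [this.2]⟩)

include ht0

theorem bet_le_alp : lagBet l z h (t, 0) ≤ lagAlp z h (t, l) := by
  have h0m : (0:ℝ) ∈ Icc 0 l := left_mem_Icc.2 hl.le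
  have hlm : l ∈ Icc 0 l := right_mem_Icc.2 hl.le
  have := monotoneOn_of_hasDerivWithinAt_self (convex_Icc 0 l)
    (f := fun a => lagAlp z h (t, a) + lagBet l z h (t, a)
      + (Real.cos (2 * lagPhi z (t, a)) + Real.cos (2 * l - 2 * lagPhi z (t, a))
        - (1 + Real.cos (2 * l))) / 2 * h (t, a))
    (fun a ha => by
      have dφ := (H.hasDerivWithinAt_phi_snd hl ht ha).const_mul 2
      exact ((hasDerivWithinAt_lagAlp_snd hI huI hl H.contZ H.contH ht ha).add
        (hasDerivWithinAt_lagBet_snd hI huI hl H.contZ H.contH ht ha)).add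
        ((((dφ.cos.add (dφ.const_sub (2 * l)).cos).sub_const _).div_const 2).mul
          (H.hasDerivWithinAt_mh_snd hI huI h0 hl hl2 ht ha).2)) (fun a ha => by
      have h1 := H.HA_nonneg hI huI h0 hl hl2 ht ht0 ha
      have h2 := mul_le_mul_of_nonneg_left (H.cos_two_phi_sub_ge hI huI h0 hl hl2 ht ha)
        (cos_pos hl hl2).le
      have e1 : Real.cos (2 * lagPhi z (t, a)) + Real.cos (2 * l - 2 * lagPhi z (t, a))
          = 2 * (Real.cos l * Real.cos (2 * lagPhi z (t, a) - l)) := by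
        rw [← cos_add_cos_sub]
        ring_nf
      have e2 : 1 + Real.cos (2 * l) = 2 * (Real.cos l * Real.cos l) := by
        rw [Real.cos_two_mul]; ring
      have h3 : 0 ≤ (Real.cos (2 * lagPhi z (t, a)) + Real.cos (2 * l - 2 * lagPhi z (t, a))
        - (1 + Real.cos (2 * l))) / 2 := by rw [e1, e2]; linarith
      have := mul_nonneg h3 h1
      simp only [Pi.add_apply]
      linarith) h0m hlm hl.le
  simp [H.phi_right hI huI h0 hl hl2 ht, H.h_zero hI h0 hl ht] at this
  simpa [add_comm (Real.cos (2 * l))] using this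

theorem integral_le_lam : (∫ a in (0:ℝ)..l, h (t, a) * lagKap z (t, a)) / 2
    ≤ lagLam l z h (t, l) := by
  have h0m : (0:ℝ) ∈ Icc 0 l := left_mem_Icc.2 hl.le
  have hlm : l ∈ Icc 0 l := right_mem_Icc.2 hl.le
  have hs : 0 < Real.sin l := Real.sin_pos_of_pos_of_lt_pi hl (by linarith)
  have hS := sin_two_mul_pos hl hl2
  have hc : ContinuousOn (fun a => h (t, a) * lagKap z (t, a)) (Icc 0 l) :=
    (H.contH.mul H.contKap).comp (by fun_prop) fun a ha => ⟨ht, ha⟩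
  have := monotoneOn_of_hasDerivWithinAt_self (convex_Icc 0 l)
    (f := fun a => lagAlp z h (t, a) - lagBet l z h (t, a)
      - Real.sin (2 * l) * ∫ b in (0:ℝ)..a, h (t, b) * lagKap z (t, b))
    (fun a ha => ((hasDerivWithinAt_lagAlp_snd hI huI hl H.contZ H.contH ht ha).sub
        (hasDerivWithinAt_lagBet_snd hI huI hl H.contZ H.contH ht ha)).sub
        ((hasDerivWithinAt_integral_of_continuousOn (convex_Icc 0 l) hc h0m ha).const_mul _))
    (fun a ha => by
      have h1 := mul_nonneg (H.h_nonneg hI huI h0 hl hl2 ht ht0 ha) (kap_pos (z := z) (t, a)).le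
      have h2 := mul_le_mul_of_nonneg_left (H.cos_two_phi_sub_ge hI huI h0 hl hl2 ht ha)
        hs.le
      have e1 : Real.sin (2 * lagPhi z (t, a)) + Real.sin (2 * l - 2 * lagPhi z (t, a))
          = 2 * (Real.sin l * Real.cos (2 * lagPhi z (t, a) - l)) := by
        rw [← sin_add_sin_sub]
        ring_nf
      have h3 : 0 ≤ Real.sin (2 * lagPhi z (t, a)) + Real.sin (2 * l - 2 * lagPhi z (t, a))
        - Real.sin (2 * l) := by rw [e1, Real.sin_two_mul]; linarith
      have := mul_nonneg h3 h1
      linarith) h0m hlm hl.le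
  have hb := H.bet_le_alp hI huI h0 hl hl2 ht ht0
  simp at this
  simp only [lagLam, H.phi_right hI huI h0 hl hl2 ht, sub_self, Real.cos_zero, lagBet_right]
  rw [le_inv_mul_iff₀ hS]
  linarith

omit ht ht0 h0 hl2 in
theorem continuousOn_density_deriv :
    ContinuousOn (fun p => (lagCoef z p * m p + lagSrc₂ z p) * lagKap z p
      + h p * (2 * lagLam l z h p * lagKap z p)) (I ×ˢ Icc 0 l) := by
  have hφ := H.contPhi hI huI hl
  have hΛ := H.contLam hI huI hl
  have c1 := H.contZ
  have c2 := H.lin.cont₁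
  have c3 := H.contH
  unfold lagCoef lagSrc₂ lagKap
  fun_prop

theorem integral_deriv_ge : 2 * l ^ 2 * Real.cos l * Real.exp (z (t, l)) ≤
    ∫ a in (0:ℝ)..l, ((lagCoef z (t, a) * m (t, a) + lagSrc₂ z (t, a)) * lagKap z (t, a)
      + h (t, a) * (2 * lagLam l z h (t, a) * lagKap z (t, a))) := by
  have h0m : (0:ℝ) ∈ Icc 0 l := left_mem_Icc.2 hl.le
  have hlm : l ∈ Icc 0 l := right_mem_Icc.2 hl.le
  have hS := sin_two_mul_pos hl hl2
  have hmt : MapsTo (fun b : ℝ => (t, b)) (Icc 0 l) (I ×ˢ Icc 0 l) := fun b hb => ⟨ht, hb⟩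
  have hc : ContinuousOn (fun a =>
      (lagCoef z (t, a) * m (t, a) + lagSrc₂ z (t, a)) * lagKap z (t, a)
      + h (t, a) * (2 * lagLam l z h (t, a) * lagKap z (t, a))) (Icc 0 l) := by
    exact (H.continuousOn_density_deriv hI huI hl).comp (f := fun b : ℝ => (t, b))
      (by fun_prop) hmt
  have := monotoneOn_of_hasDerivWithinAt_self (convex_Icc 0 l)
    (f := fun a => (∫ a in (0:ℝ)..a, ((lagCoef z (t, a) * m (t, a) + lagSrc₂ z (t, a))
      * lagKap z (t, a) + h (t, a) * (2 * lagLam l z h (t, a) * lagKap z (t, a))))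
      - (2 * (a ^ 2 * Real.cos (lagPhi z (t, a)) * Real.exp (z (t, a)))
        + lagLam l z h (t, a) ^ 2 + 4 * lagGam l z h (t, a) ^ 2))
    (fun a ha => (hasDerivWithinAt_integral_of_continuousOn (convex_Icc 0 l) hc h0m ha).sub
      (((((((hasDerivWithinAt_id a _).pow 2).mul (H.hasDerivWithinAt_phi_snd hl ht ha).cos).mul
        (H.hasDerivWithinAt_z_snd hI huI h0 hl hl2 ht ha).exp).const_mul 2).add
        ((hasDerivWithinAt_lagLam_snd hI huI hl H.contZ H.contH hS.ne' ht ha).pow 2)).add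
        (((hasDerivWithinAt_lagGam_snd hI huI hl H.contZ H.contH hS.ne' ht ha).pow 2).const_mul 4)))
    (fun a ha => by
      have h1 := H.sin_phi_nonneg hI huI h0 hl hl2 ht ha
      have h2 : 0 ≤ 4 * (a ^ 2 * Real.sin (lagPhi z (t, a)) * Real.exp (z (t, a)) ^ 3) := by
        positivity
      refine h2.trans_eq ?_
      have h3 := (Real.exp_pos (z (t, a))).ne'
      simp only [lagCoef, lagSrc₂, lagKap, Pi.mul_apply, Pi.pow_apply, id]
      rw [show 2 * z (t, a) = z (t, a) + z (t, a) by ring, Real.exp_add, Real.exp_neg]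
      field_simp
      ring) h0m hlm hl.le
  have hb := H.bet_le_alp hI huI h0 hl hl2 ht ht0
  have hb0 := H.bet_nonneg hI huI h0 hl hl2 ht ht0 h0m
  simp only [lagGam_zero, H.gam_right hI huI h0 hl hl2 ht, H.phi_right hI huI h0 hl hl2 ht,
    intervalIntegral.integral_same] at this
  have hΛ : lagLam l z h (t, 0) ^ 2 ≤ lagLam l z h (t, l) ^ 2 := by
    simp only [lagLam, H.phi_right hI huI h0 hl hl2 ht, sub_self, Real.cos_zero, lagBet_right,
      lagPhi_zero, lagAlp_zero, mul_zero, sub_zero, zero_sub, one_mul, mul_pow]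
    exact mul_le_mul_of_nonneg_left (by nlinarith) (by positivity)
  nlinarith

theorem time_le : t ≤ Real.pi / √(2 * l ^ 2 * Real.cos l) := by
  have hs : Icc 0 t ⊆ I := Icc_subset_of_mem hI h0 ht
  have hlm : l ∈ Icc 0 l := right_mem_Icc.2 hl.le
  have h0m : (0:ℝ) ∈ Icc 0 l := left_mem_Icc.2 hl.le
  refine time_le_of_riccati ht0 (by have := cos_pos hl hl2; positivity)
    (x := fun s => Real.exp (z (s, l)))
    (y := fun s => ∫ a in (0:ℝ)..l, h (s, a) * lagKap z (s, a))
    (fun s hst => ((H.derivZ s (hs hst) l hlm).exp.mono hs).congr_deriv (mul_comm _ _))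
    (fun s hst => (hasDerivWithinAt_integral_fst hI (convex_Icc 0 l)
      (f := fun p => h p * lagKap z p)
      (ft := fun p => (lagCoef z p * m p + lagSrc₂ z p) * lagKap z p
        + h p * (2 * lagLam l z h p * lagKap z p)) (H.contH.mul H.contKap)
      (H.continuousOn_density_deriv hI huI hl)
      (fun r hr b hb => (H.lin.deriv₂ r hr b hb).mul (H.hasDerivWithinAt_kap_fst hr hb))
      h0m hlm (hs hst)).mono hs)
    (fun s hst => H.integral_le_lam hI huI h0 hl hl2 (hs hst) hst.1)
    (fun s hst => H.integral_deriv_ge hI huI h0 hl hl2 (hs hst) hst.1)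
    (fun s _ => (Real.exp_pos _).le) (by simp [H.initZ l hlm]) ?_
  · have : ∫ a in (0:ℝ)..l, h (0, a) * lagKap z (0, a) = ∫ a in (0:ℝ)..l, 0 :=
      intervalIntegral.integral_congr fun b hb => by
        simp [H.initH b (uIcc_subset_of_convex (convex_Icc 0 l) h0m hlm hb)]
    simpa using this

end IsLag

/-- Boundedness of the solutions of a planar linear system with bounded coefficients. -/
theorem abs_le_of_linear {τ C : ℝ} (hτ : 0 ≤ τ) {x y A B : ℝ → ℝ}
    (hx : ∀ s ∈ Icc 0 τ, HasDerivWithinAt x (A s * y s) (Icc 0 τ) s)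
    (hy : ∀ s ∈ Icc 0 τ, HasDerivWithinAt y (B s * x s) (Icc 0 τ) s)
    (hA : ∀ s ∈ Icc 0 τ, |A s| ≤ C) (hB : ∀ s ∈ Icc 0 τ, |B s| ≤ C)
    (h0 : x 0 ^ 2 + y 0 ^ 2 = 1) :
    |x τ| ≤ Real.exp (2 * C * τ) ∧ |y τ| ≤ Real.exp (2 * C * τ) := by
  have hC : 0 ≤ C := (abs_nonneg _).trans (hA 0 (left_mem_Icc.2 hτ))
  have h1 := monotoneOn_of_hasDerivWithinAt_self (convex_Icc 0 τ)
    (f := fun s => -((x s ^ 2 + y s ^ 2) * Real.exp (-(2 * C) * s)))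
    (fun s hs => ((((hx s hs).pow 2).add ((hy s hs).pow 2)).mul
      ((hasDerivWithinAt_id s _).const_mul (-(2 * C))).exp).neg) (fun s hs => by
      have h2 := Real.exp_pos (-(2 * C) * s)
      have h3 : |(A s + B s) * (x s * y s)| ≤ C * (x s ^ 2 + y s ^ 2) := by
        rw [abs_mul]
        have h4 : |x s * y s| ≤ (x s ^ 2 + y s ^ 2) / 2 := by
          rw [abs_mul, ← sq_abs (x s), ← sq_abs (y s)]
          nlinarith [sq_nonneg (|x s| - |y s|)]
        have h5 : |A s + B s| ≤ 2 * C := (abs_add_le _ _).trans (by linarith [hA s hs, hB s hs])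
        calc _ ≤ 2 * C * ((x s ^ 2 + y s ^ 2) / 2) := by gcongr
          _ = _ := by ring
      have h6 := mul_nonneg (sub_nonneg.2 ((le_abs_self _).trans h3)) h2.le
      simp only [Pi.add_apply, Pi.pow_apply, Nat.cast_ofNat, Nat.add_one_sub_one, pow_one, id]
      nlinarith) (left_mem_Icc.2 hτ) (right_mem_Icc.2 hτ) hτ
  simp only [h0, mul_zero, Real.exp_zero, mul_one, neg_mul, Real.exp_neg] at h1
  have h7 : x τ ^ 2 + y τ ^ 2 ≤ Real.exp (2 * C * τ) := by
    have h8 := Real.exp_pos (2 * C * τ)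
    rw [neg_le_neg_iff, ← div_eq_mul_inv, div_le_one h8] at h1
    exact h1
  have h9 : 1 ≤ Real.exp (2 * C * τ) := Real.one_le_exp (by positivity)
  constructor
  · refine abs_le_of_sq_le_sq' ?_ (by positivity) |> abs_le.2
    nlinarith [sq_nonneg (y τ)]
  · refine abs_le_of_sq_le_sq' ?_ (by positivity) |> abs_le.2
    nlinarith [sq_nonneg (x τ)]

namespace IsLag

variable {l : ℝ} {I : Set ℝ} {z m h m₁ h₁ m₂ h₂ : ℝ × ℝ → ℝ}
  (H : IsLag l I z m h m₁ h₁ m₂ h₂) (hI : Convex ℝ I) (huI : UniqueDiffOn ℝ I) (h0 : (0:ℝ) ∈ I)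
  (hl : 0 < l) (hl2 : l < Real.pi / 2)

include H hI huI h0 hl hl2

theorem alp_bet_le {t : ℝ} (ht : t ∈ I) (ht0 : 0 ≤ t) {M : ℝ} (hM : h (t, l) ≤ M) {a : ℝ}
    (ha : a ∈ Icc 0 l) : lagAlp z h (t, a) ≤ M * l ∧ lagBet l z h (t, a) ≤ M * l := by
  have h0m : (0:ℝ) ∈ Icc 0 l := left_mem_Icc.2 hl.le
  have hlm : l ∈ Icc 0 l := right_mem_Icc.2 hl.le
  have hφ := H.phi_mem hI huI h0 hl hl2 ht ha
  have hh : ∀ b ∈ Icc 0 l, 0 ≤ h (t, b) ∧ h (t, b) ≤ M := fun b hb =>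
    ⟨H.h_nonneg hI huI h0 hl hl2 ht ht0 hb,
      (H.h_monotone hI huI h0 hl hl2 ht ht0 hb hlm hb.2).trans hM⟩
  have hM0 : 0 ≤ M := (hh l hlm).1.trans (hh l hlm).2
  have key : ∀ b ∈ Icc 0 l, ∀ x : ℝ,
      0 ≤ M * lagKap z (t, b) - Real.sin x * h (t, b) * lagKap z (t, b) := fun b hb x => by
    have h1 := (hh b hb).2
    have h2 := (hh b hb).1
    have h3 := mul_le_mul_of_nonneg_right (Real.sin_le_one x) h2
    have h4 := kap_pos (z := z) (t, b)
    nlinarith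
  have h1 := monotoneOn_of_hasDerivWithinAt_self (convex_Icc 0 l)
    (f := fun a => M * lagPhi z (t, a) - lagAlp z h (t, a)) (fun b hb =>
    ((H.hasDerivWithinAt_phi_snd hl ht hb).const_mul M).sub
      (hasDerivWithinAt_lagAlp_snd hI huI hl H.contZ H.contH ht hb)) (fun b hb => key b hb _)
      h0m ha ha.1
  have h2 := monotoneOn_of_hasDerivWithinAt_self (convex_Icc 0 l)
    (f := fun a => M * lagPhi z (t, a) + lagBet l z h (t, a)) (fun b hb =>
    ((H.hasDerivWithinAt_phi_snd hl ht hb).const_mul M).add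
      (hasDerivWithinAt_lagBet_snd hI huI hl H.contZ H.contH ht hb)) (fun b hb => by
        rw [← sub_eq_add_neg]; exact key b hb _)
      ha hlm ha.2
  simp only [lagPhi_zero, lagAlp_zero, lagBet_right, H.phi_right hI huI h0 hl hl2 ht] at h1 h2
  constructor <;> nlinarith [hφ.1, hφ.2]

/-- Bounds on the stream function in terms of `g`. -/
theorem lam_gam_le {t : ℝ} (ht : t ∈ I) (ht0 : 0 ≤ t) {M : ℝ} (hM : h (t, l) ≤ M) {a : ℝ}
    (ha : a ∈ Icc 0 l) : |lagLam l z h (t, a)| ≤ (Real.sin (2 * l))⁻¹ * (2 * (M * l)) ∧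
      |lagGam l z h (t, a)| ≤ (Real.sin (2 * l))⁻¹ * (2 * (M * l)) := by
  have hS := sin_two_mul_pos hl hl2
  obtain ⟨h1, h2⟩ := H.alp_bet_le hI huI h0 hl hl2 ht ht0 hM ha
  have h3 := H.alp_nonneg hI huI h0 hl hl2 ht ht0 ha
  have h4 := H.bet_nonneg hI huI h0 hl hl2 ht ht0 ha
  have key : ∀ x y A B : ℝ, |x| ≤ 1 → |y| ≤ 1 → 0 ≤ A → 0 ≤ B → A ≤ M * l → B ≤ M * l →
      |x * A + y * B| ≤ 2 * (M * l) := fun x y A B hx hy hA hB hA' hB' => by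
    refine (abs_add_le _ _).trans ?_
    rw [abs_mul, abs_mul, abs_of_nonneg hA, abs_of_nonneg hB]
    nlinarith [abs_nonneg x, abs_nonneg y]
  constructor
  · rw [lagLam, abs_mul, abs_of_pos (inv_pos.2 hS), sub_eq_add_neg, ← neg_mul]
    gcongr
    exact key _ _ _ _ (Real.abs_cos_le_one _) (by rw [abs_neg]; exact Real.abs_cos_le_one _)
      h3 h4 h1 h2
  · rw [lagGam, abs_mul, abs_neg, abs_of_pos (by positivity)]
    have : (2 * Real.sin (2 * l))⁻¹ ≤ (Real.sin (2 * l))⁻¹ := inv_anti₀ hS (by linarith)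
    gcongr
    exact key _ _ _ _ (Real.abs_sin_le_one _) (Real.abs_sin_le_one _) h3 h4 h1 h2

/-- As long as `g` stays bounded, so do all the time derivatives. -/
theorem exists_bound {T M : ℝ} (hT : ∀ t ∈ I, t ≤ T)
    (hM : ∀ t ∈ I, 0 ≤ t → h (t, l) ≤ M) :
    ∃ C, ∀ t ∈ I, 0 ≤ t → ∀ a ∈ Icc 0 l,
      |lagLam l z h (t, a)| ≤ C ∧
      |lagKap z (t, a) * h (t, a) + lagSrc₁ l z h (t, a)| ≤ C ∧
      |lagCoef z (t, a) * m (t, a) + lagSrc₂ z (t, a)| ≤ C ∧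
      |lagKap z (t, a) * h₁ (t, a)| ≤ C ∧ |lagCoef z (t, a) * m₁ (t, a)| ≤ C ∧
      |lagKap z (t, a) * h₂ (t, a)| ≤ C ∧ |lagCoef z (t, a) * m₂ (t, a)| ≤ C := by
  set L := (Real.sin (2 * l))⁻¹ * (2 * (M * l)) with hL
  have hT0 : 0 ≤ T := hT 0 h0
  have hsub : ∀ t ∈ I, Icc 0 t ⊆ I := fun t ht => Icc_subset_of_mem hI h0 ht
  have hlm : l ∈ Icc 0 l := right_mem_Icc.2 hl.le
  have hL' : ∀ t ∈ I, 0 ≤ t → ∀ a ∈ Icc 0 l,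
      |lagLam l z h (t, a)| ≤ L ∧ |lagGam l z h (t, a)| ≤ L := fun t ht ht0 a ha =>
    H.lam_gam_le hI huI h0 hl hl2 ht ht0 (hM t ht ht0) ha
  have hL0 : 0 ≤ L := (abs_nonneg _).trans (hL' 0 h0 le_rfl l hlm).1
  have hh : ∀ t ∈ I, 0 ≤ t → ∀ a ∈ Icc 0 l, |h (t, a)| ≤ M := fun t ht ht0 a ha => by
    rw [abs_of_nonneg (H.h_nonneg hI huI h0 hl hl2 ht ht0 ha)]
    exact (H.h_monotone hI huI h0 hl hl2 ht ht0 ha hlm ha.2).trans (hM t ht ht0)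
  have hM0 : 0 ≤ M := (abs_nonneg _).trans (hh 0 h0 le_rfl l hlm)
  have growth : ∀ (y y' : ℝ → ℝ) (C : ℝ), y 0 = 0 → (∀ t ∈ I, HasDerivWithinAt y (y' t) I t) →
      (∀ t ∈ I, 0 ≤ t → |y' t| ≤ C) → ∀ t ∈ I, 0 ≤ t → |y t| ≤ C * T := by
    intro y y' C hy0 hy hy' t ht ht0
    have := (convex_Icc 0 t).norm_image_sub_le_of_norm_hasDerivWithin_le
      (f := y) (f' := y') (C := C)
      (fun s hs => (hy s (hsub t ht hs)).mono (hsub t ht))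
      (fun s hs => hy' s (hsub t ht hs) hs.1) (left_mem_Icc.2 ht0) (right_mem_Icc.2 ht0)
    rw [hy0, sub_zero, sub_zero, Real.norm_eq_abs, Real.norm_eq_abs, abs_of_nonneg ht0] at this
    have hC : 0 ≤ C := (abs_nonneg _).trans (hy' t ht ht0)
    exact this.trans (mul_le_mul_of_nonneg_left (hT t ht) hC)
  have hz : ∀ t ∈ I, 0 ≤ t → ∀ a ∈ Icc 0 l, |z (t, a)| ≤ L * T := fun t ht ht0 a ha =>
    growth (fun s => z (s, a)) _ L (H.initZ a ha) (fun s hs => H.derivZ s hs a ha)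
      (fun s hs hs0 => (hL' s hs hs0 a ha).1) t ht ht0
  set E := Real.exp (2 * (L * T)) with hE
  have hE1 : 1 ≤ E := Real.one_le_exp (by positivity)
  have hκ : ∀ t ∈ I, 0 ≤ t → ∀ a ∈ Icc 0 l, |lagKap z (t, a)| ≤ E := fun t ht ht0 a ha => by
    rw [abs_of_pos (kap_pos _)]
    exact Real.exp_le_exp.2 (by linarith [(abs_le.1 (hz t ht ht0 a ha)).2])
  have hez : ∀ t ∈ I, 0 ≤ t → ∀ a ∈ Icc 0 l, Real.exp (z (t, a)) ≤ E ∧ Real.exp (-z (t, a)) ≤ E :=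
    fun t ht ht0 a ha => by
      have := abs_le.1 (hz t ht ht0 a ha)
      have : 0 ≤ L * T := by positivity
      exact ⟨Real.exp_le_exp.2 (by linarith), Real.exp_le_exp.2 (by linarith)⟩
  have hc : ∀ t ∈ I, 0 ≤ t → ∀ a ∈ Icc 0 l, |lagCoef z (t, a)| ≤ 2 * (l * l * 1 * E) :=
    fun t ht ht0 a ha => by
      rw [lagCoef, abs_mul, abs_mul, abs_mul, abs_mul, abs_two, Real.abs_exp, abs_of_nonneg ha.1]
      have := (hez t ht ht0 a ha).2
      have := Real.abs_cos_le_one (lagPhi z (t, a))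
      have := ha.1
      have := ha.2
      gcongr
  have hs₂ : ∀ t ∈ I, 0 ≤ t → ∀ a ∈ Icc 0 l,
      |lagSrc₂ z (t, a)| ≤ 2 * (l * l * 1 * E) + 4 * (l * 1 * E) := fun t ht ht0 a ha => by
    rw [lagSrc₂]
    refine (abs_add_le _ _).trans ?_
    simp only [abs_mul, abs_two, Real.abs_exp, abs_of_nonneg ha.1]
    rw [abs_of_pos (show (0:ℝ) < 4 by norm_num)]
    have := hez t ht ht0 a ha
    have := Real.abs_cos_le_one (lagPhi z (t, a))
    have := Real.abs_sin_le_one (lagPhi z (t, a))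
    have := ha.1
    have := ha.2
    gcongr <;> tauto
  set D := E * M + 4 * (E * L) with hD
  have hm' : ∀ t ∈ I, 0 ≤ t → ∀ a ∈ Icc 0 l,
      |lagKap z (t, a) * h (t, a) + lagSrc₁ l z h (t, a)| ≤ D := fun t ht ht0 a ha => by
    refine (abs_add_le _ _).trans ?_
    simp only [lagSrc₁, abs_mul, abs_neg]
    rw [abs_of_pos (show (0:ℝ) < 4 by norm_num)]
    have := hκ t ht ht0 a ha
    have := hh t ht ht0 a ha
    have := (hL' t ht ht0 a ha).2
    rw [hD]
    gcongr
  have hm : ∀ t ∈ I, 0 ≤ t → ∀ a ∈ Icc 0 l, |m (t, a)| ≤ D * T := fun t ht ht0 a ha =>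
    growth (fun s => m (s, a)) _ D (H.initM a ha) (fun s hs => H.lin.deriv₁ s hs a ha)
      (fun s hs hs0 => hm' s hs hs0 a ha) t ht ht0
  set A := max E (2 * (l * l * 1 * E)) with hA
  have hA0 : 0 ≤ A := le_max_of_le_left (by linarith)
  have hlin : ∀ {x y : ℝ × ℝ → ℝ}, IsLinSol I (Icc 0 l) (lagKap z) (lagCoef z) 0 0 x y →
      (∀ a ∈ Icc 0 l, x (0, a) ^ 2 + y (0, a) ^ 2 = 1) → ∀ t ∈ I, 0 ≤ t → ∀ a ∈ Icc 0 l,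
      |lagKap z (t, a) * y (t, a)| ≤ A * Real.exp (2 * A * T) ∧
      |lagCoef z (t, a) * x (t, a)| ≤ A * Real.exp (2 * A * T) := by
    intro x y hxy hi t ht ht0 a ha
    have h1 := abs_le_of_linear ht0 (x := fun s => x (s, a)) (y := fun s => y (s, a)) (C := A)
      (fun s hs => ((hxy.deriv₁ s (hsub t ht hs) a ha).mono (hsub t ht)).congr_deriv (by
        rw [Pi.zero_apply, add_zero]))
      (fun s hs => ((hxy.deriv₂ s (hsub t ht hs) a ha).mono (hsub t ht)).congr_deriv (by
        rw [Pi.zero_apply, add_zero]))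
      (fun s hs => (hκ s (hsub t ht hs) hs.1 a ha).trans (le_max_left _ _))
      (fun s hs => (hc s (hsub t ht hs) hs.1 a ha).trans (le_max_right _ _)) (hi a ha)
    have h2 : Real.exp (2 * A * t) ≤ Real.exp (2 * A * T) :=
      Real.exp_le_exp.2 (mul_le_mul_of_nonneg_left (hT t ht) (by positivity))
    have h3 := (hκ t ht ht0 a ha).trans (le_max_left _ (2 * (l * l * 1 * E)))
    have h4 := (hc t ht ht0 a ha).trans (le_max_right E _)
    rw [abs_mul, abs_mul]
    exact ⟨mul_le_mul h3 (h1.2.trans h2) (abs_nonneg _) hA0,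
      mul_le_mul h4 (h1.1.trans h2) (abs_nonneg _) hA0⟩
  set C₃ := 2 * (l * l * 1 * E) * (D * T) + (2 * (l * l * 1 * E) + 4 * (l * 1 * E))
  refine ⟨max L (max D (max C₃ (A * Real.exp (2 * A * T)))), fun t ht ht0 a ha => ?_⟩
  have h₁' := hlin H.lin₁ (fun a ha => by simp [H.initM₁ a ha, H.initH₁ a ha]) t ht ht0 a ha
  have h₂' := hlin H.lin₂ (fun a ha => by simp [H.initM₂ a ha, H.initH₂ a ha]) t ht ht0 a ha
  have h₃' : |lagCoef z (t, a) * m (t, a) + lagSrc₂ z (t, a)| ≤ C₃ := by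
    refine (abs_add_le _ _).trans (add_le_add ?_ (hs₂ t ht ht0 a ha))
    rw [abs_mul]
    exact mul_le_mul (hc t ht ht0 a ha) (hm t ht ht0 a ha) (abs_nonneg _) (by positivity)
  simp only [le_max_iff]
  exact ⟨.inl (hL' t ht ht0 a ha).1, .inr (.inl (hm' t ht ht0 a ha)), .inr (.inr (.inl h₃')),
    .inr (.inr (.inr h₁'.1)), .inr (.inr (.inr h₁'.2)), .inr (.inr (.inr h₂'.1)),
    .inr (.inr (.inr h₂'.2))⟩

end IsLag

theorem lipschitzOnWith_of_pointwise {l : ℝ} (hl : 0 ≤ l) {n : ℕ}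
    {u : ℝ → Fin n → C(Icc (0:ℝ) l, ℝ)} {T C : ℝ} (hC : 0 ≤ C)
    (hu : ∀ i, ∀ a ∈ Icc 0 l, ∀ t ∈ Ico 0 T, ∃ y', |y'| ≤ C ∧
      HasDerivWithinAt (fun s => uncurryExt hl (fun s => u s i) (s, a)) y' (Ico 0 T) t) :
    LipschitzOnWith (Real.toNNReal C) u (Ico 0 T) := by
  refine LipschitzOnWith.of_dist_le_mul fun t ht s hs => ?_
  rw [Real.coe_toNNReal _ hC, dist_pi_le_iff (by positivity)]
  refine fun i => (ContinuousMap.dist_le (by positivity)).2 fun a => ?_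
  choose! y' hb hd using hu i a a.2
  have := (convex_Ico 0 T).norm_image_sub_le_of_norm_hasDerivWithin_le (C := C) hd
    (fun x hx => hb x hx) hs ht
  simp only [uncurryExt, icExt_of_mem hl _ a.2, Subtype.coe_eta] at this
  rwa [← dist_eq_norm, ← dist_eq_norm] at this

/-- The Lagrangian system has a solution that blows up in finite time at the right endpoint. -/
theorem exists_isLag_blowup {l : ℝ} (hl : 0 < l) (hl2 : l < Real.pi / 2) :
    ∃ ε > 0, ∃ T > 0, ∃ z m h m₁ h₁ m₂ h₂ : ℝ × ℝ → ℝ,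
      IsLag l (Ioo (-ε) T) z m h m₁ h₁ m₂ h₂ ∧
      Tendsto (fun t => h (t, l)) (𝓝[<] T) atTop := by
  have hconv : ∀ ε T : ℝ, Convex ℝ (Ioo (-ε) T) := fun ε T => convex_Ioo _ _
  obtain ⟨ε, hε, T, hT, u, hu, hmax⟩ := exists_maximal_curve (contDiff_lagField hl.le) lagInit
    (B := Real.pi / √(2 * l ^ 2 * Real.cos l)) (fun ε hε T u hu => by
      rcases le_or_gt T 0 with hT | hT
      · exact hT.trans (by positivity)
      refine le_of_forall_lt_imp_le_of_dense fun t ht => ?_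
      rcases le_or_gt t 0 with ht0 | ht0
      · exact ht0.trans (by positivity)
      exact (IsCurve.isLag hl.le hu).time_le (hconv ε T) isOpen_Ioo.uniqueDiffOn
        ⟨by linarith, hT⟩ hl hl2 ⟨by linarith, ht⟩ ht0.le)
  have H := IsCurve.isLag hl.le hu
  have h0 : (0:ℝ) ∈ Ioo (-ε) T := ⟨by linarith, hT⟩
  have huI : UniqueDiffOn ℝ (Ioo (-ε) T) := isOpen_Ioo.uniqueDiffOn
  have hsub : ∀ t ∈ Ico 0 T, t ∈ Ioo (-ε) T := fun t ht => ⟨by linarith [ht.1], ht.2⟩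
  have hlm : l ∈ Icc 0 l := right_mem_Icc.2 hl.le
  refine ⟨ε, hε, T, hT, _, _, _, _, _, _, _, H, tendsto_atTop.2 fun M => ?_⟩
  obtain ⟨s, hs, hMs⟩ : ∃ s ∈ Ico 0 T, M < uncurryExt hl.le (fun t => u t 2) (s, l) := by
    by_contra! hM
    obtain ⟨C, hC⟩ := H.exists_bound (hconv ε T) huI h0 hl hl2 (T := T) (M := M)
      (fun t ht => ht.2.le) (fun t ht ht0 => hM t ⟨ht0, ht.2⟩)
    have hC0 : 0 ≤ C := (abs_nonneg _).trans (hC 0 h0 le_rfl l hlm).1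
    have hL := lipschitzOnWith_of_pointwise hl.le (u := u) (T := T) hC0 (by
      intro i a ha t ht
      have hI := hsub t ht
      obtain ⟨b0, b1, b2, b3, b4, b5, b6⟩ := hC t hI ht.1 a ha
      have hm : Ico 0 T ⊆ Ioo (-ε) T := fun t ht => hsub t ht
      fin_cases i
      · exact ⟨_, b0, (H.derivZ t hI a ha).mono hm⟩
      · exact ⟨_, b1, (H.lin.deriv₁ t hI a ha).mono hm⟩
      · exact ⟨_, b2, (H.lin.deriv₂ t hI a ha).mono hm⟩
      · exact ⟨_, b3, ((H.lin₁.deriv₁ t hI a ha).mono hm).congr_deriv (add_zero _)⟩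
      · exact ⟨_, b4, ((H.lin₁.deriv₂ t hI a ha).mono hm).congr_deriv (add_zero _)⟩
      · exact ⟨_, b5, ((H.lin₂.deriv₁ t hI a ha).mono hm).congr_deriv (add_zero _)⟩
      · exact ⟨_, b6, ((H.lin₂.deriv₂ t hI a ha).mono hm).congr_deriv (add_zero _)⟩)
    have hc : Cauchy (map u (𝓝[<] T)) := by
      have h1 : 𝓝[<] T ≤ 𝓟 (Ico 0 T) := le_principal_iff.2 (Ico_mem_nhdsLT hT)
      refine (cauchy_nhds.mono nhdsWithin_le_nhds : Cauchy (𝓝[<] T)).map_of_le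
        hL.uniformContinuousOn h1
    obtain ⟨v, hv⟩ := cauchy_map_iff_exists_tendsto.1 hc
    exact hmax v hv
  filter_upwards [Ico_mem_nhdsLT (hs.2 : s < T)] with t ht
  have ht' : t ∈ Ico 0 T := ⟨hs.1.trans ht.1, ht.2⟩
  exact hMs.le.trans (H.h_fst_monotone (hconv ε T) huI h0 hl hl2 (hsub t ht') hlm
    ⟨hs.1, ht.1⟩ ⟨ht'.1, le_rfl⟩ ht.1)

section InverseFlow

/-- `φ(t,·)` is a flow of `[0,l]` with velocity `v ∘ φ⁻¹` and Jacobian `κ`, and `ψ(t,·)` is its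
inverse. -/
structure IsFlowInverse (I : Set ℝ) (l : ℝ) (φ v κ ψ : ℝ × ℝ → ℝ) : Prop where
  contV : ContinuousOn v (I ×ˢ Icc 0 l)
  contK : ContinuousOn κ (I ×ˢ Icc 0 l)
  pos : ∀ p ∈ I ×ˢ Icc 0 l, 0 < κ p
  deriv_fst : ∀ t ∈ I, ∀ a ∈ Icc 0 l, HasDerivWithinAt (fun s => φ (s, a)) (v (t, a)) I t
  deriv_snd : ∀ t ∈ I, ∀ a ∈ Icc 0 l, HasDerivWithinAt (fun b => φ (t, b)) (κ (t, a)) (Icc 0 l) a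
  maps : ∀ t ∈ I, ∀ a ∈ Icc 0 l, φ (t, a) ∈ Icc 0 l
  inv_maps : ∀ t ∈ I, ∀ θ ∈ Icc 0 l, ψ (t, θ) ∈ Icc 0 l
  right_inv : ∀ t ∈ I, ∀ θ ∈ Icc 0 l, φ (t, ψ (t, θ)) = θ

variable {I : Set ℝ} {l : ℝ} {φ v κ ψ : ℝ × ℝ → ℝ}

theorem exists_isFlowInverse (hl : 0 ≤ l)
    (contV : ContinuousOn v (I ×ˢ Icc 0 l)) (contK : ContinuousOn κ (I ×ˢ Icc 0 l))
    (pos : ∀ p ∈ I ×ˢ Icc 0 l, 0 < κ p)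
    (deriv_fst : ∀ t ∈ I, ∀ a ∈ Icc 0 l, HasDerivWithinAt (fun s => φ (s, a)) (v (t, a)) I t)
    (deriv_snd : ∀ t ∈ I, ∀ a ∈ Icc 0 l,
      HasDerivWithinAt (fun b => φ (t, b)) (κ (t, a)) (Icc 0 l) a)
    (maps : ∀ t ∈ I, ∀ a ∈ Icc 0 l, φ (t, a) ∈ Icc 0 l)
    (left : ∀ t ∈ I, φ (t, 0) = 0) (right : ∀ t ∈ I, φ (t, l) = l) :
    ∃ ψ, IsFlowInverse I l φ v κ ψ := by
  have : ∀ p : ℝ × ℝ, ∃ b, p ∈ I ×ˢ Icc 0 l → b ∈ Icc 0 l ∧ φ (p.1, b) = p.2 := fun p => by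
    by_cases hp : p ∈ I ×ˢ Icc 0 l
    · have hc : ContinuousOn (fun b => φ (p.1, b)) (Icc 0 l) :=
        fun b hb => (deriv_snd p.1 hp.1 b hb).continuousWithinAt
      have := intermediate_value_Icc hl hc
      rw [left _ hp.1, right _ hp.1] at this
      obtain ⟨b, hb, h⟩ := this hp.2
      exact ⟨b, fun _ => ⟨hb, h⟩⟩
    · exact ⟨0, fun h => absurd h hp⟩
  choose ψ hψ using this
  exact ⟨ψ, contV, contK, pos, deriv_fst, deriv_snd, maps, fun t ht θ hθ => (hψ (t, θ) ⟨ht, hθ⟩).1,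
    fun t ht θ hθ => (hψ (t, θ) ⟨ht, hθ⟩).2⟩

namespace IsFlowInverse

variable (H : IsFlowInverse I l φ v κ ψ)

include H

theorem strictMonoOn {t : ℝ} (ht : t ∈ I) : StrictMonoOn (fun b => φ (t, b)) (Icc 0 l) := by
  refine strictMonoOn_of_hasDerivWithinAt_pos (f' := fun b => κ (t, b)) (convex_Icc 0 l)
    (fun b hb => (H.deriv_snd t ht b hb).continuousWithinAt) (fun b hb => ?_)
    (fun b hb => H.pos _ ⟨ht, interior_subset hb⟩)
  exact (H.deriv_snd t ht b (interior_subset hb)).mono interior_subset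

theorem left_inv {t a : ℝ} (ht : t ∈ I) (ha : a ∈ Icc 0 l) : ψ (t, φ (t, a)) = a :=
  (H.strictMonoOn ht).injOn (H.inv_maps t ht _ (H.maps t ht a ha)) ha
    (H.right_inv t ht _ (H.maps t ht a ha))

theorem continuousOn_inv : ContinuousOn ψ (I ×ˢ Icc 0 l) := by
  rintro ⟨t, θ⟩ ⟨ht, hθ⟩
  simp only at ht hθ
  have key : ∀ a ∈ Icc 0 l, ContinuousWithinAt (fun p : ℝ × ℝ => φ (p.1, a) - p.2)
      (I ×ˢ Icc 0 l) (t, θ) := fun a ha => by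
    have : ContinuousWithinAt (fun s => φ (s, a)) I t :=
      (H.deriv_fst t ht a ha).continuousWithinAt
    exact (this.comp (x := (t, θ)) (f := Prod.fst) continuousWithinAt_fst fun p hp => hp.1).sub
      continuousWithinAt_snd
  have hψ := H.inv_maps t ht θ hθ
  have hr := H.right_inv t ht θ hθ
  refine tendsto_order.2 ⟨fun x hx => ?_, fun x hx => ?_⟩
  · rcases lt_or_ge x 0 with hx0 | hx0
    · filter_upwards [self_mem_nhdsWithin] with p hp
      exact hx0.trans_le (H.inv_maps p.1 hp.1 p.2 hp.2).1
    have hxm : x ∈ Icc 0 l := ⟨hx0, hx.le.trans hψ.2⟩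
    have h1 : φ (t, x) - θ < 0 := by
      have := H.strictMonoOn ht hxm hψ hx
      simp only [hr] at this
      linarith
    filter_upwards [self_mem_nhdsWithin, (key x hxm).eventually_lt_const h1] with p hp hlt
    refine ((H.strictMonoOn hp.1).lt_iff_lt hxm (H.inv_maps p.1 hp.1 p.2 hp.2)).1 ?_
    simp only [H.right_inv p.1 hp.1 p.2 hp.2]
    linarith
  · rcases lt_or_ge l x with hx0 | hx0
    · filter_upwards [self_mem_nhdsWithin] with p hp
      exact (H.inv_maps p.1 hp.1 p.2 hp.2).2.trans_lt hx0
    have hxm : x ∈ Icc 0 l := ⟨hψ.1.trans hx.le, hx0⟩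
    have h1 : 0 < φ (t, x) - θ := by
      have := H.strictMonoOn ht hψ hxm hx
      simp only [hr] at this
      linarith
    filter_upwards [self_mem_nhdsWithin, (key x hxm).eventually_const_lt h1] with p hp hlt
    refine ((H.strictMonoOn hp.1).lt_iff_lt (H.inv_maps p.1 hp.1 p.2 hp.2) hxm).1 ?_
    simp only [H.right_inv p.1 hp.1 p.2 hp.2]
    linarith

theorem mapsTo : MapsTo (fun p : ℝ × ℝ => (p.1, ψ p)) (I ×ˢ Icc 0 l) (I ×ˢ Icc 0 l) :=
  fun p hp => ⟨hp.1, H.inv_maps p.1 hp.1 p.2 hp.2⟩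

theorem hasFDerivWithinAt_inv (hI : Convex ℝ I) {p : ℝ × ℝ} (hp : p ∈ I ×ˢ Icc 0 l) :
    ∃ L : ℝ × ℝ →L[ℝ] ℝ × ℝ, HasFDerivWithinAt (fun p => (p.1, ψ p)) L (I ×ˢ Icc 0 l) p ∧
      L (1, 0) = (1, -v (p.1, ψ p) / κ (p.1, ψ p)) ∧ L (0, 1) = (0, 1 / κ (p.1, ψ p)) := by
  have hk := (H.pos _ (H.mapsTo hp)).ne'
  set k := κ (p.1, ψ p)
  set w := v (p.1, ψ p)
  set F : ℝ × ℝ →L[ℝ] ℝ × ℝ := (ContinuousLinearMap.fst ℝ ℝ ℝ).prod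
    (w • ContinuousLinearMap.fst ℝ ℝ ℝ + k • ContinuousLinearMap.snd ℝ ℝ ℝ) with hF
  set J : ℝ × ℝ →L[ℝ] ℝ × ℝ := (ContinuousLinearMap.fst ℝ ℝ ℝ).prod
    ((-w / k) • ContinuousLinearMap.fst ℝ ℝ ℝ + (1 / k) • ContinuousLinearMap.snd ℝ ℝ ℝ) with hJ
  let e : (ℝ × ℝ) ≃L[ℝ] (ℝ × ℝ) := ContinuousLinearEquiv.equivOfInverse F J
    (fun x => by ext <;> simp [F, J]; field_simp; ring)
    (fun x => by ext <;> simp [F, J]; field_simp; ring)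
  have hd : HasFDerivWithinAt (fun q : ℝ × ℝ => (q.1, φ q)) (e : ℝ × ℝ →L[ℝ] ℝ × ℝ)
      (I ×ˢ Icc 0 l) (p.1, ψ p) :=
    hasFDerivWithinAt_fst.prodMk (hasFDerivWithinAt_of_partials hI (convex_Icc 0 l) H.contV H.contK
      H.deriv_fst H.deriv_snd (H.mapsTo hp))
  refine ⟨J, hd.of_local_left_inverse (g := fun p => (p.1, ψ p)) ?_ hp ?_, ?_, ?_⟩
  · exact ((continuousOn_fst.prodMk H.continuousOn_inv) p hp).tendsto_nhdsWithin H.mapsTo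
  · filter_upwards [self_mem_nhdsWithin] with q hq
    exact Prod.ext rfl (H.right_inv q.1 hq.1 q.2 hq.2)
  · simp [J]
  · simp [J]

/-- Derivatives of a function transported along the inverse flow. -/
theorem hasDerivWithinAt_comp (hI : Convex ℝ I) {f ft fa : ℝ × ℝ → ℝ}
    (hft : ContinuousOn ft (I ×ˢ Icc 0 l)) (hfa : ContinuousOn fa (I ×ˢ Icc 0 l))
    (dt : ∀ t ∈ I, ∀ a ∈ Icc 0 l, HasDerivWithinAt (fun s => f (s, a)) (ft (t, a)) I t)
    (da : ∀ t ∈ I, ∀ a ∈ Icc 0 l, HasDerivWithinAt (fun b => f (t, b)) (fa (t, a)) (Icc 0 l) a)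
    {t θ : ℝ} (ht : t ∈ I) (hθ : θ ∈ Icc 0 l) :
    HasDerivWithinAt (fun s => f (s, ψ (s, θ))) (ft (t, ψ (t, θ))
      + fa (t, ψ (t, θ)) * (-v (t, ψ (t, θ)) / κ (t, ψ (t, θ)))) I t ∧
    HasDerivWithinAt (fun y => f (t, ψ (t, y))) (fa (t, ψ (t, θ)) / κ (t, ψ (t, θ)))
      (Icc 0 l) θ := by
  have hp : (t, θ) ∈ I ×ˢ Icc 0 l := ⟨ht, hθ⟩
  obtain ⟨L, hL, hL1, hL2⟩ := H.hasFDerivWithinAt_inv hI hp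
  have hf := (hasFDerivWithinAt_of_partials hI (convex_Icc 0 l) hft hfa dt da
    (H.mapsTo hp)).comp (t, θ) hL H.mapsTo
  constructor
  · have h2 : HasDerivWithinAt (fun s : ℝ => (s, θ)) (1, 0) I t :=
      (hasDerivWithinAt_id t I).prodMk (hasDerivWithinAt_const t I θ)
    refine (hf.comp_hasDerivWithinAt (t := I ×ˢ Icc 0 l) t h2 (fun s hs => ⟨hs, hθ⟩)).congr_deriv ?_
    simp [hL1]
  · have h2 : HasDerivWithinAt (fun s : ℝ => (t, s)) (0, 1) (Icc 0 l) θ :=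
      (hasDerivWithinAt_const θ _ t).prodMk (hasDerivWithinAt_id θ _)
    refine (hf.comp_hasDerivWithinAt (t := I ×ˢ Icc 0 l) θ h2 (fun s hs => ⟨ht, hs⟩)).congr_deriv ?_
    simp [hL2, div_eq_mul_inv]

theorem contDiffOn_inv (hI : Convex ℝ I) (huI : UniqueDiffOn ℝ I) (hl : 0 < l)
    (hv : ∀ n : ℕ, ContDiffOn ℝ n v (I ×ˢ Icc 0 l))
    (hκ : ∀ n : ℕ, ContDiffOn ℝ n κ (I ×ˢ Icc 0 l)) (n : ℕ) :
    ContDiffOn ℝ n ψ (I ×ˢ Icc 0 l) := by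
  induction n with
  | zero => exact contDiffOn_zero.2 H.continuousOn_inv
  | succ n ih =>
    have hpair : ContDiffOn ℝ n (fun p : ℝ × ℝ => (p.1, ψ p)) (I ×ˢ Icc 0 l) :=
      contDiffOn_fst.prodMk ih
    have hv' := (hv n).comp hpair H.mapsTo
    have hκ' := (hκ n).comp hpair H.mapsTo
    have hne : ∀ p ∈ I ×ˢ Icc 0 l, (κ ∘ fun p : ℝ × ℝ => (p.1, ψ p)) p ≠ 0 :=
      fun p hp => (H.pos _ (H.mapsTo hp)).ne'
    have hd := fun t (ht : t ∈ I) θ (hθ : θ ∈ Icc 0 l) =>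
      H.hasDerivWithinAt_comp hI (f := Prod.snd) (ft := 0) (fa := 1) continuousOn_const
        continuousOn_const (fun t _ a _ => hasDerivWithinAt_const _ _ _)
        (fun t _ a _ => hasDerivWithinAt_id _ _) ht hθ
    refine contDiffOn_succ_of_partials hI (convex_Icc 0 l) huI (uniqueDiffOn_Icc hl)
      (hv'.neg.div hκ' hne) ((contDiffOn_const (c := 1)).div hκ' hne)
      (fun t ht θ hθ => ((hd t ht θ hθ).1).congr_deriv ?_)
      (fun t ht θ hθ => (hd t ht θ hθ).2)
    simp

end IsFlowInverse

end InverseFlow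

theorem IsFlowInverse.hasDerivWithinAt_comp_of_contDiffOn {I : Set ℝ} {l : ℝ}
    {φ v κ ψ : ℝ × ℝ → ℝ} (H : IsFlowInverse I l φ v κ ψ) (hI : Convex ℝ I)
    (huI : UniqueDiffOn ℝ I) (hl : 0 < l) {f : ℝ × ℝ → ℝ}
    (hf : ContDiffOn ℝ (0 + 1 : ℕ) f (I ×ˢ Icc 0 l)) {t θ x y : ℝ} (ht : t ∈ I) (hθ : θ ∈ Icc 0 l)
    (dt : HasDerivWithinAt (fun s => f (s, ψ (t, θ))) x I t)
    (da : HasDerivWithinAt (fun b => f (t, b)) y (Icc 0 l) (ψ (t, θ))) :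
    HasDerivWithinAt (fun s => f (s, ψ (s, θ))) (x + y * (-v (t, ψ (t, θ)) / κ (t, ψ (t, θ)))) I t ∧
    HasDerivWithinAt (fun b => f (t, ψ (t, b))) (y / κ (t, ψ (t, θ))) (Icc 0 l) θ := by
  have huK := uniqueDiffOn_Icc hl
  have hψ := H.inv_maps t ht θ hθ
  have h1 := fun t (ht : t ∈ I) a (ha : a ∈ Icc 0 l) => hf.hasDerivWithinAt_fst (by simp) ht ha
  have h2 := fun t (ht : t ∈ I) a (ha : a ∈ Icc 0 l) => hf.hasDerivWithinAt_snd (by simp) ht ha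
  have := H.hasDerivWithinAt_comp hI (hf.fderivWithin_apply_pair huI huK _).continuousOn
    (hf.fderivWithin_apply_pair huI huK _).continuousOn h1 h2 ht hθ
  rwa [(huI t ht).eq_deriv _ (h1 t ht _ hψ) dt, (huK _ hψ).eq_deriv _ (h2 t ht _ hψ) da] at this

namespace IsLag

variable {l ε T : ℝ} {z m h m₁ h₁ m₂ h₂ : ℝ × ℝ → ℝ}

/-- A Lagrangian solution yields an Eulerian solution whose vorticity attains its maximum at the
right endpoint. -/
theorem exists_isSol1D (H : IsLag l (Ioo (-ε) T) z m h m₁ h₁ m₂ h₂) (hε : 0 < ε) (hT : 0 < T)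
    (hl : 0 < l) (hl2 : l < Real.pi / 2) :
    ∃ g P G : ℝ → ℝ → ℝ, IsSol1D l T g P G ∧ (∀ θ ∈ Icc 0 l, g 0 θ = 0 ∧ P 0 θ = θ ^ 2) ∧
      ∀ t ∈ Ico 0 T, sSup {y | ∃ θ ∈ Icc (0:ℝ) l, y = |g t θ|} = h (t, l) := by
  have hI : Convex ℝ (Ioo (-ε) T) := convex_Ioo _ _
  have huI : UniqueDiffOn ℝ (Ioo (-ε) T) := isOpen_Ioo.uniqueDiffOn
  have huK := uniqueDiffOn_Icc hl
  have huJ : UniqueDiffOn ℝ (Ico 0 T) := uniqueDiffOn_Ico 0 T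
  have h0 : (0:ℝ) ∈ Ioo (-ε) T := ⟨by linarith, hT⟩
  have hS := (sin_two_mul_pos hl hl2).ne'
  have hsub : Ico 0 T ⊆ Ioo (-ε) T := fun t ht => ⟨by linarith [ht.1], ht.2⟩
  have hlm : l ∈ Icc 0 l := right_mem_Icc.2 hl.le
  have cz : ∀ n : ℕ, ContDiffOn ℝ n z (Ioo (-ε) T ×ˢ Icc 0 l) := fun n =>
    (H.contDiffOn_all hI huI h0 hl hl2 n).1
  have ch : ∀ n : ℕ, ContDiffOn ℝ n h (Ioo (-ε) T ×ˢ Icc 0 l) := fun n =>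
    (H.contDiffOn_all hI huI h0 hl hl2 n).2.1.2
  have cΓ := fun n => contDiffOn_lagGam hI huI hl (cz n) (ch n)
  have cΛ := fun n => contDiffOn_lagLam hI huI hl (cz n) (ch n)
  have cκ : ∀ n : ℕ, ContDiffOn ℝ n (lagKap z) (Ioo (-ε) T ×ˢ Icc 0 l) := fun n => by
    have := cz n
    unfold lagKap
    fun_prop
  obtain ⟨ψ, F⟩ := exists_isFlowInverse (φ := lagPhi z) (v := fun p => 2 * lagGam l z h p)
    (κ := lagKap z) hl.le (continuousOn_const.mul (H.contGam hI huI hl)) H.contKap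
    (fun p _ => kap_pos p) (fun t ht a ha => H.hasDerivWithinAt_phi_fst hI huI hl hl2 ht ha)
    (fun t ht a ha => H.hasDerivWithinAt_phi_snd hl ht ha)
    (fun t ht a ha => H.phi_mem hI huI h0 hl hl2 ht ha) (fun t _ => lagPhi_zero _)
    (fun t ht => H.phi_right hI huI h0 hl hl2 ht)
  have cψ := F.contDiffOn_inv hI huI hl (fun n => contDiffOn_const.mul (cΓ n)) cκ
  have comp : ∀ {f : ℝ × ℝ → ℝ}, (∀ n : ℕ, ContDiffOn ℝ n f (Ioo (-ε) T ×ˢ Icc 0 l)) →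
      ∀ n : ℕ, ContDiffOn ℝ n (fun q : ℝ × ℝ => f (q.1, ψ (q.1, q.2))) (Ico 0 T ×ˢ Icc 0 l) :=
    fun hf n => ((hf n).comp (contDiffOn_fst.prodMk (cψ n)) F.mapsTo).mono
      (prod_mono hsub Subset.rfl)
  have cp : ∀ n : ℕ, ContDiffOn ℝ n (fun p => p.2 ^ 2 * Real.exp (z p))
      (Ioo (-ε) T ×ˢ Icc 0 l) := fun n => by
    have := cz n
    fun_prop
  have dp_snd : ∀ t ∈ Ioo (-ε) T, ∀ a ∈ Icc 0 l, HasDerivWithinAt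
      (fun b => b ^ 2 * Real.exp (z (t, b)))
      (2 * a * Real.exp (z (t, a)) + a ^ 2 * (Real.exp (z (t, a)) * m (t, a))) (Icc 0 l) a :=
    fun t ht a ha => by
      exact (((hasDerivWithinAt_id a (Icc 0 l)).pow 2).mul
        (H.hasDerivWithinAt_z_snd hI huI h0 hl hl2 ht ha).exp).congr_deriv (by simp)
  have dp_fst : ∀ t ∈ Ioo (-ε) T, ∀ a ∈ Icc 0 l, HasDerivWithinAt
      (fun s => a ^ 2 * Real.exp (z (s, a)))
      (a ^ 2 * (Real.exp (z (t, a)) * lagLam l z h (t, a))) (Ioo (-ε) T) t :=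
    fun t ht a ha => (H.derivZ t ht a ha).exp.const_mul _
  have κne := fun p => (kap_pos (z := z) p).ne'
  have dG : ∀ t ∈ Ioo (-ε) T, ∀ θ ∈ Icc 0 l, HasDerivWithinAt (fun θ => lagGam l z h (t, ψ (t, θ)))
      (lagLam l z h (t, ψ (t, θ))) (Icc 0 l) θ := fun t ht θ hθ => by
    have hψ := F.inv_maps t ht θ hθ
    refine (F.hasDerivWithinAt_comp_of_contDiffOn hI huI hl (cΓ _) ht hθ
      ((cΓ (0 + 1)).hasDerivWithinAt_fst (by simp) ht hψ)
      (hasDerivWithinAt_lagGam_snd hI huI hl H.contZ H.contH hS ht hψ)).2.congr_deriv ?_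
    rw [mul_div_cancel_left₀ _ (κne _)]
  have dΛ : ∀ t ∈ Ioo (-ε) T, ∀ θ ∈ Icc 0 l, HasDerivWithinAt (fun θ => lagLam l z h (t, ψ (t, θ)))
      (h (t, ψ (t, θ)) - 4 * lagGam l z h (t, ψ (t, θ))) (Icc 0 l) θ := fun t ht θ hθ => by
    have hψ := F.inv_maps t ht θ hθ
    refine (F.hasDerivWithinAt_comp_of_contDiffOn hI huI hl (cΛ _) ht hθ
      ((cΛ (0 + 1)).hasDerivWithinAt_fst (by simp) ht hψ)
      (hasDerivWithinAt_lagLam_snd hI huI hl H.contZ H.contH hS ht hψ)).2.congr_deriv ?_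
    rw [mul_div_cancel_left₀ _ (κne _)]
  have dh := fun t (ht : t ∈ Ioo (-ε) T) θ (hθ : θ ∈ Icc 0 l) =>
    F.hasDerivWithinAt_comp_of_contDiffOn hI huI hl (ch _) ht hθ
      (H.lin.deriv₂ t ht _ (F.inv_maps t ht θ hθ))
      (H.hasDerivWithinAt_mh_snd hI huI h0 hl hl2 ht (F.inv_maps t ht θ hθ)).2
  have dp := fun t (ht : t ∈ Ioo (-ε) T) θ (hθ : θ ∈ Icc 0 l) =>
    F.hasDerivWithinAt_comp_of_contDiffOn hI huI hl (cp _) ht hθ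
      (dp_fst t ht _ (F.inv_maps t ht θ hθ)) (dp_snd t ht _ (F.inv_maps t ht θ hθ))
  have ψ_zero : ∀ t ∈ Ioo (-ε) T, ψ (t, 0) = 0 := fun t ht => by
    simpa using F.left_inv ht (left_mem_Icc.2 hl.le)
  have ψ_right : ∀ t ∈ Ioo (-ε) T, ψ (t, l) = l := fun t ht => by
    simpa only [H.phi_right hI huI h0 hl hl2 ht] using F.left_inv ht hlm
  have ψ_init : ∀ θ ∈ Icc 0 l, ψ (0, θ) = θ := fun θ hθ => by
    simpa only [H.phi_init hl hθ] using F.left_inv h0 hθ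
  refine ⟨fun t θ => h (t, ψ (t, θ)), fun t θ => ψ (t, θ) ^ 2 * Real.exp (z (t, ψ (t, θ))),
    fun t θ => lagGam l z h (t, ψ (t, θ)), ⟨comp ch, comp cp, comp cΓ, fun t ht => ⟨?_, ?_, ?_⟩,
    fun t ht θ hθ => ?_, fun t ht θ hθ => ?_⟩, fun θ hθ => ⟨?_, ?_⟩, fun t ht => ?_⟩
  · simp [ψ_zero t (hsub ht)]
  · simp only [ψ_right t (hsub ht), H.gam_right hI huI h0 hl hl2 (hsub ht)]
  · intro θ hθ
    rw [((dΛ t (hsub ht) θ hθ).congr_of_mem (fun y hy =>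
      (dG t (hsub ht) y hy).derivWithin (huK y hy)) hθ).derivWithin (huK θ hθ)]
    ring
  · have hr := F.right_inv t (hsub ht) θ hθ
    rw [((dh t (hsub ht) θ hθ).1.mono hsub).derivWithin (huJ t ht),
      (dh t (hsub ht) θ hθ).2.derivWithin (huK θ hθ),
      (dp t (hsub ht) θ hθ).2.derivWithin (huK θ hθ), lagCoef, lagSrc₂, hr]
    simp only [lagKap, two_mul (z _), Real.exp_add, Real.exp_neg]
    field_simp
    ring
  · rw [((dp t (hsub ht) θ hθ).1.mono hsub).derivWithin (huJ t ht),
      (dp t (hsub ht) θ hθ).2.derivWithin (huK θ hθ),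
      (dG t (hsub ht) θ hθ).derivWithin (huK θ hθ)]
    ring
  · exact H.initH _ (F.inv_maps 0 h0 θ hθ)
  · simp only [ψ_init θ hθ, H.initZ θ hθ, Real.exp_zero, mul_one]
  · have hI' := hsub ht
    have hmono := H.h_monotone hI huI h0 hl hl2 hI' ht.1
    have habs : ∀ θ ∈ Icc 0 l, |h (t, ψ (t, θ))| = h (t, ψ (t, θ)) := fun θ hθ =>
      abs_of_nonneg (H.h_nonneg hI huI h0 hl hl2 hI' ht.1 (F.inv_maps t hI' θ hθ))
    refine (IsGreatest.csSup_eq ⟨⟨l, hlm, ?_⟩, ?_⟩)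
    · rw [habs l hlm, ψ_right t hI']
    · rintro y ⟨θ, hθ, rfl⟩
      rw [habs θ hθ]
      exact hmono (F.inv_maps t hI' θ hθ) hlm (F.inv_maps t hI' θ hθ).2

end IsLag

/-- Gronwall's lemma for the supremum of a family of functions of time. -/
theorem eq_zero_of_sup_growth {ι : Type*} {τ C M : ℝ} (hC : 0 ≤ C) {F F' : ι → ℝ → ℝ}
    (hF : ∀ i, ∀ t ∈ Icc 0 τ, HasDerivWithinAt (F i) (F' i t) (Icc 0 τ) t)
    (hF' : ∀ t ∈ Icc 0 τ, ∀ N, (∀ i, |F i t| ≤ N) → ∀ i, |F' i t| ≤ C * N)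
    (hF0 : ∀ i, F i 0 = 0) (hM : ∀ i, ∀ t ∈ Icc 0 τ, |F i t| ≤ M)
    (i : ι) {t : ℝ} (ht : t ∈ Icc 0 τ) : F i t = 0 := by
  have hM0 : 0 ≤ M := (abs_nonneg _).trans (hM i t ht)
  have h0 : (0:ℝ) ∈ Icc 0 τ := left_mem_Icc.2 (ht.1.trans ht.2)
  have key : ∀ n : ℕ, ∀ i, ∀ t ∈ Icc 0 τ, |F i t| ≤ M / 2 ^ n * Real.exp (2 * C * t) := by
    intro n
    induction n with
    | zero =>
      intro i t ht
      refine (hM i t ht).trans ?_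
      rw [pow_zero, div_one]
      have := ht.1
      exact le_mul_of_one_le_right hM0 (Real.one_le_exp (by positivity))
    | succ n ih =>
      intro i t ht
      have hB : ∀ s ∈ Icc 0 τ, HasDerivWithinAt (fun s => M / 2 ^ (n + 1) * Real.exp (2 * C * s))
          (C * (M / 2 ^ n * Real.exp (2 * C * s))) (Icc 0 τ) s := fun s _ => by
        have := (((hasDerivWithinAt_id s (Icc 0 τ)).const_mul (2 * C)).exp).const_mul
          (M / 2 ^ (n + 1))
        refine this.congr_deriv ?_
        simp only [id, pow_succ]
        ring
      have hb := fun s (hs : s ∈ Icc 0 τ) => abs_le.1 (hF' s hs _ (fun j => ih j s hs) i)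
      have m1 := monotoneOn_of_hasDerivWithinAt_self (convex_Icc 0 τ)
        (fun s hs => (hB s hs).sub (hF i s hs)) (fun s hs => by linarith [(hb s hs).2]) h0 ht ht.1
      have m2 := monotoneOn_of_hasDerivWithinAt_self (convex_Icc 0 τ)
        (fun s hs => (hB s hs).add (hF i s hs)) (fun s hs => by linarith [(hb s hs).1]) h0 ht ht.1
      simp only [Pi.sub_apply, Pi.add_apply, hF0 i, mul_zero, Real.exp_zero, mul_one, sub_zero,
        add_zero] at m1 m2
      have : 0 ≤ M / 2 ^ (n + 1) := by positivity
      exact abs_le.2 ⟨by linarith, by linarith⟩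
  have hlim : Tendsto (fun n : ℕ => M / 2 ^ n * Real.exp (2 * C * t)) atTop (𝓝 0) := by
    have := (tendsto_pow_atTop_nhds_zero_of_lt_one (r := (1/2:ℝ)) (by norm_num)
      (by norm_num)).const_mul (M * Real.exp (2 * C * t))
    rw [mul_zero] at this
    refine this.congr fun n => ?_
    rw [one_div, inv_pow]
    ring
  exact abs_nonpos_iff.1 (ge_of_tendsto' hlim fun n => key n i t ht)

/-- The parts of the Eulerian system on a time set `I` needed to compare it with the Lagrangian
formulation, with the evolution equations given as derivatives along arbitrary curves. -/
structure IsEulerian (l : ℝ) (I : Set ℝ) (g gθ P Pθ Pθθ G Gθ : ℝ × ℝ → ℝ) : Prop where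
  cont_g : ContinuousOn g (I ×ˢ Icc 0 l)
  cont_gθ : ContinuousOn gθ (I ×ˢ Icc 0 l)
  cont_P : ContinuousOn P (I ×ˢ Icc 0 l)
  cont_Pθ : ContinuousOn Pθ (I ×ˢ Icc 0 l)
  cont_Pθθ : ContinuousOn Pθθ (I ×ˢ Icc 0 l)
  left : ∀ t ∈ I, G (t, 0) = 0
  right : ∀ t ∈ I, G (t, l) = 0
  deriv_P : ∀ t ∈ I, ∀ θ ∈ Icc 0 l, HasDerivWithinAt (fun y => P (t, y)) (Pθ (t, θ)) (Icc 0 l) θ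
  deriv_G : ∀ t ∈ I, ∀ θ ∈ Icc 0 l, HasDerivWithinAt (fun y => G (t, y)) (Gθ (t, θ)) (Icc 0 l) θ
  deriv_Gθ : ∀ t ∈ I, ∀ θ ∈ Icc 0 l,
    HasDerivWithinAt (fun y => Gθ (t, y)) (g (t, θ) - 4 * G (t, θ)) (Icc 0 l) θ
  material_g : ∀ φ : ℝ → ℝ, MapsTo φ I (Icc 0 l) → ∀ t ∈ I, ∀ w, HasDerivWithinAt φ w I t →
    HasDerivWithinAt (fun s => g (s, φ s))
      (2 * (Real.sin (φ t) * P (t, φ t) + Real.cos (φ t) * Pθ (t, φ t))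
        + (w - 2 * G (t, φ t)) * gθ (t, φ t)) I t
  material_P : ∀ φ : ℝ → ℝ, MapsTo φ I (Icc 0 l) → ∀ t ∈ I, ∀ w, HasDerivWithinAt φ w I t →
    HasDerivWithinAt (fun s => P (s, φ s))
      (P (t, φ t) * Gθ (t, φ t) + (w - 2 * G (t, φ t)) * Pθ (t, φ t)) I t
  material_Pθ : ∀ φ : ℝ → ℝ, MapsTo φ I (Icc 0 l) → ∀ t ∈ I, ∀ w, HasDerivWithinAt φ w I t →
    HasDerivWithinAt (fun s => Pθ (s, φ s))
      (P (t, φ t) * (g (t, φ t) - 4 * G (t, φ t)) - Gθ (t, φ t) * Pθ (t, φ t)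
        + (w - 2 * G (t, φ t)) * Pθθ (t, φ t)) I t

theorem fderivWithin_fderivWithin_apply_comm {S : Set (ℝ × ℝ)} {f : ℝ × ℝ → ℝ}
    (hS : UniqueDiffOn ℝ S) (hf : ContDiffOn ℝ (2 : ℕ) f S) {p : ℝ × ℝ} (hp : p ∈ S)
    (hp' : p ∈ closure (interior S)) (v w : ℝ × ℝ) :
    fderivWithin ℝ (fun q => fderivWithin ℝ f S q v) S p w
      = fderivWithin ℝ (fun q => fderivWithin ℝ f S q w) S p v := by
  have hd : DifferentiableWithinAt ℝ (fderivWithin ℝ f S) S p :=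
    (hf.fderivWithin (m := 1) hS (by norm_num)).differentiableOn (by simp) p hp
  have key : ∀ v w, fderivWithin ℝ (fun q => fderivWithin ℝ f S q v) S p w
      = fderivWithin ℝ (fderivWithin ℝ f S) S p w v := fun v w => by
    rw [(hd.hasFDerivWithinAt.clm_apply (hasFDerivWithinAt_const v p S)).fderivWithin (hS p hp)]
    simp
  rw [key, key]
  exact (hf p hp).isSymmSndFDerivWithinAt (by simp) hS hp' hp w v

theorem ContDiffOn.hasDerivWithinAt_along {I J K : Set ℝ} {f : ℝ × ℝ → ℝ} (hJ : J ⊆ I)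
    {n : WithTop ℕ∞}
    (hf : ContDiffOn ℝ n f (I ×ˢ K)) (hn : n ≠ 0) {φ : ℝ → ℝ} (hφ : MapsTo φ J K) {t w : ℝ}
    (ht : t ∈ J) (hw : HasDerivWithinAt φ w J t) :
    HasDerivWithinAt (fun s => f (s, φ s)) (fderivWithin ℝ f (I ×ˢ K) (t, φ t) (1, 0)
      + w * fderivWithin ℝ f (I ×ˢ K) (t, φ t) (0, 1)) J t := by
  have h := (hf.differentiableOn hn (t, φ t) ⟨hJ ht, hφ ht⟩).hasFDerivWithinAt
  have h2 : HasDerivWithinAt (fun s : ℝ => (s, φ s)) (1, w) J t :=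
    (hasDerivWithinAt_id t J).prodMk hw
  refine (h.comp_hasDerivWithinAt (t := I ×ˢ K) t h2 (fun s hs => ⟨hJ hs, hφ hs⟩)).congr_deriv ?_
  have : ((1:ℝ), w) = (1, 0) + w • (0, 1) := by ext <;> simp
  rw [this, map_add, map_smul, smul_eq_mul]

theorem IsSol1D.exists_isEulerian {l T : ℝ} {g P G : ℝ → ℝ → ℝ} (hsol : IsSol1D l T g P G)
    (hl : 0 < l) {J : Set ℝ} (hJ : J ⊆ Ico 0 T) :
    ∃ gθ Pθ Pθθ Gθ : ℝ × ℝ → ℝ, IsEulerian l J (fun q => g q.1 q.2) gθ (fun q => P q.1 q.2)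
      Pθ Pθθ (fun q => G q.1 q.2) Gθ := by
  obtain ⟨cg, cP, cG, bvp, eg, eP⟩ := hsol
  have huI : UniqueDiffOn ℝ (Ico 0 T) := uniqueDiffOn_Ico 0 T
  have huK := uniqueDiffOn_Icc hl
  set S : Set (ℝ × ℝ) := Ico 0 T ×ˢ Icc 0 l with hS
  have huS : UniqueDiffOn ℝ S := huI.prod huK
  have hJS : J ×ˢ Icc 0 l ⊆ S := prod_mono hJ Subset.rfl
  have hcl : ∀ p ∈ S, p ∈ closure (interior S) := fun p hp => by
    have hT : (0:ℝ) ≠ T := (hp.1.1.trans_lt hp.1.2).ne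
    rw [hS, interior_prod_eq, closure_prod_eq, interior_Ico, interior_Icc, closure_Ioo hT,
      closure_Ioo hl.ne]
    exact ⟨Ico_subset_Icc_self hp.1, hp.2⟩
  set D : (ℝ × ℝ → ℝ) → ℝ × ℝ → ℝ × ℝ → ℝ := fun f v q => fderivWithin ℝ f S q v with hD
  have cD : ∀ {f : ℝ × ℝ → ℝ}, (∀ n : ℕ, ContDiffOn ℝ n f S) → ∀ v, ∀ n : ℕ,
      ContDiffOn ℝ n (D f v) S := fun hf v n => (hf (n + 1)).fderivWithin_apply_pair huI huK v
  have dt : ∀ {f : ℝ × ℝ → ℝ}, (∀ n : ℕ, ContDiffOn ℝ n f S) → ∀ t ∈ Ico 0 T, ∀ θ ∈ Icc 0 l,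
      HasDerivWithinAt (fun s => f (s, θ)) (D f (1, 0) (t, θ)) (Ico 0 T) t :=
    fun hf t ht θ hθ => (hf 1).hasDerivWithinAt_fst (by simp) ht hθ
  have dθ : ∀ {f : ℝ × ℝ → ℝ}, (∀ n : ℕ, ContDiffOn ℝ n f S) → ∀ t ∈ Ico 0 T, ∀ θ ∈ Icc 0 l,
      HasDerivWithinAt (fun y => f (t, y)) (D f (0, 1) (t, θ)) (Icc 0 l) θ :=
    fun hf t ht θ hθ => (hf 1).hasDerivWithinAt_snd (by simp) ht hθ
  set g₁ : ℝ × ℝ → ℝ := fun q => g q.1 q.2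
  set P₁ : ℝ × ℝ → ℝ := fun q => P q.1 q.2
  set G₁ : ℝ × ℝ → ℝ := fun q => G q.1 q.2
  have dGθ : ∀ t ∈ Ico 0 T, ∀ θ ∈ Icc 0 l, HasDerivWithinAt (fun y => D G₁ (0, 1) (t, y))
      (g₁ (t, θ) - 4 * G₁ (t, θ)) (Icc 0 l) θ := fun t ht θ hθ => by
    have h1 := dθ (cD cG (0, 1)) t ht θ hθ
    have h2 := (bvp t ht).2.2 θ hθ
    rw [(h1.congr_of_mem (fun y hy => (dθ cG t ht y hy).derivWithin (huK y hy)) hθ).derivWithin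
      (huK θ hθ)] at h2
    refine h1.congr_deriv ?_
    simp only [g₁, G₁] at h2 ⊢
    linarith
  have gt : ∀ p ∈ S, D g₁ (1, 0) p = 2 * (Real.sin p.2 * P₁ p + Real.cos p.2 * D P₁ (0, 1) p)
      - 2 * G₁ p * D g₁ (0, 1) p := fun p hp => by
    have := eg p.1 hp.1 p.2 hp.2
    rw [(dt cg p.1 hp.1 p.2 hp.2).derivWithin (huI _ hp.1),
      (dθ cg p.1 hp.1 p.2 hp.2).derivWithin (huK _ hp.2),
      (dθ cP p.1 hp.1 p.2 hp.2).derivWithin (huK _ hp.2)] at this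
    linarith
  have Pt : ∀ p ∈ S, D P₁ (1, 0) p = P₁ p * D G₁ (0, 1) p - 2 * G₁ p * D P₁ (0, 1) p :=
    fun p hp => by
    have := eP p.1 hp.1 p.2 hp.2
    rw [(dt cP p.1 hp.1 p.2 hp.2).derivWithin (huI _ hp.1),
      (dθ cG p.1 hp.1 p.2 hp.2).derivWithin (huK _ hp.2),
      (dθ cP p.1 hp.1 p.2 hp.2).derivWithin (huK _ hp.2)] at this
    linarith
  have Pθt : ∀ p ∈ S, D (D P₁ (0, 1)) (1, 0) p = P₁ p * (g₁ p - 4 * G₁ p)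
      - D G₁ (0, 1) p * D P₁ (0, 1) p - 2 * G₁ p * D (D P₁ (0, 1)) (0, 1) p := fun p hp => by
    have hc : D (D P₁ (0, 1)) (1, 0) p = D (D P₁ (1, 0)) (0, 1) p :=
      fderivWithin_fderivWithin_apply_comm huS (cP 2) hp (hcl p hp) _ _
    rw [hc]
    have h1 := dθ (cD cP (1, 0)) p.1 hp.1 p.2 hp.2
    have h2 := ((dθ cP p.1 hp.1 p.2 hp.2).mul (dGθ p.1 hp.1 p.2 hp.2)).sub
      (((dθ cG p.1 hp.1 p.2 hp.2).const_mul 2).mul (dθ (cD cP (0, 1)) p.1 hp.1 p.2 hp.2))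
    refine (huK _ hp.2).eq_deriv _ h1 ((h2.congr_of_mem (fun y hy => Pt (p.1, y) ⟨hp.1, hy⟩)
      hp.2).congr_deriv ?_)
    ring
  refine ⟨D g₁ (0, 1), D P₁ (0, 1), D (D P₁ (0, 1)) (0, 1), D G₁ (0, 1),
    ((cg 0).continuousOn).mono hJS, ((cD cg _ 0).continuousOn).mono hJS,
    ((cP 0).continuousOn).mono hJS, ((cD cP _ 0).continuousOn).mono hJS,
    ((cD (cD cP _) _ 0).continuousOn).mono hJS, fun t ht => (bvp t (hJ ht)).1,
    fun t ht => (bvp t (hJ ht)).2.1, fun t ht => dθ cP t (hJ ht), fun t ht => dθ cG t (hJ ht),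
    fun t ht => dGθ t (hJ ht), fun φ hφ t ht w hw => ?_, fun φ hφ t ht w hw => ?_,
    fun φ hφ t ht w hw => ?_⟩
  · refine ((cg 1).hasDerivWithinAt_along hJ (by simp) hφ ht hw).congr_deriv ?_
    have := gt (t, φ t) ⟨hJ ht, hφ ht⟩
    simp only [hD] at this ⊢
    rw [this]
    ring
  · refine ((cP 1).hasDerivWithinAt_along hJ (by simp) hφ ht hw).congr_deriv ?_
    have := Pt (t, φ t) ⟨hJ ht, hφ ht⟩
    simp only [hD] at this ⊢
    rw [this]
    ring
  · refine ((cD cP (0, 1) 1).hasDerivWithinAt_along hJ (by simp) hφ ht hw).congr_deriv ?_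
    have := Pθt (t, φ t) ⟨hJ ht, hφ ht⟩
    simp only [hD] at this ⊢
    rw [this]
    ring

/-- A priori bound for the difference of two stream functions in Lagrangian coordinates. -/
theorem abs_stream_le {l E N : ℝ} (hl : 0 ≤ l) (hS : 0 < Real.sin (2 * l)) {φ κ d e γ : ℝ → ℝ}
    (dφ : ∀ a ∈ Icc 0 l, HasDerivWithinAt φ (κ a) (Icc 0 l) a)
    (dd : ∀ a ∈ Icc 0 l, HasDerivWithinAt d (κ a * e a) (Icc 0 l) a)
    (de : ∀ a ∈ Icc 0 l, HasDerivWithinAt e (κ a * (γ a - 4 * d a)) (Icc 0 l) a)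
    (hκ : ∀ a ∈ Icc 0 l, |κ a| ≤ E) (hγ : ∀ a ∈ Icc 0 l, |γ a| ≤ N)
    (φ0 : φ 0 = 0) (φl : φ l = l) (d0 : d 0 = 0) (dl : d l = 0) {a : ℝ} (ha : a ∈ Icc 0 l) :
    |d a| ≤ 2 * (E * l) / Real.sin (2 * l) * N ∧ |e a| ≤ 2 * (E * l) / Real.sin (2 * l) * N := by
  have hE : 0 ≤ E := (abs_nonneg _).trans (hκ a ha)
  have hN : 0 ≤ N := (abs_nonneg _).trans (hγ a ha)
  have h0m : (0:ℝ) ∈ Icc 0 l := left_mem_Icc.2 hl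
  have hlm : l ∈ Icc 0 l := right_mem_Icc.2 hl
  have est : ∀ (X w : ℝ → ℝ), (∀ a ∈ Icc 0 l, HasDerivWithinAt X (κ a * γ a * Real.sin (w a))
      (Icc 0 l) a) → ∀ b ∈ Icc 0 l, X b = 0 → |X a| ≤ E * N * l := by
    intro X w hX b hb hXb
    have := (convex_Icc 0 l).norm_image_sub_le_of_norm_hasDerivWithin_le (C := E * N) hX
      (fun x hx => by
        rw [norm_mul, norm_mul]
        calc ‖κ x‖ * ‖γ x‖ * ‖Real.sin (w x)‖ ≤ E * N * 1 :=
              mul_le_mul (mul_le_mul (hκ x hx) (hγ x hx) (norm_nonneg _) hE)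
                (Real.abs_sin_le_one _) (norm_nonneg _) (by positivity)
          _ = E * N := mul_one _) hb ha
    rw [hXb, sub_zero] at this
    refine this.trans (mul_le_mul_of_nonneg_left ?_ (by positivity))
    rw [Real.norm_eq_abs, abs_le]
    constructor <;> linarith [ha.1, ha.2, hb.1, hb.2]
  have hX := est (fun a => e a * Real.sin (2 * φ a) - 2 * d a * Real.cos (2 * φ a))
    (fun a => 2 * φ a) (fun a ha => by
      refine (((de a ha).mul ((dφ a ha).const_mul 2).sin).sub
        (((dd a ha).const_mul 2).mul ((dφ a ha).const_mul 2).cos)).congr_deriv ?_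
      ring) 0 h0m (by simp [φ0, d0])
  have hY := est (fun a => e a * Real.sin (2 * l - 2 * φ a) + 2 * d a * Real.cos (2 * l - 2 * φ a))
    (fun a => 2 * l - 2 * φ a) (fun a ha => by
      refine (((de a ha).mul (((dφ a ha).const_mul 2).const_sub (2 * l)).sin).add
        (((dd a ha).const_mul 2).mul
          (((dφ a ha).const_mul 2).const_sub (2 * l)).cos)).congr_deriv ?_
      ring) l hlm (by simp [φl, dl])
  set X := e a * Real.sin (2 * φ a) - 2 * d a * Real.cos (2 * φ a)
  set Y := e a * Real.sin (2 * l - 2 * φ a) + 2 * d a * Real.cos (2 * l - 2 * φ a)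
  have hsum : Real.sin (2 * l) = Real.sin (2 * φ a) * Real.cos (2 * l - 2 * φ a)
      + Real.cos (2 * φ a) * Real.sin (2 * l - 2 * φ a) := by
    rw [← Real.sin_add]
    congr 1
    ring
  have bd : ∀ x y u v : ℝ, |u| ≤ 1 → |v| ≤ 1 → |x| ≤ E * N * l → |y| ≤ E * N * l →
      |x * u + y * v| ≤ 2 * (E * N * l) := fun x y u v hu hv hx hy => by
    refine (abs_add_le _ _).trans ?_
    rw [abs_mul, abs_mul]
    have h1 := mul_le_mul hx hu (abs_nonneg _) (by positivity)
    have h2 := mul_le_mul hy hv (abs_nonneg _) (by positivity)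
    linarith
  have e1 : 2 * d a * Real.sin (2 * l)
      = Y * Real.sin (2 * φ a) + X * -Real.sin (2 * l - 2 * φ a) := by
    simp only [X, Y]
    rw [hsum]
    ring
  have e2 : e a * Real.sin (2 * l)
      = X * Real.cos (2 * l - 2 * φ a) + Y * Real.cos (2 * φ a) := by
    simp only [X, Y]
    rw [hsum]
    ring
  have b1 := bd Y X _ _ (Real.abs_sin_le_one (2 * φ a))
    ((abs_neg _).trans_le (Real.abs_sin_le_one (2 * l - 2 * φ a))) hY hX
  have b2 := bd X Y _ _ (Real.abs_cos_le_one (2 * l - 2 * φ a))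
    (Real.abs_cos_le_one (2 * φ a)) hX hY
  rw [← e1, abs_mul, abs_mul, abs_two, abs_of_pos hS] at b1
  rw [← e2, abs_mul, abs_of_pos hS] at b2
  have hd := mul_nonneg (abs_nonneg (d a)) hS.le
  constructor
  · rw [div_mul_eq_mul_div, le_div_iff₀ hS]
    linarith
  · rw [div_mul_eq_mul_div, le_div_iff₀ hS]
    linarith

/-- The Eulerian and the Lagrangian solution agree along the Lagrangian flow. -/
theorem IsLag.eq_of_isEulerian {l τ : ℝ} {I : Set ℝ} {z m h m₁ h₁ m₂ h₂ : ℝ × ℝ → ℝ}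
    (H : IsLag l I z m h m₁ h₁ m₂ h₂) (hI : Convex ℝ I) (huI : UniqueDiffOn ℝ I) (h0 : (0:ℝ) ∈ I)
    (hl : 0 < l) (hl2 : l < Real.pi / 2) (hτ : 0 ≤ τ) (hJ : Icc 0 τ ⊆ I)
    {g gθ P Pθ Pθθ G Gθ : ℝ × ℝ → ℝ} (U : IsEulerian l (Icc 0 τ) g gθ P Pθ Pθθ G Gθ)
    (hg : ∀ θ ∈ Icc 0 l, g (0, θ) = 0) (hP : ∀ θ ∈ Icc 0 l, P (0, θ) = θ ^ 2)
    {t a : ℝ} (ht : t ∈ Icc 0 τ) (ha : a ∈ Icc 0 l) : g (t, lagPhi z (t, a)) = h (t, a) := by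
  have hS := sin_two_mul_pos hl hl2
  have h0J : (0:ℝ) ∈ Icc 0 τ := left_mem_Icc.2 hτ
  have huK := uniqueDiffOn_Icc hl
  have hmaps : ∀ a ∈ Icc 0 l, MapsTo (fun s => lagPhi z (s, a)) (Icc 0 τ) (Icc 0 l) :=
    fun a ha s hs => H.phi_mem hI huI h0 hl hl2 (hJ hs) ha
  have hJS : Icc 0 τ ×ˢ Icc 0 l ⊆ I ×ˢ Icc 0 l := prod_mono hJ Subset.rfl
  have hcomp : IsCompact (Icc 0 τ ×ˢ Icc 0 l) := isCompact_Icc.prod isCompact_Icc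
  have hΦ : ContinuousOn (fun p : ℝ × ℝ => (p.1, lagPhi z p)) (Icc 0 τ ×ˢ Icc 0 l) :=
    continuousOn_fst.prodMk ((H.contPhi hI huI hl).mono hJS)
  have hΦm : MapsTo (fun p : ℝ × ℝ => (p.1, lagPhi z p)) (Icc 0 τ ×ˢ Icc 0 l)
      (Icc 0 τ ×ˢ Icc 0 l) := fun p hp => ⟨hp.1, hmaps p.2 hp.2 hp.1⟩
  obtain ⟨A, hA⟩ := hcomp.exists_bound_of_continuousOn
    (f := fun p => (lagLam l z h p, h p, lagGam l z h p, P p, Pθ p, Pθθ p, gθ p))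
    (((H.contLam hI huI hl).mono hJS).prodMk ((H.contH.mono hJS).prodMk
      (((H.contGam hI huI hl).mono hJS).prodMk (U.cont_P.prodMk (U.cont_Pθ.prodMk
        (U.cont_Pθθ.prodMk U.cont_gθ))))))
  simp only [norm_prod_le_iff, Real.norm_eq_abs] at hA
  obtain ⟨E, hE⟩ := hcomp.exists_bound_of_continuousOn (H.contKap.mono hJS)
  have hA0 : 0 ≤ A := (abs_nonneg _).trans (hA (0, a) ⟨h0J, ha⟩).1
  have hE0 : 0 ≤ E := (norm_nonneg _).trans (hE (0, a) ⟨h0J, ha⟩)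
  set B := 2 * (E * l) / Real.sin (2 * l) with hB
  have hB0 : 0 ≤ B := by positivity
  set q : ℝ × ℝ → ℝ := fun p => P (p.1, lagPhi z p) - p.2 ^ 2 * Real.exp (z p) with hq
  set ρ : ℝ × ℝ → ℝ := fun p =>
    Pθ (p.1, lagPhi z p) - (2 * p.2 + p.2 ^ 2 * m p) * Real.exp (-z p) with hρ
  set γ : ℝ × ℝ → ℝ := fun p => g (p.1, lagPhi z p) - h p with hγ
  set d : ℝ × ℝ → ℝ := fun p => G (p.1, lagPhi z p) - lagGam l z h p with hd
  set e : ℝ × ℝ → ℝ := fun p => Gθ (p.1, lagPhi z p) - lagLam l z h p with he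
  have cz := H.contZ.mono hJS
  have cm := H.lin.cont₁.mono hJS
  obtain ⟨M, hM⟩ := hcomp.exists_bound_of_continuousOn (f := fun p => (q p, ρ p, γ p))
    (((U.cont_P.comp hΦ hΦm).sub (by fun_prop)).prodMk (((U.cont_Pθ.comp hΦ hΦm).sub
      (by fun_prop)).prodMk ((U.cont_g.comp hΦ hΦm).sub (H.contH.mono hJS))))
  simp only [norm_prod_le_iff, Real.norm_eq_abs] at hM
  have hde : ∀ t ∈ Icc 0 τ, ∀ N, (∀ a ∈ Icc 0 l, |γ (t, a)| ≤ N) → ∀ a ∈ Icc 0 l,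
      |d (t, a)| ≤ B * N ∧ |e (t, a)| ≤ B * N := fun t ht N hN a ha => by
    have hm : MapsTo (fun a => lagPhi z (t, a)) (Icc 0 l) (Icc 0 l) := fun a ha => hmaps a ha ht
    have hφ := fun a (ha : a ∈ Icc 0 l) => H.hasDerivWithinAt_phi_snd hl (hJ ht) ha
    have hφl := H.phi_right hI huI h0 hl hl2 (hJ ht)
    refine abs_stream_le (φ := fun a => lagPhi z (t, a)) (κ := fun a => lagKap z (t, a))
      (γ := fun a => γ (t, a)) (d := fun a => d (t, a)) (e := fun a => e (t, a)) hl.le hS hφ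
      (fun a ha => ?_) (fun a ha => ?_) (fun a ha => hE (t, a) ⟨ht, ha⟩) hN
      (lagPhi_zero _) hφl ?_ ?_ ha
    · refine (((U.deriv_G t ht _ (hm ha)).comp a (hφ a ha) hm).sub
        (hasDerivWithinAt_lagGam_snd hI huI hl H.contZ H.contH hS.ne' (hJ ht) ha)).congr_deriv ?_
      simp only [he]
      ring
    · refine (((U.deriv_Gθ t ht _ (hm ha)).comp a (hφ a ha) hm).sub
        (hasDerivWithinAt_lagLam_snd hI huI hl H.contZ H.contH hS.ne' (hJ ht) ha)).congr_deriv ?_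
      simp only [hγ, hd]
      ring
    · simp [hd, U.left t ht]
    · simp only [hd, hφl, U.right t ht, H.gam_right hI huI h0 hl hl2 (hJ ht), sub_zero]
  let F : Fin 3 × Icc 0 l → ℝ → ℝ := fun i s =>
    ![q (s, i.2), ρ (s, i.2), γ (s, i.2)] i.1
  let F' : Fin 3 × Icc 0 l → ℝ → ℝ := fun i s =>
    ![q (s, i.2) * lagLam l z h (s, i.2) + P (s, lagPhi z (s, i.2)) * e (s, i.2)
        - 2 * (Pθ (s, lagPhi z (s, i.2)) * d (s, i.2)),
      q (s, i.2) * (h (s, i.2) - 4 * lagGam l z h (s, i.2)) - ρ (s, i.2) * lagLam l z h (s, i.2)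
        + P (s, lagPhi z (s, i.2)) * (γ (s, i.2) - 4 * d (s, i.2))
        - Pθ (s, lagPhi z (s, i.2)) * e (s, i.2)
        - 2 * (Pθθ (s, lagPhi z (s, i.2)) * d (s, i.2)),
      2 * (Real.sin (lagPhi z (s, i.2)) * q (s, i.2) + Real.cos (lagPhi z (s, i.2)) * ρ (s, i.2))
        - 2 * (gθ (s, lagPhi z (s, i.2)) * d (s, i.2))] i.1
  have key := eq_zero_of_sup_growth (F := F) (F' := F') (τ := τ) (C := 4 + 8 * A + 8 * (A * B))
    (M := M) (by positivity) ?_ ?_ ?_ ?_ (2, ⟨a, ha⟩) ht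
  · exact sub_eq_zero.1 key
  · rintro ⟨i, a, ha⟩ t ht
    have dφ := (H.hasDerivWithinAt_phi_fst hI huI hl hl2 (hJ ht) ha).mono hJ
    have dz := (H.derivZ t (hJ ht) a ha).mono hJ
    fin_cases i
    · refine ((U.material_P _ (hmaps a ha) t ht _ dφ).sub (dz.exp.const_mul (a ^ 2))).congr_deriv ?_
      simp only [F', q, e, d, Fin.zero_eta, Matrix.cons_val_zero]
      ring
    · refine ((U.material_Pθ _ (hmaps a ha) t ht _ dφ).sub
        ((((H.lin.deriv₁ t (hJ ht) a ha).mono hJ).const_mul (a ^ 2)).const_add (2 * a) |>.mul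
          dz.neg.exp)).congr_deriv ?_
      simp only [F', q, ρ, γ, e, d, lagSrc₁, lagKap, two_mul (z _), Real.exp_add, Pi.neg_apply,
        Real.exp_neg, Fin.mk_one, Matrix.cons_val_one, Matrix.cons_val_zero]
      field_simp
      ring
    · refine ((U.material_g _ (hmaps a ha) t ht _ dφ).sub
        ((H.lin.deriv₂ t (hJ ht) a ha).mono hJ)).congr_deriv ?_
      simp only [F', q, ρ, γ, d, lagCoef, lagSrc₂, Fin.reduceFinMk, Matrix.cons_val]
      ring
  · intro t ht N hN
    have hqN : ∀ a ∈ Icc 0 l, |q (t, a)| ≤ N := fun a ha => hN (0, ⟨a, ha⟩)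
    have hρN : ∀ a ∈ Icc 0 l, |ρ (t, a)| ≤ N := fun a ha => hN (1, ⟨a, ha⟩)
    have hγN : ∀ a ∈ Icc 0 l, |γ (t, a)| ≤ N := fun a ha => hN (2, ⟨a, ha⟩)
    rintro ⟨i, a, ha⟩
    have hN0 : 0 ≤ N := (abs_nonneg _).trans (hqN a ha)
    obtain ⟨bd, be⟩ := hde t ht N hγN a ha
    obtain ⟨bΛ, bh, bΓ, -⟩ := hA (t, a) ⟨ht, ha⟩
    obtain ⟨-, -, -, bP, bPθ, bPθθ, bgθ⟩ := hA (t, lagPhi z (t, a)) ⟨ht, hmaps a ha ht⟩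
    have bq := hqN a ha
    have bρ := hρN a ha
    have bγ := hγN a ha
    have mul : ∀ {x y X Y : ℝ}, |x| ≤ X → |y| ≤ Y → -(X * Y) ≤ x * y ∧ x * y ≤ X * Y :=
      fun hx hy => abs_le.1 (by
        rw [abs_mul]
        exact mul_le_mul hx hy (abs_nonneg _) ((abs_nonneg _).trans hx))
    have hAN : 0 ≤ A * N := by positivity
    have hABN : 0 ≤ A * (B * N) := by positivity
    fin_cases i
    · have e1 := mul bq bΛ
      have e2 := mul bP be
      have e3 := mul bPθ bd
      simp only [F', Fin.zero_eta, Matrix.cons_val_zero]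
      rw [abs_le]
      constructor <;> linarith [e1.1, e1.2, e2.1, e2.2, e3.1, e3.2]
    · have e1 := mul bq bh
      have e1' := mul bq bΓ
      have e2 := mul bρ bΛ
      have e3 := mul bP bγ
      have e3' := mul bP bd
      have e4 := mul bPθ be
      have e5 := mul bPθθ bd
      simp only [F', Fin.mk_one, Matrix.cons_val_one, Matrix.cons_val_zero]
      rw [abs_le]
      constructor <;> linarith [e1.1, e1.2, e1'.1, e1'.2, e2.1, e2.2, e3.1, e3.2, e3'.1, e3'.2,
        e4.1, e4.2, e5.1, e5.2]
    · have e1 := mul (Real.abs_sin_le_one (lagPhi z (t, a))) bq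
      have e2 := mul (Real.abs_cos_le_one (lagPhi z (t, a))) bρ
      have e3 := mul bgθ bd
      simp only [F', Fin.reduceFinMk, Matrix.cons_val]
      rw [abs_le]
      constructor <;> linarith [e1.1, e1.2, e2.1, e2.2, e3.1, e3.2]
  · rintro ⟨i, a, ha⟩
    have hφ := H.phi_init hl ha
    have hPθ : Pθ (0, a) = 2 * a := by
      refine (huK a ha).eq_deriv _ (U.deriv_P 0 h0J a ha) ?_
      refine HasDerivWithinAt.congr_of_mem ?_ hP ha
      simpa using (hasDerivAt_pow 2 a).hasDerivWithinAt
    fin_cases i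
    · simp [F, q, hφ, hP a ha, H.initZ a ha]
    · simp [F, ρ, hφ, hPθ, H.initZ a ha, H.initM a ha]
    · simp [F, γ, hφ, hg a ha, H.initH a ha]
  · rintro ⟨i, a, ha⟩ t ht
    obtain ⟨h1, h2, h3⟩ := hM (t, a) ⟨ht, ha⟩
    fin_cases i
    exacts [h1, h2, h3]

/-- An Eulerian solution cannot exist beyond the blow-up time of the Lagrangian solution. -/
theorem IsLag.not_isSol1D {l ε T T' : ℝ} {z m h m₁ h₁ m₂ h₂ : ℝ × ℝ → ℝ}
    (H : IsLag l (Ioo (-ε) T) z m h m₁ h₁ m₂ h₂) (hε : 0 < ε) (hT : 0 < T) (hl : 0 < l)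
    (hl2 : l < Real.pi / 2) (hblow : Tendsto (fun t => h (t, l)) (𝓝[<] T) atTop) (hTT : T < T')
    {g P G : ℝ → ℝ → ℝ} (hsol : IsSol1D l T' g P G) :
    ¬ ∀ θ ∈ Icc 0 l, g 0 θ = 0 ∧ P 0 θ = θ ^ 2 := by
  intro hinit
  have hI : Convex ℝ (Ioo (-ε) T) := convex_Ioo _ _
  have huI : UniqueDiffOn ℝ (Ioo (-ε) T) := isOpen_Ioo.uniqueDiffOn
  have h0 : (0:ℝ) ∈ Ioo (-ε) T := ⟨by linarith, hT⟩
  have hlm : l ∈ Icc 0 l := right_mem_Icc.2 hl.le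
  have heq : ∀ t ∈ Ico 0 T, h (t, l) = g t l := fun t ht => by
    obtain ⟨_, _, _, _, U⟩ := hsol.exists_isEulerian hl
      (J := Icc 0 t) fun s hs => ⟨hs.1, (hs.2.trans_lt ht.2).trans hTT⟩
    have := H.eq_of_isEulerian hI huI h0 hl hl2 ht.1
      (fun s hs => ⟨by linarith [hs.1], hs.2.trans_lt ht.2⟩) U (fun θ hθ => (hinit θ hθ).1)
      (fun θ hθ => (hinit θ hθ).2) (right_mem_Icc.2 ht.1) hlm
    rw [← this, H.phi_right hI huI h0 hl hl2 ⟨by linarith [ht.1], ht.2⟩]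
  have hc : ContinuousOn (fun t => g t l) (Ico 0 T') :=
    (hsol.1 0).continuousOn.comp (f := fun t : ℝ => (t, l)) (by fun_prop) fun t ht => ⟨ht, hlm⟩
  have hlim : Tendsto (fun t => g t l) (𝓝[<] T) (𝓝 (g T l)) := by
    refine (hc T ⟨hT.le, hTT⟩).mono_left (nhdsWithin_le_iff.2 ?_)
    filter_upwards [Ico_mem_nhdsLT hT] with t ht using ⟨ht.1, ht.2.trans hTT⟩
  refine not_tendsto_nhds_of_tendsto_atTop (hblow.congr' ?_) _ hlim
  filter_upwards [Ico_mem_nhdsLT hT] with t ht using heq t ht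

/-- Theorem 4.1: finite-time blow-up for the 1D system.  Let
`0 < l < π/2` and take initial data `g₀ ≡ 0`, `P₀(θ) = θ²`.  Then the unique local-in-time
smooth solution `(g,P)` cannot be extended past some finite time `T*`, and
`lim_{t→T*} ‖g(t,·)‖_{L^∞([0,l])} = +∞`. -/
theorem stmt_10 (l : ℝ) (hl0 : 0 < l) (hl : l < Real.pi / 2) :
    ∃ Tstar > 0, ∃ g P G : ℝ → ℝ → ℝ,
      IsSol1D l Tstar g P G ∧
      (∀ θ ∈ Icc (0:ℝ) l, g 0 θ = 0 ∧ P 0 θ = θ ^ 2) ∧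
      Tendsto (fun t => sSup {y | ∃ θ ∈ Icc (0:ℝ) l, y = |g t θ|})
        (nhdsWithin Tstar (Iio Tstar)) atTop ∧
      ∀ T, Tstar < T →
        ¬ ∃ g' P' G' : ℝ → ℝ → ℝ, IsSol1D l T g' P' G' ∧
          ∀ θ ∈ Icc (0:ℝ) l, g' 0 θ = 0 ∧ P' 0 θ = θ ^ 2 := by
  obtain ⟨ε, hε, T, hT, z, m, h, m₁, h₁, m₂, h₂, H, hb⟩ := exists_isLag_blowup hl0 hl
  obtain ⟨g, P, G, hsol, hinit, hsup⟩ := H.exists_isSol1D hε hT hl0 hl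
  refine ⟨T, hT, g, P, G, hsol, hinit, hb.congr' ?_, ?_⟩
  · filter_upwards [Ico_mem_nhdsLT hT] with t ht using (hsup t ht).symm
  · rintro T' hTT ⟨g', P', G', hs, hi⟩
    exact H.not_isSol1D hε hT hl0 hl hb hTT hs hi

end
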